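/- arXiv:2106.08860 — 3 statements merged into one kernel-verified Lean document; each statement's English description precedes it below -/
import Mathlib

section
/- The family of translates {g_tλ_{a,b}}_{t>0} has no escape of mass — that is, for every ε > 0 there exists a compact set K ⊆ X such that (g_tλ_{a,b})(K) > 1−ε for all t > 0 — if and only if (a,b) ∉ W₂^∞. -/
open MeasureTheory Matrix Filter Topology ENNReal

noncomputable section

/-- `G = SL(3,ℝ)`. -/
abbrev G : Type := Matrix.SpecialLinearGroup (Fin 3) ℝ

instance : TopologicalSpace G :=
  TopologicalSpace.induced (fun g : G => (g : Matrix (Fin 3) (Fin 3) ℝ)) inferInstance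

/-- `Γ = SL(3,ℤ)`, viewed as a (discrete) subgroup of `G`. -/
def Gamma : Subgroup G := (Matrix.SpecialLinearGroup.map (n := Fin 3) (Int.castRingHom ℝ)).range

/-- `X = G/Γ` with the quotient topology. -/
abbrev X : Type := G ⧸ Gamma

instance : MeasurableSpace X := borel X

/-- `x₀ = eΓ ∈ X`. -/
def x₀ : X := ↑(1 : G)

/-- `g_t = diag(e^{2t}, e^{-t}, e^{-t})`. -/
def gSL (t : ℝ) : G :=
  ⟨Matrix.diagonal ![Real.exp (2*t), Real.exp (-t), Real.exp (-t)], by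
    rw [Matrix.det_diagonal, Fin.prod_univ_three]
    simp [← Real.exp_add]
    ring_nf⟩

/-- `φ_{a,b}(s)`, the unipotent matrix with first row `(1, s, as+b)`. -/
def phiSL (a b s : ℝ) : G :=
  ⟨!![1, s, a*s+b; 0, 1, 0; 0, 0, 1], by
    simp [Matrix.det_fin_three, Matrix.vecHead, Matrix.vecTail]⟩

/-- `λ_{a,b}` : the push-forward of the normalized Lebesgue measure on `I = [s₁,s₂]`
under `s ↦ φ_{a,b}(s)·x₀`. -/
def lambdaAB (a b s₁ s₂ : ℝ) : Measure X :=
  Measure.map (fun s => phiSL a b s • x₀)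
    ((volume (Set.Icc s₁ s₂))⁻¹ • volume.restrict (Set.Icc s₁ s₂))

/-- `g_t λ_{a,b}` : the translate of `λ_{a,b}` by `g_t`. -/
def gtLambda (a b s₁ s₂ t : ℝ) : Measure X :=
  Measure.map (fun x => gSL t • x) (lambdaAB a b s₁ s₂)

/-- `(a,b) ∈ W₂^∞` : for every `C > 0` the system
`|qb+p₁| ≤ C q⁻²`, `|qa+p₂| ≤ C q⁻²` has a solution `(p₁,p₂,q) ∈ ℤ × ℤ × ℤ₊`. -/
def W2inf (a b : ℝ) : Prop :=
  ∀ C > (0:ℝ), ∃ p₁ p₂ q : ℤ, 0 < q ∧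
    |(q : ℝ) * b + (p₁ : ℝ)| ≤ C / (q : ℝ) ^ 2 ∧
    |(q : ℝ) * a + (p₂ : ℝ)| ≤ C / (q : ℝ) ^ 2


/-! ### Covering lemma -/

lemma exists_right_max (x : ℝ) (s : Finset (Set ℝ)) (hs : s.Nonempty)
    (hc : ∀ J ∈ s, J.OrdConnected ∧ x ∈ J) : ∃ J₁ ∈ s, ∀ J ∈ s, J ∩ Set.Ici x ⊆ J₁ := by
  classical
  induction hs using Finset.Nonempty.cons_induction with
  | singleton A => exact ⟨A, by simp, by simp⟩
  | cons A s hA hs ih =>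
    obtain ⟨J₁, h1, h2⟩ := ih (fun J hJ => hc J (by simp [hJ]))
    by_cases hsub : A ∩ Set.Ici x ⊆ J₁
    · refine ⟨J₁, by simp [h1], fun J hJ => ?_⟩
      rcases Finset.mem_cons.1 hJ with rfl | hJ
      · exact hsub
      · exact h2 J hJ
    · obtain ⟨y, ⟨hyA, hxy⟩, hy1⟩ := Set.not_subset.1 hsub
      refine ⟨A, by simp, fun J hJ => ?_⟩
      rcases Finset.mem_cons.1 hJ with rfl | hJ
      · exact Set.inter_subset_left
      · rintro z ⟨hzJ, hxz⟩
        have hz1 : z ∈ J₁ := h2 J hJ ⟨hzJ, hxz⟩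
        have : z ≤ y := by
          by_contra hlt
          push Not at hlt
          have hJ1 := hc J₁ (by simp [h1])
          exact hy1 (hJ1.1.out hJ1.2 hz1 ⟨hxy, hlt.le⟩)
        have hA' := hc A (by simp)
        exact hA'.1.out hA'.2 hyA ⟨hxz, this⟩

lemma exists_left_max (x : ℝ) (s : Finset (Set ℝ)) (hs : s.Nonempty)
    (hc : ∀ J ∈ s, J.OrdConnected ∧ x ∈ J) : ∃ J₁ ∈ s, ∀ J ∈ s, J ∩ Set.Iic x ⊆ J₁ := by
  classical
  induction hs using Finset.Nonempty.cons_induction with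
  | singleton A => exact ⟨A, by simp, by simp⟩
  | cons A s hA hs ih =>
    obtain ⟨J₁, h1, h2⟩ := ih (fun J hJ => hc J (by simp [hJ]))
    by_cases hsub : A ∩ Set.Iic x ⊆ J₁
    · refine ⟨J₁, by simp [h1], fun J hJ => ?_⟩
      rcases Finset.mem_cons.1 hJ with rfl | hJ
      · exact hsub
      · exact h2 J hJ
    · obtain ⟨y, ⟨hyA, hxy⟩, hy1⟩ := Set.not_subset.1 hsub
      refine ⟨A, by simp, fun J hJ => ?_⟩
      rcases Finset.mem_cons.1 hJ with rfl | hJ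
      · exact Set.inter_subset_left
      · rintro z ⟨hzJ, hxz⟩
        have hz1 : z ∈ J₁ := h2 J hJ ⟨hzJ, hxz⟩
        have : y ≤ z := by
          by_contra hlt
          push Not at hlt
          have hJ1 := hc J₁ (by simp [h1])
          exact hy1 (hJ1.1.out hz1 hJ1.2 ⟨hlt.le, hxy⟩)
        have hA' := hc A (by simp)
        exact hA'.1.out hyA hA'.2 ⟨this, hxz⟩

lemma covering (I E : Set ℝ) (hI : I.OrdConnected) (F : Finset (Set ℝ)) (c : ℝ≥0∞)
    (hF : ∀ J ∈ F, J.OrdConnected ∧ J ⊆ I) (hE : ∀ s ∈ E, ∃ J ∈ F, s ∈ J)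
    (hc : ∀ J ∈ F, volume (E ∩ J) ≤ c * volume J) : volume E ≤ 2 * c * volume I := by
  classical
  let P : Finset (Set ℝ) → Prop := fun t => t ⊆ F ∧ ∀ s ∈ E, ∃ J ∈ t, s ∈ J
  obtain ⟨t, ⟨htF, htE⟩, hmin⟩ : ∃ t, P t ∧ ∀ t', P t' → ¬ t' ⊂ t := by
    have := WellFounded.has_min (wellFounded_lt (α := Finset (Set ℝ))) {t | P t}
      ⟨F, Finset.Subset.refl _, hE⟩
    obtain ⟨t, h1, h2⟩ := this
    exact ⟨t, h1, fun t' ht' => h2 t' ht'⟩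
  have hmult : ∀ x, (t.filter (fun J => x ∈ J)).card ≤ 2 := by
    intro x
    by_contra hcon
    push Not at hcon
    set tx := t.filter (fun J => x ∈ J) with htx
    have hne : tx.Nonempty := Finset.card_pos.1 (by omega)
    have hcx : ∀ J ∈ tx, J.OrdConnected ∧ x ∈ J := fun J hJ => by
      rw [htx, Finset.mem_filter] at hJ
      exact ⟨(hF J (htF hJ.1)).1, hJ.2⟩
    obtain ⟨J₁, h1, h1'⟩ := exists_right_max x tx hne hcx
    obtain ⟨J₂, h2, h2'⟩ := exists_left_max x tx hne hcx
    obtain ⟨J, hJ, hJn⟩ : ∃ J ∈ tx, J ∉ ({J₁, J₂} : Finset (Set ℝ)) := by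
      by_contra hno
      push Not at hno
      have := Finset.card_le_card (fun J hJ => hno J hJ : tx ⊆ {J₁, J₂})
      have := Finset.card_le_two (a := J₁) (b := J₂)
      omega
    simp only [Finset.mem_insert, Finset.mem_singleton, not_or] at hJn
    have hJt : J ∈ t := (Finset.mem_filter.1 hJ).1
    refine hmin (t.erase J) ⟨(Finset.erase_subset _ _).trans htF, fun s hs => ?_⟩
      (Finset.erase_ssubset hJt)
    obtain ⟨J', hJ't, hsJ'⟩ := htE s hs
    by_cases hJJ : J' = J
    · subst hJJ
      rcases le_total x s with hxs | hxs
      · exact ⟨J₁, Finset.mem_erase.2 ⟨Ne.symm hJn.1, (Finset.mem_filter.1 h1).1⟩,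
          h1' _ hJ ⟨hsJ', hxs⟩⟩
      · exact ⟨J₂, Finset.mem_erase.2 ⟨Ne.symm hJn.2, (Finset.mem_filter.1 h2).1⟩,
          h2' _ hJ ⟨hsJ', hxs⟩⟩
    · exact ⟨J', Finset.mem_erase.2 ⟨hJJ, hJ't⟩, hsJ'⟩
  have hsum : ∑ J ∈ t, volume J ≤ 2 * volume I := by
    have hm : ∀ J ∈ t, MeasurableSet J := fun J hJ => (hF J (htF hJ)).1.measurableSet
    calc ∑ J ∈ t, volume J = ∑ J ∈ t, ∫⁻ x, J.indicator 1 x := by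
          refine Finset.sum_congr rfl fun J hJ => ?_
          rw [lintegral_indicator_one (hm J hJ)]
      _ = ∫⁻ x, ∑ J ∈ t, J.indicator 1 x := by
          rw [lintegral_finsetSum']
          intro J hJ
          exact (measurable_one.indicator (hm J hJ)).aemeasurable
      _ ≤ ∫⁻ x, I.indicator (fun _ => 2) x := by
          refine lintegral_mono fun x => ?_
          have : ∑ J ∈ t, J.indicator (1 : ℝ → ℝ≥0∞) x
              = ((t.filter (fun J => x ∈ J)).card : ℝ≥0∞) := by
            rw [Finset.card_filter]
            push_cast
            refine Finset.sum_congr rfl fun J hJ => ?_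
            by_cases hx : x ∈ J <;> simp [hx]
          simp only [this]
          by_cases hx : x ∈ I
          · simp only [hx, Set.indicator_of_mem]
            exact_mod_cast hmult x
          · have : t.filter (fun J => x ∈ J) = ∅ := by
              refine Finset.filter_eq_empty_iff.2 fun J hJ hxJ => hx ((hF J (htF hJ)).2 hxJ)
            simp [this]
      _ = 2 * volume I := by
          rw [lintegral_indicator_const hI.measurableSet]
  calc volume E ≤ volume (⋃ J ∈ t, E ∩ J) := by
        refine measure_mono fun s hs => ?_
        obtain ⟨J, hJ, hsJ⟩ := htE s hs
        simp only [Set.mem_iUnion]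
        exact ⟨J, hJ, hs, hsJ⟩
    _ ≤ ∑ J ∈ t, volume (E ∩ J) := measure_biUnion_finset_le _ _
    _ ≤ ∑ J ∈ t, c * volume J := Finset.sum_le_sum fun J hJ => hc J (htF hJ)
    _ = c * ∑ J ∈ t, volume J := by rw [Finset.mul_sum]
    _ ≤ c * (2 * volume I) := by gcongr
    _ = 2 * c * volume I := by ring

/-- all coordinates are affine functions -/
def Aff (f : ℝ → Fin 3 → ℝ) : Prop := ∀ i, ∃ A B : ℝ, ∀ s, f s i = A + B * s

lemma Aff.cont {f : ℝ → Fin 3 → ℝ} (hf : Aff f) : Continuous f := by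
  refine continuous_pi fun i => ?_
  obtain ⟨A, B, h⟩ := hf i
  simp only [h]
  fun_prop

lemma Aff.ordConnected {f : ℝ → Fin 3 → ℝ} (hf : Aff f) {J : Set ℝ} (hJ : J.OrdConnected) (r : ℝ) :
    {s | s ∈ J ∧ ‖f s‖ < r}.OrdConnected := by
  refine ⟨fun x hx y hy z hz => ⟨hJ.out hx.1 hy.1 hz, ?_⟩⟩
  have hr : 0 < r := lt_of_le_of_lt (norm_nonneg _) hx.2
  have hx2 := (pi_norm_lt_iff hr).1 hx.2
  have hy2 := (pi_norm_lt_iff hr).1 hy.2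
  refine (pi_norm_lt_iff hr).2 fun i => ?_
  obtain ⟨A, B, h⟩ := hf i
  have h1 := hx2 i
  have h2 := hy2 i
  rw [h, Real.norm_eq_abs, abs_lt] at *
  rcases le_total 0 B with hB | hB
  · constructor <;> nlinarith [hz.1, hz.2]
  · constructor <;> nlinarith [hz.1, hz.2]

lemma Aff.good {f : ℝ → Fin 3 → ℝ} (hf : Aff f) {J : Set ℝ} (hJ : J.OrdConnected) {ρ ε : ℝ}
    (hρ : 0 < ρ) (hε : 0 < ε) {s₀ : ℝ} (hs₀ : s₀ ∈ J) (h₀ : ρ ≤ ‖f s₀‖) :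
    volume {s | s ∈ J ∧ ‖f s‖ < ε} ≤ ENNReal.ofReal (4 * ε / ρ) * volume J := by
  by_cases hbig : ρ ≤ 2 * ε
  · calc volume {s | s ∈ J ∧ ‖f s‖ < ε} ≤ 1 * volume J := by
          rw [one_mul]; exact measure_mono fun s hs => hs.1
      _ ≤ _ := by
          gcongr
          rw [← ENNReal.ofReal_one]
          apply ENNReal.ofReal_le_ofReal
          rw [le_div_iff₀ hρ]; linarith
  push Not at hbig
  obtain ⟨i, hi⟩ : ∃ i, ρ ≤ |f s₀ i| := by
    by_contra hcon
    push Not at hcon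
    exact absurd ((pi_norm_lt_iff hρ).2 hcon) (not_lt.2 h₀)
  obtain ⟨A, B, hAB⟩ := hf i
  rcases Set.eq_empty_or_nonempty {s | s ∈ J ∧ ‖f s‖ < ε} with he | ⟨s₁, hs₁J, hs₁⟩
  · rw [he]; simp
  have hcoord : ∀ s, ‖f s‖ < ε → |A + B * s| < ε := fun s hs => by
    rw [← hAB]; exact lt_of_le_of_lt (norm_le_pi_norm (f s) i) hs
  have h1 := hcoord s₁ hs₁
  rw [hAB] at hi
  have hB : ρ / 2 ≤ |B| * |s₁ - s₀| := by
    rw [← abs_mul]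
    have : A + B * s₀ = (A + B * s₁) - B * (s₁ - s₀) := by ring
    have h3 := abs_sub (A + B * s₁) (B * (s₁ - s₀))
    rw [← this] at h3
    linarith
  have hB0 : 0 < |B| := by
    rcases (abs_nonneg B).lt_or_eq with h | h
    · exact h
    · rw [← h] at hB; linarith
  have hBne : B ≠ 0 := abs_pos.1 hB0
  have hJvol : ENNReal.ofReal |s₁ - s₀| ≤ volume J := by
    rw [← Real.volume_interval]
    exact measure_mono (hJ.uIcc_subset hs₀ hs₁J)
  have hsub : {s | s ∈ J ∧ ‖f s‖ < ε} ⊆ Set.Icc (-A / B - ε / |B|) (-A / B + ε / |B|) := by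
    rintro s ⟨_, hs⟩
    have h2 := hcoord s hs
    have : |s - (-A / B)| ≤ ε / |B| := by
      rw [le_div_iff₀ hB0, ← abs_mul]
      have : (s - -A / B) * B = A + B * s := by field_simp; ring
      rw [this]; exact h2.le
    rw [abs_le] at this
    constructor <;> linarith [this.1, this.2]
  calc volume {s | s ∈ J ∧ ‖f s‖ < ε} ≤ volume (Set.Icc (-A / B - ε / |B|) (-A / B + ε / |B|)) :=
        measure_mono hsub
    _ = ENNReal.ofReal (2 * ε / |B|) := by rw [Real.volume_Icc]; congr 1; ring
    _ ≤ ENNReal.ofReal (4 * ε / ρ * |s₁ - s₀|) := by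
        apply ENNReal.ofReal_le_ofReal
        rw [div_mul_eq_mul_div, div_le_div_iff₀ hB0 hρ]
        nlinarith
    _ = ENNReal.ofReal (4 * ε / ρ) * ENNReal.ofReal |s₁ - s₀| :=
        ENNReal.ofReal_mul (by positivity)
    _ ≤ _ := by gcongr

/-- intermediate value: on the sublevel set inside `J` the function is somewhere `≥ r/2`. -/
lemma Aff.ivt {f : ℝ → Fin 3 → ℝ} (hf : Aff f) {J : Set ℝ} (hJ : J.OrdConnected) {r : ℝ}
    (hr : 0 < r) {x y : ℝ} (hx : x ∈ J) (hxr : ‖f x‖ < r) (hy : y ∈ J) (hyr : r ≤ ‖f y‖) :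
    ∃ z ∈ {s | s ∈ J ∧ ‖f s‖ < r}, r / 2 ≤ ‖f z‖ := by
  by_cases h : r / 2 ≤ ‖f x‖
  · exact ⟨x, ⟨hx, hxr⟩, h⟩
  push Not at h
  have hcont : ContinuousOn (fun s => ‖f s‖) (Set.uIcc x y) := hf.cont.norm.continuousOn
  have := intermediate_value_uIcc hcont
  have hmem : r / 2 ∈ Set.uIcc ‖f x‖ ‖f y‖ := by
    rw [Set.mem_uIcc]; left; constructor <;> linarith
  obtain ⟨z, hz, hz2⟩ := this hmem
  simp only at hz2
  exact ⟨z, ⟨hJ.uIcc_subset hx hy hz, by rw [hz2]; linarith⟩, hz2.ge⟩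

/-! ### Algebra of vectors -/

/-- cross product -/
def cr {R : Type*} [CommRing R] (x y : Fin 3 → R) : Fin 3 → R :=
  ![x 1 * y 2 - x 2 * y 1, x 2 * y 0 - x 0 * y 2, x 0 * y 1 - x 1 * y 0]

/-- dot product -/
def dt {R : Type*} [CommRing R] (x y : Fin 3 → R) : R := x 0 * y 0 + x 1 * y 1 + x 2 * y 2

lemma cr_zero' {R : Type*} [CommRing R] (x y : Fin 3 → R) :
    cr x y 0 = x 1 * y 2 - x 2 * y 1 := rfl
lemma cr_one' {R : Type*} [CommRing R] (x y : Fin 3 → R) :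
    cr x y 1 = x 2 * y 0 - x 0 * y 2 := rfl
lemma cr_two' {R : Type*} [CommRing R] (x y : Fin 3 → R) :
    cr x y 2 = x 0 * y 1 - x 1 * y 0 := rfl

lemma vec3_ext {R : Type*} {x y : Fin 3 → R} (h0 : x 0 = y 0) (h1 : x 1 = y 1) (h2 : x 2 = y 2) :
    x = y := by
  funext i; fin_cases i <;> assumption

lemma cr_cr {R : Type*} [CommRing R] (x y z : Fin 3 → R) :
    cr x (cr y z) = dt x z • y - dt x y • z := by
  apply vec3_ext <;> simp [cr_zero', cr_one', cr_two', dt] <;> ring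

lemma dt_comm {R : Type*} [CommRing R] (x y : Fin 3 → R) : dt x y = dt y x := by
  simp [dt]; ring

lemma dt_cr_left {R : Type*} [CommRing R] (x y : Fin 3 → R) : dt x (cr x y) = 0 := by
  simp [cr_zero', cr_one', cr_two', dt]; ring

lemma dt_cr_right {R : Type*} [CommRing R] (x y : Fin 3 → R) : dt y (cr x y) = 0 := by
  simp [cr_zero', cr_one', cr_two', dt]; ring

lemma cr_sub_smul {R : Type*} [CommRing R] (x y : Fin 3 → R) (k : R) :
    cr x (y - k • x) = cr x y := by
  apply vec3_ext <;> simp [cr_zero', cr_one', cr_two'] <;> ring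

/-- primitive vectors, with a Bezout witness -/
def Prim (v : Fin 3 → ℤ) : Prop := ∃ u, dt u v = 1

lemma Prim.ne_zero {v : Fin 3 → ℤ} (h : Prim v) : v ≠ 0 := by
  rintro rfl
  obtain ⟨u, hu⟩ := h
  simp [dt] at hu

lemma exists_prim (v : Fin 3 → ℤ) (hv : v ≠ 0) : ∃ k : ℤ, k ≠ 0 ∧ ∃ v₀, Prim v₀ ∧ v = k • v₀ := by
  set d1 : ℕ := Int.gcd (v 1) (v 2)
  set d : ℕ := Int.gcd (v 0) d1 with hd
  have hd0 : (d : ℤ) ∣ v 0 := Int.gcd_dvd_left ..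
  have hd1' : (d : ℤ) ∣ d1 := Int.gcd_dvd_right ..
  have hd1 : (d : ℤ) ∣ v 1 := hd1'.trans (Int.gcd_dvd_left ..)
  have hd2 : (d : ℤ) ∣ v 2 := hd1'.trans (Int.gcd_dvd_right ..)
  obtain ⟨x0, h0⟩ := hd0
  obtain ⟨x1, h1⟩ := hd1
  obtain ⟨x2, h2⟩ := hd2
  have hdne : (d : ℤ) ≠ 0 := by
    intro h
    apply hv
    apply vec3_ext
    · rw [h0, h]; simp
    · rw [h1, h]; simp
    · rw [h2, h]; simp
  refine ⟨d, hdne, ![x0, x1, x2], ?_, ?_⟩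
  · have b1 := Int.gcd_eq_gcd_ab (v 1) (v 2)
    have b2 := Int.gcd_eq_gcd_ab (v 0) d1
    set A := Int.gcdA (v 0) d1
    set B := Int.gcdB (v 0) d1
    set A' := Int.gcdA (v 1) (v 2)
    set B' := Int.gcdB (v 1) (v 2)
    refine ⟨![A, B * A', B * B'], ?_⟩
    have : (d : ℤ) * (dt ![A, B * A', B * B'] ![x0, x1, x2]) = d * 1 := by
      simp only [dt, Matrix.cons_val]
      have b3 : (d1 : ℤ) = v 1 * A' + v 2 * B' := b1
      have b4 : (d : ℤ) = v 0 * A + d1 * B := b2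
      rw [h1, h2] at b3
      rw [h0] at b4
      linear_combination (-1 : ℤ) * b4 - B * b3
    exact mul_left_cancel₀ hdne this
  · apply vec3_ext <;> simp [h0, h1, h2]

lemma Prim.of_cr_eq_zero {v u : Fin 3 → ℤ} (hv : Prim v) (h : cr v u = 0) :
    ∃ k : ℤ, u = k • v := by
  obtain ⟨x, hx⟩ := hv
  refine ⟨dt x u, ?_⟩
  have h2 := cr_cr x v u
  rw [h, hx] at h2
  have h3 : cr x (0 : Fin 3 → ℤ) = 0 := by
    apply vec3_ext <;> simp [cr_zero', cr_one', cr_two']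
  rw [h3, one_smul] at h2
  exact (sub_eq_zero.1 h2.symm).symm

/-- A pair of dual linear maps -/
structure Dual (L M : (Fin 3 → ℤ) → Fin 3 → ℝ) : Prop where
  subL : ∀ v u, L (v - u) = L v - L u
  subM : ∀ v u, M (v - u) = M v - M u
  smulL : ∀ (k : ℤ) v, L (k • v) = (k : ℝ) • L v
  smulM : ∀ (k : ℤ) v, M (k • v) = (k : ℝ) • M v
  crL : ∀ v u, M (cr v u) = cr (L v) (L u)
  crM : ∀ v u, L (cr v u) = cr (M v) (M u)
  dtLM : ∀ v u, dt (L v) (M u) = ((dt v u : ℤ) : ℝ)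

lemma Dual.symm {L M : (Fin 3 → ℤ) → Fin 3 → ℝ} (h : Dual L M) : Dual M L where
  subL := h.subM
  subM := h.subL
  smulL := h.smulM
  smulM := h.smulL
  crL := h.crM
  crM := h.crL
  dtLM v u := by rw [dt_comm, h.dtLM, dt_comm]

lemma abs_coord_le (x : Fin 3 → ℝ) (i : Fin 3) : |x i| ≤ ‖x‖ := norm_le_pi_norm x i

lemma dt_le (x y : Fin 3 → ℝ) : |dt x y| ≤ 3 * ‖x‖ * ‖y‖ := by
  have h : ∀ i, |x i * y i| ≤ ‖x‖ * ‖y‖ := fun i => by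
    rw [abs_mul]
    exact mul_le_mul (abs_coord_le x i) (abs_coord_le y i) (abs_nonneg _) (norm_nonneg _)
  have h0 := h 0
  have h1 := h 1
  have h2 := h 2
  unfold dt
  rw [abs_le] at *
  constructor <;> linarith [h0.1, h1.1, h2.1, h0.2, h1.2, h2.2]

lemma cr_le (x y : Fin 3 → ℝ) : ‖cr x y‖ ≤ 2 * ‖x‖ * ‖y‖ := by
  have h : ∀ i j, |x i * y j| ≤ ‖x‖ * ‖y‖ := fun i j => by
    rw [abs_mul]
    exact mul_le_mul (abs_coord_le x i) (abs_coord_le y j) (abs_nonneg _) (norm_nonneg _)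
  have h' : ∀ i j k l, |x i * y j - x k * y l| ≤ 2 * ‖x‖ * ‖y‖ := fun i j k l => by
    have := abs_sub (x i * y j) (x k * y l)
    linarith [h i j, h k l]
  refine (pi_norm_le_iff_of_nonneg (by positivity)).2 fun i => ?_
  fin_cases i
  · exact h' 1 2 2 1
  · exact h' 2 0 0 2
  · exact h' 0 1 1 0

lemma Dual.norm_smul_ge {L M : (Fin 3 → ℤ) → Fin 3 → ℝ} (h : Dual L M) {k : ℤ} (hk : k ≠ 0)
    (v : Fin 3 → ℤ) : ‖L v‖ ≤ ‖L (k • v)‖ := by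
  rw [h.smulL, norm_smul]
  have : (1 : ℝ) ≤ ‖(k : ℝ)‖ := by
    rw [Real.norm_eq_abs]
    exact_mod_cast Int.one_le_abs hk
  nlinarith [norm_nonneg (L v)]

lemma int_vec_finite (B : ℝ) : {v : Fin 3 → ℤ | ∀ i, |(v i : ℝ)| ≤ B}.Finite := by
  refine (Set.finite_Icc (fun _ : Fin 3 => -⌈B⌉) (fun _ => ⌈B⌉)).subset fun v hv => ?_
  have : ∀ i, |v i| ≤ ⌈B⌉ := fun i => by
    have h1 := (hv i).trans (Int.le_ceil B)
    exact_mod_cast h1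
  exact ⟨fun i => (abs_le.1 (this i)).1, fun i => (abs_le.1 (this i)).2⟩

lemma Dual.coord {L M : (Fin 3 → ℤ) → Fin 3 → ℝ} (h : Dual L M) (v : Fin 3 → ℤ) (i : Fin 3) :
    |(v i : ℝ)| ≤ 3 * ‖L v‖ * ‖M (Pi.single i 1)‖ := by
  have h1 : ((v i : ℤ) : ℝ) = dt (L v) (M (Pi.single i 1)) := by
    rw [h.dtLM]
    congr 1
    fin_cases i <;> simp [dt, Pi.single_apply]
  rw [h1]
  exact dt_le _ _

/-! ### Quantitative nondivergence -/

structure Sys (L M : ℝ → (Fin 3 → ℤ) → Fin 3 → ℝ) : Prop where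
  dual : ∀ s, Dual (L s) (M s)
  affL : ∀ v, Aff (fun s => L s v)
  affM : ∀ v, Aff (fun s => M s v)

lemma Sys.symm {L M : ℝ → (Fin 3 → ℤ) → Fin 3 → ℝ} (S : Sys L M) : Sys M L :=
  ⟨fun s => (S.dual s).symm, S.affM, S.affL⟩

lemma Sys.finite {L M : ℝ → (Fin 3 → ℤ) → Fin 3 → ℝ} (S : Sys L M) (s₁ s₂ r : ℝ) :
    {v | ∃ s ∈ Set.Icc s₁ s₂, ‖L s v‖ < r}.Finite := by
  have : ∀ i : Fin 3, ∃ C, ∀ s ∈ Set.Icc s₁ s₂, ‖M s (Pi.single i 1)‖ ≤ C := fun i =>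
    isCompact_Icc.exists_bound_of_continuousOn (S.affM (Pi.single i 1)).cont.continuousOn
  choose C hC using this
  refine (int_vec_finite (3 * |r| * (|C 0| + |C 1| + |C 2|))).subset ?_
  rintro v ⟨s, hs, hv⟩ i
  refine ((S.dual s).coord v i).trans ?_
  have h1 : ‖M s (Pi.single i 1)‖ ≤ |C 0| + |C 1| + |C 2| := by
    refine ((hC i s hs).trans (le_abs_self _)).trans ?_
    fin_cases i <;> simp only [Fin.zero_eta, Fin.mk_one, Fin.reduceFinMk] <;>
      linarith [abs_nonneg (C 0), abs_nonneg (C 1), abs_nonneg (C 2)]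
  have h2 : ‖L s v‖ ≤ |r| := hv.le.trans (le_abs_self _)
  gcongr

lemma Sys.level2 {L M : ℝ → (Fin 3 → ℤ) → Fin 3 → ℝ} (S : Sys L M) {s₁ s₂ : ℝ} {J : Set ℝ}
    (hJ : J.OrdConnected) (hJI : J ⊆ Set.Icc s₁ s₂) {v : Fin 3 → ℤ} (hv : Prim v) {κ : ℝ}
    (hκ : 0 < κ) (hκ1 : κ ≤ 1)
    (hsup : ∀ w, Prim w → ∃ s₀ ∈ J, κ ≤ ‖M s₀ w‖) :
    volume {s | s ∈ J ∧ 2 * κ ^ 2 ≤ ‖L s v‖ ∧ ∃ w, Prim w ∧ dt v w = 0 ∧ ‖M s w‖ < κ ^ 2}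
      ≤ 2 * ENNReal.ofReal (8 * κ) * volume J := by
  classical
  have hfin : {w | Prim w ∧ dt v w = 0 ∧ ∃ s ∈ J, ‖M s w‖ < κ}.Finite := by
    refine (S.symm.finite s₁ s₂ κ).subset ?_
    rintro w ⟨_, _, s, hs, h⟩
    exact ⟨s, hJI hs, h⟩
  have hκκ : κ ^ 2 ≤ κ := by nlinarith
  refine covering J _ hJ (hfin.toFinset.image (fun w => {s | s ∈ J ∧ ‖M s w‖ < κ})) _ ?_ ?_ ?_
  · intro A hA
    obtain ⟨w, hw, rfl⟩ := Finset.mem_image.1 hA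
    exact ⟨(S.affM w).ordConnected hJ κ, fun s hs => hs.1⟩
  · rintro s ⟨hsJ, _, w, hw, hvw, hsw⟩
    refine ⟨_, Finset.mem_image.2 ⟨w, ?_, rfl⟩, hsJ, hsw.trans_le hκκ⟩
    rw [Set.Finite.mem_toFinset]
    exact ⟨hw, hvw, s, hsJ, hsw.trans_le hκκ⟩
  · intro A hA
    obtain ⟨w, hw, rfl⟩ := Finset.mem_image.1 hA
    rw [Set.Finite.mem_toFinset] at hw
    obtain ⟨hw, hvw, x, hxJ, hx⟩ := hw
    obtain ⟨y, hyJ, hy⟩ := hsup w hw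
    obtain ⟨z, hz, hz2⟩ := (S.affM w).ivt hJ hκ hxJ hx hyJ hy
    have hgood := (S.affM w).good ((S.affM w).ordConnected hJ κ) (ρ := κ / 2) (ε := κ ^ 2)
      (by positivity) (by positivity) hz hz2
    have he : 4 * κ ^ 2 / (κ / 2) = 8 * κ := by field_simp; ring
    rw [he] at hgood
    refine le_trans (measure_mono ?_) hgood
    rintro s ⟨⟨hsJ, hsv, w', hw', hvw', hsw'⟩, hs2⟩
    refine ⟨hs2, ?_⟩
    have D := S.dual s
    have hc : cr w w' = 0 := by
      by_contra hne
      have h0 : cr v (cr w w') = 0 := by rw [cr_cr, hvw, hvw']; simp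
      obtain ⟨k, hk⟩ := hv.of_cr_eq_zero h0
      have hk0 : k ≠ 0 := by
        rintro rfl
        rw [zero_smul] at hk; exact hne hk
      have h1 := D.norm_smul_ge hk0 v
      rw [← hk, D.crM] at h1
      have h2 := cr_le (M s w) (M s w')
      have h3 : ‖M s w‖ < κ := hs2.2
      have h4 : ‖M s w'‖ < κ := hsw'.trans_le hκκ
      have : ‖M s w‖ * ‖M s w'‖ < κ * κ :=
        mul_lt_mul'' h3 h4 (norm_nonneg _) (norm_nonneg _)
      nlinarith
    obtain ⟨k, hk⟩ := hw.of_cr_eq_zero hc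
    have hk0 : k ≠ 0 := by
      rintro rfl
      rw [zero_smul] at hk; exact hw'.ne_zero hk
    have h1 := D.symm.norm_smul_ge hk0 w
    rw [← hk] at h1
    exact h1.trans_lt hsw'

/-- the bad set -/
def Bad (L M : ℝ → (Fin 3 → ℤ) → Fin 3 → ℝ) (I : Set ℝ) (η : ℝ) : Set ℝ :=
  {s | s ∈ I ∧ ∃ u, u ≠ 0 ∧ (‖L s u‖ < η ∨ ‖M s u‖ < η)}

lemma Bad.symm (L M : ℝ → (Fin 3 → ℤ) → Fin 3 → ℝ) (I : Set ℝ) (η : ℝ) :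
    Bad L M I η = Bad M L I η := by
  unfold Bad
  ext s
  simp only [Set.mem_ofPred_eq, or_comm]

lemma Sys.level1 {L M : ℝ → (Fin 3 → ℤ) → Fin 3 → ℝ} (S : Sys L M) {s₁ s₂ : ℝ}
    {v : Fin 3 → ℤ} (hv : Prim v) {κ ρ : ℝ}
    (hκ : 0 < κ) (hρ : 0 < ρ) (hκρ : κ ≤ ρ / 4) (hρ2 : ρ ≤ 1 / 2) {J : Set ℝ}
    (hJ : J = {s | s ∈ Set.Icc s₁ s₂ ∧ ‖L s v‖ < ρ})
    (hsupL : ∃ s₀ ∈ J, ρ / 2 ≤ ‖L s₀ v‖)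
    (hsupM : ∀ w, Prim w → ∃ s₀ ∈ J, ρ / 2 ≤ ‖M s₀ w‖) :
    volume (Bad L M (Set.Icc s₁ s₂) (κ ^ 2) ∩ J) ≤ ENNReal.ofReal (20 * κ) * volume J := by
  have hJc : J.OrdConnected := by rw [hJ]; exact (S.affL v).ordConnected Set.ordConnected_Icc ρ
  have hJI : J ⊆ Set.Icc s₁ s₂ := by rw [hJ]; exact fun s hs => hs.1
  have h2 := S.level2 hJc hJI hv hκ (by linarith) (fun w hw => by
    obtain ⟨s₀, h, h'⟩ := hsupM w hw
    exact ⟨s₀, h, by linarith⟩)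
  obtain ⟨s₀, hs₀, hs₀'⟩ := hsupL
  have h1 := (S.affL v).good hJc (ρ := ρ / 2) (ε := 2 * κ ^ 2) (by positivity) (by positivity)
    hs₀ hs₀'
  have hle : ENNReal.ofReal (4 * (2 * κ ^ 2) / (ρ / 2)) ≤ ENNReal.ofReal (4 * κ) := by
    apply ENNReal.ofReal_le_ofReal
    rw [div_le_iff₀ (by positivity)]
    nlinarith
  have h3 : volume {s | s ∈ J ∧ ‖L s v‖ < 2 * κ ^ 2} ≤ ENNReal.ofReal (4 * κ) * volume J :=
    h1.trans (by gcongr)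
  have hadd : ENNReal.ofReal (20 * κ) = ENNReal.ofReal (4 * κ) + 2 * ENNReal.ofReal (8 * κ) := by
    have : (2 : ℝ≥0∞) = ENNReal.ofReal 2 := by simp
    rw [this, ← ENNReal.ofReal_mul (by norm_num), ← ENNReal.ofReal_add (by positivity)
      (by positivity)]
    congr 1; ring
  rw [hadd, add_mul]
  refine le_trans ?_ (add_le_add h3 h2)
  refine le_trans (measure_mono ?_) (measure_union_le _ _)
  rintro s ⟨⟨hsI, u, hu0, hu⟩, hsJ⟩
  by_cases hsm : ‖L s v‖ < 2 * κ ^ 2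
  · exact Or.inl ⟨hsJ, hsm⟩
  right
  push Not at hsm
  refine ⟨hsJ, hsm, ?_⟩
  have D := S.dual s
  have hsv : ‖L s v‖ < ρ := by rw [hJ] at hsJ; exact hsJ.2
  rcases hu with hu | hu
  · by_cases hc : cr v u = 0
    · exfalso
      obtain ⟨k, hk⟩ := hv.of_cr_eq_zero hc
      have hk0 : k ≠ 0 := by
        rintro rfl
        rw [zero_smul] at hk; exact hu0 hk
      have h1 := D.norm_smul_ge hk0 v
      rw [← hk] at h1
      nlinarith
    · obtain ⟨k, hk0, w, hw, hkw⟩ := exists_prim _ hc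
      refine ⟨w, hw, ?_, ?_⟩
      · have h5 := dt_cr_left v u
        rw [hkw] at h5
        have h6 : k * dt v w = 0 := by
          rw [← h5]; simp [dt]; ring
        exact (mul_eq_zero.1 h6).resolve_left hk0
      · have h5 := D.symm.norm_smul_ge hk0 w
        rw [← hkw, D.crL] at h5
        have h6 := cr_le (L s v) (L s u)
        have h7 : ‖L s v‖ * ‖L s u‖ < ρ * κ ^ 2 :=
          mul_lt_mul'' hsv hu (norm_nonneg _) (norm_nonneg _)
        nlinarith [sq_nonneg κ]
  · by_cases hd : dt v u = 0
    · obtain ⟨k, hk0, w, hw, hkw⟩ := exists_prim _ hu0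
      refine ⟨w, hw, ?_, ?_⟩
      · rw [hkw] at hd
        have h6 : k * dt v w = 0 := by
          rw [← hd]; simp [dt]; ring
        exact (mul_eq_zero.1 h6).resolve_left hk0
      · have h5 := D.symm.norm_smul_ge hk0 w
        rw [← hkw] at h5
        exact h5.trans_lt hu
    · exfalso
      have h5 := dt_le (L s v) (M s u)
      rw [D.dtLM] at h5
      have h6 : (1 : ℝ) ≤ |((dt v u : ℤ) : ℝ)| := by exact_mod_cast Int.one_le_abs hd
      have h7 : ‖L s v‖ * ‖M s u‖ < ρ * κ ^ 2 :=
          mul_lt_mul'' hsv hu (norm_nonneg _) (norm_nonneg _)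
      have h8 : κ ^ 2 ≤ 1 / 64 := by nlinarith
      nlinarith

lemma Sys.nondiv {L M : ℝ → (Fin 3 → ℤ) → Fin 3 → ℝ} (S : Sys L M) {s₁ s₂ : ℝ} {κ ρ : ℝ}
    (hκ : 0 < κ) (hρ : 0 < ρ) (hκρ : κ ≤ ρ / 4) (hρ2 : ρ ≤ 1 / 2)
    (hL : ∀ v, v ≠ 0 → ∃ s ∈ Set.Icc s₁ s₂, ρ ≤ ‖L s v‖)
    (hM : ∀ v, v ≠ 0 → ∃ s ∈ Set.Icc s₁ s₂, ρ ≤ ‖M s v‖) :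
    volume (Bad L M (Set.Icc s₁ s₂) (κ ^ 2))
      ≤ 2 * ENNReal.ofReal (20 * κ) * volume (Set.Icc s₁ s₂) := by
  classical
  set I := Set.Icc s₁ s₂ with hI
  have hIc : I.OrdConnected := Set.ordConnected_Icc
  let A : Set (Set ℝ) := {J | J.Nonempty ∧ ∃ v, Prim v ∧
    (J = {s | s ∈ I ∧ ‖L s v‖ < ρ} ∨ J = {s | s ∈ I ∧ ‖M s v‖ < ρ})}
  have hAfin : A.Finite := by
    refine (((S.finite s₁ s₂ ρ).image (fun v => {s | s ∈ I ∧ ‖L s v‖ < ρ})).union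
      ((S.symm.finite s₁ s₂ ρ).image (fun v => {s | s ∈ I ∧ ‖M s v‖ < ρ}))).subset ?_
    rintro J ⟨⟨x, hx⟩, v, hv, rfl | rfl⟩
    · exact Or.inl ⟨v, ⟨x, hx⟩, rfl⟩
    · exact Or.inr ⟨v, ⟨x, hx⟩, rfl⟩
  have hBfin : {J | Maximal (· ∈ A) J}.Finite := hAfin.subset fun J hJ => hJ.1
  have key : ∀ J, Maximal (· ∈ A) J → ∀ f : ℝ → Fin 3 → ℝ, Aff f →
      (({s | s ∈ I ∧ ‖f s‖ < ρ}).Nonempty → {s | s ∈ I ∧ ‖f s‖ < ρ} ∈ A) →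
      (∃ s ∈ I, ρ ≤ ‖f s‖) → ∃ s₀ ∈ J, ρ / 2 ≤ ‖f s₀‖ := by
    intro J hJ f hf hfA ⟨y, hyI, hy⟩
    by_contra hcon
    push Not at hcon
    have hJI : J ⊆ I := by
      rcases hJ.1 with ⟨_, v, _, rfl | rfl⟩ <;> exact fun s hs => hs.1
    have hsub : J ⊆ {s | s ∈ I ∧ ‖f s‖ < ρ} := fun s hs =>
      ⟨hJI hs, (hcon s hs).trans (by linarith)⟩
    obtain ⟨x, hx⟩ := hJ.1.1
    have hle := hJ.2 (hfA ⟨x, hsub hx⟩) hsub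
    obtain ⟨z, hz, hz2⟩ := hf.ivt hIc hρ (hsub hx).1 (hsub hx).2 hyI hy
    exact absurd (hcon z (hle hz)) (not_lt.2 hz2)
  have hκ2 : κ ^ 2 ≤ ρ := by nlinarith
  refine covering I _ hIc hBfin.toFinset _ ?_ ?_ ?_
  · intro J hJ
    rw [Set.Finite.mem_toFinset] at hJ
    rcases hJ.1 with ⟨_, v, _, rfl | rfl⟩
    · exact ⟨(S.affL v).ordConnected hIc ρ, fun s hs => hs.1⟩
    · exact ⟨(S.affM v).ordConnected hIc ρ, fun s hs => hs.1⟩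
  · rintro s ⟨hsI, u, hu0, hu⟩
    obtain ⟨k, hk0, w, hw, rfl⟩ := exists_prim _ hu0
    have : ∃ J ∈ A, s ∈ J := by
      rcases hu with hu | hu
      · have hs : s ∈ {s | s ∈ I ∧ ‖L s w‖ < ρ} :=
          ⟨hsI, (((S.dual s).norm_smul_ge hk0 w).trans_lt hu).trans_le hκ2⟩
        exact ⟨_, ⟨⟨s, hs⟩, w, hw, Or.inl rfl⟩, hs⟩
      · have hs : s ∈ {s | s ∈ I ∧ ‖M s w‖ < ρ} :=
          ⟨hsI, (((S.dual s).symm.norm_smul_ge hk0 w).trans_lt hu).trans_le hκ2⟩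
        exact ⟨_, ⟨⟨s, hs⟩, w, hw, Or.inr rfl⟩, hs⟩
    obtain ⟨J, hJA, hsJ⟩ := this
    obtain ⟨J', hJJ', hJ'⟩ := hAfin.exists_le_maximal hJA
    exact ⟨J', by rw [Set.Finite.mem_toFinset]; exact hJ', hJJ' hsJ⟩
  · intro J hJ
    rw [Set.Finite.mem_toFinset] at hJ
    have kL : ∀ w, Prim w → ∃ s₀ ∈ J, ρ / 2 ≤ ‖L s₀ w‖ := fun w hw =>
      key J hJ _ (S.affL w) (fun hne => ⟨hne, w, hw, Or.inl rfl⟩) (hL w hw.ne_zero)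
    have kM : ∀ w, Prim w → ∃ s₀ ∈ J, ρ / 2 ≤ ‖M s₀ w‖ := fun w hw =>
      key J hJ _ (S.affM w) (fun hne => ⟨hne, w, hw, Or.inr rfl⟩) (hM w hw.ne_zero)
    rcases hJ.1 with ⟨_, v, hv, hJv | hJv⟩
    · exact S.level1 hv hκ hρ hκρ hρ2 hJv (kL v hv) kM
    · rw [Bad.symm]
      exact S.symm.level1 hv hκ hρ hκρ hρ2 hJv (kM v hv) kL

/-! ### Mahler's criterion -/

lemma dt_self_nonneg (x : Fin 3 → ℝ) : 0 ≤ dt x x := by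
  unfold dt; nlinarith [mul_self_nonneg (x 0), mul_self_nonneg (x 1), mul_self_nonneg (x 2)]

lemma sq_norm_le_dt (x : Fin 3 → ℝ) : ‖x‖ ^ 2 ≤ dt x x := by
  have : ‖x‖ ≤ Real.sqrt (dt x x) := by
    refine (pi_norm_le_iff_of_nonneg (Real.sqrt_nonneg _)).2 fun i => ?_
    rw [Real.norm_eq_abs]
    apply Real.abs_le_sqrt
    unfold dt
    fin_cases i <;> simp only [Fin.zero_eta, Fin.mk_one, Fin.reduceFinMk] <;>
      nlinarith [sq_nonneg (x 0), sq_nonneg (x 1), sq_nonneg (x 2)]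
  calc ‖x‖ ^ 2 ≤ Real.sqrt (dt x x) ^ 2 := by gcongr
    _ = dt x x := Real.sq_sqrt (dt_self_nonneg x)

lemma lagrange (x y : Fin 3 → ℝ) : dt (cr x y) (cr x y) = dt x x * dt y y - dt x y ^ 2 := by
  simp only [dt, cr_zero', cr_one', cr_two']; ring

lemma nearest (x y : Fin 3 → ℝ) (hx : 0 < dt x x) :
    ∃ k : ℤ, |dt x (y - (k : ℝ) • x)| ≤ dt x x / 2 := by
  refine ⟨round (dt x y / dt x x), ?_⟩
  have h := abs_sub_round (dt x y / dt x x)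
  set k := round (dt x y / dt x x)
  have h2 : dt x (y - (k : ℝ) • x) = (dt x y / dt x x - k) * dt x x := by
    rw [sub_mul, div_mul_cancel₀ _ hx.ne']
    simp [dt]; ring
  rw [h2, abs_mul, abs_of_pos hx]
  nlinarith

lemma Dual.exists_shortest {L M : (Fin 3 → ℤ) → Fin 3 → ℝ} (D : Dual L M)
    (P : (Fin 3 → ℤ) → Prop) (hP : ∃ v, P v) :
    ∃ v, P v ∧ ∀ u, P u → dt (L v) (L v) ≤ dt (L u) (L u) := by
  obtain ⟨v₀, hv₀⟩ := hP
  set B := dt (L v₀) (L v₀)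
  have hfin : {u | P u ∧ dt (L u) (L u) ≤ B}.Finite := by
    refine (int_vec_finite (3 * (1 + B) * (‖M (Pi.single 0 1)‖ + ‖M (Pi.single 1 1)‖
      + ‖M (Pi.single 2 1)‖))).subset ?_
    rintro u ⟨_, hu⟩ i
    refine (D.coord u i).trans ?_
    have h1 : ‖L u‖ ≤ 1 + B := by
      nlinarith [sq_norm_le_dt (L u), sq_nonneg (‖L u‖ - 1 / 2)]
    have h2 : ‖M (Pi.single i 1)‖ ≤ ‖M (Pi.single 0 1)‖ + ‖M (Pi.single 1 1)‖
      + ‖M (Pi.single 2 1)‖ := by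
      have := norm_nonneg (M (Pi.single 0 1))
      have := norm_nonneg (M (Pi.single 1 1))
      have := norm_nonneg (M (Pi.single 2 1))
      fin_cases i <;> simp only [Fin.zero_eta, Fin.mk_one, Fin.reduceFinMk] <;> linarith
    have : 0 ≤ 1 + B := le_trans (norm_nonneg _) h1
    gcongr
  obtain ⟨v, hv, hmin⟩ := Set.exists_min_image _ (fun u => dt (L u) (L u)) hfin
    ⟨v₀, hv₀, le_refl _⟩
  refine ⟨v, hv.1, fun u hu => ?_⟩
  by_cases h : dt (L u) (L u) ≤ B
  · exact hmin u ⟨hu, h⟩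
  · push Not at h
    exact hv.2.trans h.le

lemma Dual.pos {L M : (Fin 3 → ℤ) → Fin 3 → ℝ} (D : Dual L M) {v : Fin 3 → ℤ} (hv : v ≠ 0) :
    0 < dt (L v) (L v) := by
  rcases (dt_self_nonneg (L v)).lt_or_eq with h | h
  · exact h
  exfalso
  have h1 : ‖L v‖ = 0 := by
    have := sq_norm_le_dt (L v)
    rw [← h] at this
    nlinarith [norm_nonneg (L v)]
  apply hv
  funext i
  have h2 := D.coord v i
  rw [h1] at h2
  simp at h2
  exact h2

lemma Dual.shortest_prim {L M : (Fin 3 → ℤ) → Fin 3 → ℝ} (D : Dual L M) {v w : Fin 3 → ℤ}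
    (hv : v ≠ 0) (hvw : dt w v = 0)
    (hmin : ∀ u, u ≠ 0 ∧ dt w u = 0 → dt (L v) (L v) ≤ dt (L u) (L u)) : Prim v := by
  obtain ⟨k, hk0, v₀, hv₀, rfl⟩ := exists_prim v hv
  have h0 : dt w v₀ = 0 := by
    have h6 : k * dt w v₀ = 0 := by
      rw [← hvw]; simp [dt]; ring
    exact (mul_eq_zero.1 h6).resolve_left hk0
  have h1 := hmin v₀ ⟨hv₀.ne_zero, h0⟩
  have h2 : dt (L (k • v₀)) (L (k • v₀)) = (k : ℝ) ^ 2 * dt (L v₀) (L v₀) := by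
    rw [D.smulL]; simp [dt]; ring
  rw [h2] at h1
  have hp := D.pos hv₀.ne_zero
  have h3 : (k : ℝ) ^ 2 ≤ 1 := by
    by_contra hcon
    push Not at hcon
    nlinarith
  have h4 : k ^ 2 ≤ 1 := by exact_mod_cast h3
  have h5 : k ^ 2 = 1 := by
    have : 0 < k ^ 2 := by positivity
    omega
  obtain ⟨u, hu⟩ := hv₀
  refine ⟨k • u, ?_⟩
  have : dt (k • u) (k • v₀) = k ^ 2 * dt u v₀ := by simp [dt]; ring
  rw [this, h5, hu, one_mul]

lemma Dual.red2 {L M : (Fin 3 → ℤ) → Fin 3 → ℝ} (D : Dual L M) {v w : Fin 3 → ℤ}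
    (hv : Prim v) (hw0 : w ≠ 0) (hvw : dt v w = 0)
    (hmin : ∀ u, u ≠ 0 ∧ dt v u = 0 → dt (M w) (M w) ≤ dt (M u) (M u)) :
    3 / 4 * dt (M w) (M w) ^ 2 ≤ dt (L v) (L v) := by
  have hw := D.symm.shortest_prim hw0 hvw hmin
  obtain ⟨x, hx⟩ := hw
  have h1 : cr w (cr v x) = v := by
    rw [cr_cr, dt_comm w x, hx, dt_comm w v, hvw]; simp
  have hpos := D.symm.pos hw0
  obtain ⟨k, hk⟩ := nearest (M w) (M (cr v x)) hpos
  set w' := cr v x - k • w with hw'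
  have h2 : cr w w' = v := by rw [hw', cr_sub_smul, h1]
  have h3 : M w' = M (cr v x) - (k : ℝ) • M w := by rw [hw', D.subM, D.smulM]
  rw [← h3] at hk
  have h4 : w' ≠ 0 := by
    intro h
    rw [h] at h2
    apply hv.ne_zero
    rw [← h2]
    apply vec3_ext <;> simp [cr_zero', cr_one', cr_two']
  have h5 : dt v w' = 0 := by
    rw [← h2, dt_comm]; exact dt_cr_right _ _
  have h6 := hmin w' ⟨h4, h5⟩
  have h7 := lagrange (M w) (M w')
  rw [← D.crM, h2] at h7
  rw [h7]
  have h8 : dt (M w) (M w') ^ 2 ≤ (dt (M w) (M w) / 2) ^ 2 := sq_le_sq' (abs_le.1 hk).1 (abs_le.1 hk).2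
  nlinarith

lemma exists_perp {v : Fin 3 → ℤ} (hv : v ≠ 0) : ∃ u, u ≠ 0 ∧ dt v u = 0 := by
  by_contra hcon
  push Not at hcon
  have h : ∀ x, cr v x = 0 := fun x => by
    by_contra hne
    exact hcon _ hne (dt_cr_left v x)
  apply hv
  have h1 := h ![1, 0, 0]
  have h2 := h ![0, 1, 0]
  have a1 := congrFun h1 1
  have a2 := congrFun h1 2
  have a3 := congrFun h2 2
  simp [cr_one', cr_two'] at a1 a2 a3
  apply vec3_ext <;> simp [a1, a2, a3]

lemma cramer_id (b₁ b₂ m : Fin 3 → ℝ) :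
    dt (cr b₁ b₂) (cr b₁ b₂) • m = dt (cr m b₂) (cr b₁ b₂) • b₁ + dt (cr b₁ m) (cr b₁ b₂) • b₂
      + dt m (cr b₁ b₂) • cr b₁ b₂ := by
  apply vec3_ext <;> simp [dt, cr_zero', cr_one', cr_two'] <;> ring

lemma Dual.mahler {L M : (Fin 3 → ℤ) → Fin 3 → ℝ} (D : Dual L M) {η : ℝ} (hη : 0 < η)
    (hL : ∀ v, v ≠ 0 → η ≤ ‖L v‖) (hM : ∀ v, v ≠ 0 → η ≤ ‖M v‖) :
    ∃ v₁ v₂ v₃ : Fin 3 → ℤ, dt (cr v₁ v₂) v₃ = 1 ∧ ‖L v₁‖ ≤ 2 + 2 / η ∧ ‖L v₂‖ ≤ 2 + 2 / η ∧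
      ‖L v₃‖ ≤ 2 + 2 / η := by
  obtain ⟨v₁, ⟨hv0, hv0'⟩, hvmin⟩ := D.exists_shortest (fun u => u ≠ 0 ∧ dt 0 u = 0)
    ⟨![1, 0, 0], by intro h; simpa using congrFun h 0, by simp [dt]⟩
  have hvP := D.shortest_prim hv0 hv0' hvmin
  obtain ⟨w, ⟨hw0, hvw⟩, hwmin⟩ := D.symm.exists_shortest (fun u => u ≠ 0 ∧ dt v₁ u = 0)
    (exists_perp hv0)
  have hwP := D.symm.shortest_prim hw0 hvw hwmin
  have e1 := D.red2 hvP hw0 hvw hwmin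
  have e2 := D.symm.red2 hwP hv0 (by rw [dt_comm]; exact hvw)
    (fun u hu => hvmin u ⟨hu.1, by simp [dt]⟩)
  have hA := D.pos hv0
  have hB := D.symm.pos hw0
  have hAη : η ^ 2 ≤ dt (L v₁) (L v₁) :=
    le_trans (by gcongr; exact hL v₁ hv0) (sq_norm_le_dt _)
  have hn1 := sq_norm_le_dt (L v₁)
  set A := dt (L v₁) (L v₁) with hAdef
  set B := dt (M w) (M w) with hBdef
  have hA43 : A ≤ 4 / 3 := by
    by_contra hcon
    push Not at hcon
    have : A < B := by nlinarith
    nlinarith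
  have hB43 : B ≤ 4 / 3 := by
    by_contra hcon
    push Not at hcon
    nlinarith
  obtain ⟨u₁, hu₁⟩ := hvP
  obtain ⟨v₃', hv₃'⟩ := hwP
  have h1 : cr v₁ (cr w u₁) = w := by
    rw [cr_cr, dt_comm v₁ u₁, hu₁, hvw]; simp
  obtain ⟨k, hk⟩ := nearest (L v₁) (L (cr w u₁)) hA
  set v₂ := cr w u₁ - k • v₁ with hv₂
  have h2 : cr v₁ v₂ = w := by rw [hv₂, cr_sub_smul, h1]
  have h3 : L v₂ = L (cr w u₁) - (k : ℝ) • L v₁ := by rw [hv₂, D.subL, D.smulL]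
  rw [← h3] at hk
  have h7 := lagrange (L v₁) (L v₂)
  have hn : cr (L v₁) (L v₂) = M w := by rw [← D.crL, h2]
  rw [hn] at h7
  have h8 : dt (L v₁) (L v₂) ^ 2 ≤ (A / 2) ^ 2 := sq_le_sq' (abs_le.1 hk).1 (abs_le.1 hk).2
  have hb1 : ‖L v₁‖ ≤ 2 := by nlinarith [norm_nonneg (L v₁)]
  have hb2 : ‖L v₂‖ ≤ 1 + 2 / η := by
    have g1 : A * dt (L v₂) (L v₂) ≤ 4 / 3 + A * (1 / 3) := by
      have : A * dt (L v₂) (L v₂) = B + dt (L v₁) (L v₂) ^ 2 := by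
        rw [hBdef, h7]; ring
      nlinarith
    have g2 : dt (L v₂) (L v₂) ≤ 4 / 3 / η ^ 2 + 1 / 3 := by
      have : A * (dt (L v₂) (L v₂) - 1 / 3) ≤ 4 / 3 := by linarith
      rw [← sub_le_iff_le_add, le_div_iff₀ (by positivity)]
      rcases le_total 0 (dt (L v₂) (L v₂) - 1 / 3) with hh | hh
      · nlinarith
      · nlinarith [sq_nonneg η]
    have g3 := sq_norm_le_dt (L v₂)
    have g4 : ‖L v₂‖ ^ 2 ≤ (1 + 2 / η) ^ 2 := by
      refine (g3.trans g2).trans ?_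
      have e1 : (1 + 2 / η) ^ 2 = 1 + 4 / η + 4 / η ^ 2 := by field_simp; ring
      have e2 : 4 / 3 / η ^ 2 ≤ 4 / η ^ 2 := by gcongr; norm_num
      have e3 : 0 ≤ 4 / η := by positivity
      rw [e1]; linarith
    exact (pow_le_pow_iff_left₀ (norm_nonneg _) (by positivity) two_ne_zero).1 g4
  have hid := cramer_id (L v₁) (L v₂) (L v₃')
  rw [hn, ← hBdef] at hid
  have hone : dt (L v₃') (M w) = 1 := by rw [D.dtLM, hv₃']; simp
  rw [hone, one_smul] at hid
  set X := dt (cr (L v₃') (L v₂)) (M w)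
  set Y := dt (cr (L v₁) (L v₃')) (M w)
  have hid2 : L v₃' = (X / B) • L v₁ + (Y / B) • L v₂ + (1 / B) • M w := by
    have : L v₃' = (1 / B) • (B • L v₃') := by
      rw [smul_smul, one_div_mul_cancel hB.ne', one_smul]
    rw [this, hid, smul_add, smul_add, smul_smul, smul_smul]
    congr 3 <;> ring
  refine ⟨v₁, v₂, v₃' - round (X / B) • v₁ - round (Y / B) • v₂, ?_, ?_, ?_, ?_⟩
  · rw [h2]
    have q1 : dt w v₁ = 0 := by rw [dt_comm]; exact hvw
    have q2 : dt w v₂ = 0 := by rw [← h2, dt_comm]; exact dt_cr_right _ _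
    have q3 : dt w v₃' = 1 := by rw [dt_comm]; exact hv₃'
    have : dt w (v₃' - round (X / B) • v₁ - round (Y / B) • v₂)
        = dt w v₃' - round (X / B) * dt w v₁ - round (Y / B) * dt w v₂ := by
      simp [dt]; ring
    rw [this, q1, q2, q3]; simp
  · have : 0 ≤ 2 / η := by positivity
    linarith
  · linarith
  · have r1 := abs_sub_round (X / B)
    have r2 := abs_sub_round (Y / B)
    have : L (v₃' - round (X / B) • v₁ - round (Y / B) • v₂)
        = (X / B - round (X / B)) • L v₁ + (Y / B - round (Y / B)) • L v₂ + (1 / B) • M w := by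
      rw [D.subL, D.subL, D.smulL, D.smulL, hid2, sub_smul, sub_smul]
      abel
    rw [this]
    have n3 : ‖(1 / B) • M w‖ ≤ 1 / η := by
      rw [norm_smul, Real.norm_eq_abs, abs_of_pos (by positivity), one_div_mul_eq_div,
        div_le_div_iff₀ hB hη]
      have m1 := sq_norm_le_dt (M w)
      have m2 := hM w hw0
      nlinarith [norm_nonneg (M w)]
    have n1 : ‖(X / B - round (X / B)) • L v₁‖ ≤ 1 / 2 * 2 := by
      rw [norm_smul, Real.norm_eq_abs]; gcongr
    have n2 : ‖(Y / B - round (Y / B)) • L v₂‖ ≤ 1 / 2 * (1 + 2 / η) := by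
      rw [norm_smul, Real.norm_eq_abs]; gcongr
    refine (norm_add₃_le).trans ?_
    have : 2 / η = 1 / η + 1 / η := by ring
    linarith

/-! ### The space of lattices -/

/-- the linear action on integer vectors -/
def Lg (g : G) (v : Fin 3 → ℤ) : Fin 3 → ℝ := fun i =>
  g.1 i 0 * (v 0 : ℝ) + g.1 i 1 * (v 1 : ℝ) + g.1 i 2 * (v 2 : ℝ)

/-- the dual action on integer vectors (by the cofactor matrix) -/
def Mg (g : G) (w : Fin 3 → ℤ) : Fin 3 → ℝ :=
  ![dt (cr (g.1 1) (g.1 2)) (fun i => (w i : ℝ)), dt (cr (g.1 2) (g.1 0)) (fun i => (w i : ℝ)),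
    dt (cr (g.1 0) (g.1 1)) (fun i => (w i : ℝ))]

lemma dual_g (g : G) : Dual (Lg g) (Mg g) := by
  have hdet : g.1.det = 1 := g.2
  rw [Matrix.det_fin_three] at hdet
  refine ⟨?_, ?_, ?_, ?_, ?_, ?_, ?_⟩
  · intro v u
    funext i
    simp [Lg]; ring
  · intro v u
    apply vec3_ext <;> simp [Mg, dt] <;> ring
  · intro k v
    funext i
    simp [Lg]; ring
  · intro k v
    apply vec3_ext <;> simp [Mg, dt] <;> ring
  · intro v u
    apply vec3_ext <;> simp [Mg, Lg, dt, cr_zero', cr_one', cr_two'] <;> ring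
  · intro v u
    apply vec3_ext <;> simp only [Mg, Lg, dt, cr_zero', cr_one', cr_two', Matrix.cons_val] <;>
      push_cast
    · linear_combination (-(g.1 0 0 * (v 1 * u 2 - v 2 * u 1 : ℝ) + g.1 0 1 * (v 2 * u 0 - v 0 * u 2) +
        g.1 0 2 * (v 0 * u 1 - v 1 * u 0))) * hdet
    · linear_combination (-(g.1 1 0 * (v 1 * u 2 - v 2 * u 1 : ℝ) + g.1 1 1 * (v 2 * u 0 - v 0 * u 2) +
        g.1 1 2 * (v 0 * u 1 - v 1 * u 0))) * hdet
    · linear_combination (-(g.1 2 0 * (v 1 * u 2 - v 2 * u 1 : ℝ) + g.1 2 1 * (v 2 * u 0 - v 0 * u 2) +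
        g.1 2 2 * (v 0 * u 1 - v 1 * u 0))) * hdet
  · intro v u
    simp only [Mg, Lg, dt, cr_zero', cr_one', cr_two', Matrix.cons_val]
    push_cast
    linear_combination (v 0 * u 0 + v 1 * u 1 + v 2 * u 2 : ℝ) * hdet

lemma gInd : Topology.IsInducing (fun g : G => (g : Matrix (Fin 3) (Fin 3) ℝ)) := ⟨rfl⟩

instance instTG : IsTopologicalGroup G where
  continuous_mul := by
    rw [gInd.continuous_iff]
    have : Continuous fun p : G × G => (p.1 : Matrix (Fin 3) (Fin 3) ℝ) * p.2.1 :=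
      (gInd.continuous.comp continuous_fst).matrix_mul (gInd.continuous.comp continuous_snd)
    exact this
  continuous_inv := by
    rw [gInd.continuous_iff]
    have : Continuous fun p : G => (p : Matrix (Fin 3) (Fin 3) ℝ).adjugate :=
      gInd.continuous.matrix_adjugate
    exact this

instance instBorelX : BorelSpace X := ⟨rfl⟩

/-- bounded part of `G` -/
def bdd (R : ℝ) : Set G := {g | ∀ i j, |g.1 i j| ≤ R}

lemma isCompact_bdd (R : ℝ) : IsCompact (bdd R) := by
  have hK : IsCompact {m : Matrix (Fin 3) (Fin 3) ℝ | m.det = 1 ∧ ∀ i j, |m i j| ≤ R} := by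
    have h1 : IsCompact (Set.pi Set.univ fun _ : Fin 3 => Set.pi Set.univ fun _ : Fin 3 =>
        Set.Icc (-R) R) :=
      isCompact_univ_pi fun _ => isCompact_univ_pi fun _ => isCompact_Icc
    have h2 : IsClosed {m : Matrix (Fin 3) (Fin 3) ℝ | m.det = 1} :=
      isClosed_eq (Continuous.matrix_det continuous_id) continuous_const
    have h3 := h1.inter_right h2
    refine h3.of_isClosed_subset ?_ ?_
    · have h4 : IsClosed {m : Matrix (Fin 3) (Fin 3) ℝ | ∀ i j, |m i j| ≤ R} := by
        simp only [Set.ofPred_forall]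
        refine isClosed_iInter fun i => isClosed_iInter fun j => ?_
        exact isClosed_le (continuous_id.matrix_elem i j).abs continuous_const
      exact h2.inter h4
    · rintro m ⟨hd, hm⟩
      exact ⟨fun i _ j _ => abs_le.1 (hm i j), hd⟩
  have hind : Topology.IsInducing (fun g : G => (g : Matrix (Fin 3) (Fin 3) ℝ)) := ⟨rfl⟩
  rw [hind.isCompact_iff]
  convert hK using 1
  ext m
  constructor
  · rintro ⟨g, hg, rfl⟩
    exact ⟨g.2, hg⟩
  · rintro ⟨hd, hm⟩
    exact ⟨⟨m, hd⟩, hm, rfl⟩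

/-- compact part of `X` -/
def KX (R : ℝ) : Set X := (fun g : G => (g : X)) '' bdd R

lemma isCompact_KX (R : ℝ) : IsCompact (KX R) :=
  (isCompact_bdd R).image continuous_quotient_mk'

lemma mem_KX {g : G} {η : ℝ} (hη : 0 < η) (hL : ∀ v, v ≠ 0 → η ≤ ‖Lg g v‖)
    (hM : ∀ v, v ≠ 0 → η ≤ ‖Mg g v‖) : (g : X) ∈ KX (2 + 2 / η) := by
  obtain ⟨v₁, v₂, v₃, hd, h1, h2, h3⟩ := (dual_g g).mahler hη hL hM
  let γ : Matrix.SpecialLinearGroup (Fin 3) ℤ :=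
    ⟨!![v₁ 0, v₂ 0, v₃ 0; v₁ 1, v₂ 1, v₃ 1; v₁ 2, v₂ 2, v₃ 2], by
      rw [← hd, Matrix.det_fin_three]
      simp [dt, cr_zero', cr_one', cr_two']; ring⟩
  let γ' : G := Matrix.SpecialLinearGroup.map (n := Fin 3) (Int.castRingHom ℝ) γ
  have hγ' : γ' ∈ Gamma := ⟨γ, rfl⟩
  refine ⟨g * γ', ?_, ?_⟩
  · intro i j
    have e : ∀ j, (g * γ').1 i j = g.1 i 0 * (γ.1 0 j : ℝ) + g.1 i 1 * (γ.1 1 j : ℝ)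
        + g.1 i 2 * (γ.1 2 j : ℝ) := by
      intro j
      change (g.1 * γ'.1) i j = _
      rw [Matrix.mul_apply, Fin.sum_univ_three]
      rfl
    rw [e j]
    fin_cases j
    · exact (abs_coord_le (Lg g v₁) i).trans h1
    · exact (abs_coord_le (Lg g v₂) i).trans h2
    · exact (abs_coord_le (Lg g v₃) i).trans h3
  · change ((g * γ' : G) : X) = (g : X)
    rw [QuotientGroup.eq]
    simpa using Gamma.inv_mem hγ'

/-- open sets in `G` exhausting it -/
def opn (n : ℕ) : Set G := {g | ∀ i, ‖Mg g (Pi.single i 1)‖ < n}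

lemma isOpen_opn (n : ℕ) : IsOpen (opn n) := by
  have hc : Continuous (fun g : G => (g : Matrix (Fin 3) (Fin 3) ℝ)) := continuous_induced_dom
  have : ∀ i, Continuous fun g : G => Mg g (Pi.single i 1) := by
    intro i
    have he : ∀ k l, Continuous fun g : G => g.1 k l := fun k l =>
      (continuous_apply l).comp ((continuous_apply k).comp hc)
    refine continuous_pi fun j => ?_
    fin_cases j <;> simp only [Mg, dt, cr_zero', cr_one', cr_two', Fin.zero_eta, Fin.mk_one,
      Fin.reduceFinMk, Matrix.cons_val] <;>
    exact (((((he _ _).mul (he _ _)).sub ((he _ _).mul (he _ _))).mul continuous_const).add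
      ((((he _ _).mul (he _ _)).sub ((he _ _).mul (he _ _))).mul continuous_const)).add
      ((((he _ _).mul (he _ _)).sub ((he _ _).mul (he _ _))).mul continuous_const)
  have h2 : opn n = ⋂ i, {g | ‖Mg g (Pi.single i 1)‖ < n} := by
    ext g; simp [opn]
  rw [h2]
  exact isOpen_iInter_of_finite fun i => isOpen_lt (this i).norm continuous_const

/-- image in `X` -/
def opnX (n : ℕ) : Set X := (fun g : G => (g : X)) '' opn n

lemma isOpen_opnX (n : ℕ) : IsOpen (opnX n) :=
  QuotientGroup.isOpenMap_coe _ (isOpen_opn n)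

lemma compact_sub_opnX {K : Set X} (hK : IsCompact K) : ∃ n, K ⊆ opnX n := by
  refine hK.elim_directed_cover opnX isOpen_opnX ?_ ?_
  · rintro x -
    obtain ⟨g, rfl⟩ := QuotientGroup.mk_surjective x
    obtain ⟨n, hn⟩ := exists_nat_gt (‖Mg g (Pi.single 0 1)‖ + ‖Mg g (Pi.single 1 1)‖
      + ‖Mg g (Pi.single 2 1)‖)
    refine Set.mem_iUnion.2 ⟨n, g, fun i => lt_of_le_of_lt ?_ hn, rfl⟩
    have := norm_nonneg (Mg g (Pi.single 0 1))
    have := norm_nonneg (Mg g (Pi.single 1 1))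
    have := norm_nonneg (Mg g (Pi.single 2 1))
    fin_cases i <;> simp only [Fin.zero_eta, Fin.mk_one, Fin.reduceFinMk] <;> linarith
  · refine directed_of_isDirected_le fun m n hmn => Set.image_mono fun g hg i => ?_
    exact (hg i).trans_le (by exact_mod_cast hmn)

lemma opnX_lower {n : ℕ} {g : G} (hg : (g : X) ∈ opnX n) {v : Fin 3 → ℤ} (hv : v ≠ 0) :
    1 ≤ 3 * ‖Lg g v‖ * n := by
  obtain ⟨h, hh, heq⟩ := hg
  have heq' : ((h : G) : X) = (g : X) := heq
  rw [QuotientGroup.eq] at heq'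
  obtain ⟨γ, hγ⟩ := heq'
  let u : Fin 3 → ℤ := γ.1.mulVec v
  have hu : u ≠ 0 := by
    intro h0
    apply hv
    have : (γ⁻¹ * γ).1.mulVec v = 0 := by
      rw [Matrix.SpecialLinearGroup.coe_mul, ← Matrix.mulVec_mulVec]
      change (γ⁻¹).1.mulVec u = 0
      rw [h0, Matrix.mulVec_zero]
    simpa using this
  have hLu : Lg h u = Lg g v := by
    have hg2 : g = h * Matrix.SpecialLinearGroup.map (n := Fin 3) (Int.castRingHom ℝ) γ := by
      have : h * (h⁻¹ * g) = g := by group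
      rw [← this]
      exact congrArg (h * ·) hγ.symm
    have key : ∀ (g : G) (v : Fin 3 → ℤ), Lg g v = g.1.mulVec (fun i => (v i : ℝ)) := by
      intro g v
      funext i
      simp [Lg, Matrix.mulVec, dotProduct, Fin.sum_univ_three]
    rw [key, key, hg2, Matrix.SpecialLinearGroup.coe_mul, ← Matrix.mulVec_mulVec]
    congr 1
    funext i
    simp [u, Matrix.mulVec, dotProduct, Fin.sum_univ_three]
  obtain ⟨i, hi⟩ : ∃ i, u i ≠ 0 := by
    by_contra hcon
    push Not at hcon
    exact hu (funext hcon)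
  have h1 := (dual_g h).coord u i
  rw [hLu] at h1
  have h2 : (1 : ℝ) ≤ |(u i : ℝ)| := by exact_mod_cast Int.one_le_abs hi
  have h3 := (hh i).le
  refine (h2.trans h1).trans ?_
  gcongr

/-! ### The concrete family -/

lemma prod_entries (a b t s : ℝ) : (gSL t * phiSL a b s).1 =
    !![Real.exp (2*t), Real.exp (2*t) * s, Real.exp (2*t) * (a*s+b); 0, Real.exp (-t), 0;
      0, 0, Real.exp (-t)] := by
  change Matrix.diagonal _ * _ = _
  ext i j
  rw [Matrix.diagonal_mul]
  fin_cases i <;> fin_cases j <;> simp [phiSL]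

lemma Lg_coord (a b t s : ℝ) (v : Fin 3 → ℤ) : Lg (gSL t * phiSL a b s) v =
    ![Real.exp (2*t) * ((v 0 + v 2 * b) + s * (v 1 + v 2 * a)), Real.exp (-t) * v 1,
      Real.exp (-t) * v 2] := by
  apply vec3_ext <;> simp only [Lg, prod_entries] <;> simp
  ring

lemma Mg_coord (a b t s : ℝ) (w : Fin 3 → ℤ) : Mg (gSL t * phiSL a b s) w =
    ![Real.exp (-t) * Real.exp (-t) * w 0, Real.exp (-t) * Real.exp (2*t) * (w 1 - s * w 0),
      Real.exp (-t) * Real.exp (2*t) * (w 2 - (a*s+b) * w 0)] := by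
  apply vec3_ext <;> simp only [Mg, dt, cr_zero', cr_one', cr_two', prod_entries] <;> simp <;> ring

lemma sys (a b t : ℝ) : Sys (fun s => Lg (gSL t * phiSL a b s)) (fun s => Mg (gSL t * phiSL a b s)) where
  dual s := dual_g _
  affL v i := by
    simp only [Lg_coord]
    fin_cases i
    · refine ⟨Real.exp (2*t) * (v 0 + v 2 * b), Real.exp (2*t) * (v 1 + v 2 * a), fun s => ?_⟩
      simp; ring
    · exact ⟨Real.exp (-t) * v 1, 0, fun s => by simp⟩
    · exact ⟨Real.exp (-t) * v 2, 0, fun s => by simp⟩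
  affM w i := by
    simp only [Mg_coord]
    fin_cases i
    · exact ⟨Real.exp (-t) * Real.exp (-t) * w 0, 0, fun s => by simp⟩
    · refine ⟨Real.exp (-t) * Real.exp (2*t) * w 1, -(Real.exp (-t) * Real.exp (2*t) * w 0),
        fun s => ?_⟩
      simp; ring
    · refine ⟨Real.exp (-t) * Real.exp (2*t) * (w 2 - b * w 0),
        -(Real.exp (-t) * Real.exp (2*t) * a * w 0), fun s => ?_⟩
      simp; ring

lemma int_zero_of_abs_lt {n : ℤ} (h : |(n : ℝ)| < 1) : n = 0 := by
  have : |n| < 1 := by exact_mod_cast h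
  exact Int.abs_lt_one_iff.1 this

lemma sup_M (a b t s₁ s₂ ρ : ℝ) (ht : 0 < t) (h : s₁ < s₂) (hρ : 0 < ρ) (hρ2 : ρ ≤ 1 / 2)
    (hρD : ρ ≤ (s₂ - s₁) / 2) (w : Fin 3 → ℤ) (hw : w ≠ 0) :
    ∃ s ∈ Set.Icc s₁ s₂, ρ ≤ ‖Mg (gSL t * phiSL a b s) w‖ := by
  by_contra hcon
  push Not at hcon
  have H := fun s hs => (pi_norm_lt_iff hρ).1 (hcon s hs)
  have hE : 1 ≤ Real.exp (-t) * Real.exp (2*t) := by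
    rw [← Real.exp_add]; exact Real.one_le_exp (by linarith)
  have m1 : s₁ ∈ Set.Icc s₁ s₂ := ⟨le_refl _, h.le⟩
  have m2 : s₂ ∈ Set.Icc s₁ s₂ := ⟨h.le, le_refl _⟩
  have strip : ∀ x : ℝ, |Real.exp (-t) * Real.exp (2*t) * x| < ρ → |x| < ρ := fun x hx => by
    rw [abs_mul, abs_of_pos (by positivity)] at hx
    nlinarith [abs_nonneg x]
  have a1 := H s₁ m1 1
  have a2 := H s₂ m2 1
  have a3 := H s₁ m1 2
  rw [Mg_coord, Real.norm_eq_abs] at a1 a2 a3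
  simp only [Matrix.cons_val] at a1 a2 a3
  replace a1 := strip _ a1
  replace a2 := strip _ a2
  replace a3 := strip _ a3
  have w0 : w 0 = 0 := by
    apply int_zero_of_abs_lt
    have : |((w 1 : ℝ) - s₁ * w 0) - (w 1 - s₂ * w 0)| < 2 * ρ := by
      have := abs_sub ((w 1 : ℝ) - s₁ * w 0) (w 1 - s₂ * w 0)
      linarith
    have e : ((w 1 : ℝ) - s₁ * w 0) - (w 1 - s₂ * w 0) = (s₂ - s₁) * w 0 := by ring
    rw [e, abs_mul, abs_of_pos (by linarith)] at this
    by_contra hc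
    push Not at hc
    nlinarith
  rw [w0] at a1 a3
  simp only [Int.cast_zero, mul_zero, sub_zero] at a1 a3
  have w1 := int_zero_of_abs_lt (a1.trans (by linarith))
  have w2 := int_zero_of_abs_lt (a3.trans (by linarith))
  exact hw (vec3_ext w0 w1 w2)

lemma sup_L (a b t s₁ s₂ ρ C : ℝ) (ht : 0 < t) (h : s₁ < s₂) (hρ : 0 < ρ) (hρ2 : ρ ≤ 1 / 2)
    (hρD : ρ ≤ (s₂ - s₁) / 2)
    (hρC : ρ * (2 / (s₂ - s₁) + 1 + |s₁| * (2 / (s₂ - s₁))) ≤ C)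
    (hW : ∀ p₁ p₂ q : ℤ, 0 < q → |(q : ℝ) * b + (p₁ : ℝ)| ≤ C / (q : ℝ) ^ 2 →
      ¬ |(q : ℝ) * a + (p₂ : ℝ)| ≤ C / (q : ℝ) ^ 2) (v : Fin 3 → ℤ) (hv : v ≠ 0) :
    ∃ s ∈ Set.Icc s₁ s₂, ρ ≤ ‖Lg (gSL t * phiSL a b s) v‖ := by
  by_contra hcon
  push Not at hcon
  have H := fun s hs => (pi_norm_lt_iff hρ).1 (hcon s hs)
  have m1 : s₁ ∈ Set.Icc s₁ s₂ := ⟨le_refl _, h.le⟩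
  have m2 : s₂ ∈ Set.Icc s₁ s₂ := ⟨h.le, le_refl _⟩
  have hE : Real.exp (2 * t) * Real.exp (-t) ^ 2 = 1 := by
    rw [pow_two, ← Real.exp_add, ← Real.exp_add]; simp; ring
  have he : 0 < Real.exp (-t) := Real.exp_pos _
  have he1 : Real.exp (-t) ≤ 1 := Real.exp_le_one_iff.2 (by linarith)
  have hE0 : 0 < Real.exp (2 * t) := Real.exp_pos _
  have a1 := H s₁ m1 0
  have a2 := H s₂ m2 0
  have a3 := H s₁ m1 2
  rw [Lg_coord, Real.norm_eq_abs] at a1 a2 a3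
  simp only [Matrix.cons_val] at a1 a2 a3
  set e := Real.exp (-t)
  set E := Real.exp (2 * t)
  set α : ℝ := v 0 + v 2 * b with hα
  set β : ℝ := v 1 + v 2 * a with hβ
  have strip : ∀ x : ℝ, |E * x| < ρ → |x| < ρ * e ^ 2 := fun x hx => by
    rw [abs_mul, abs_of_pos hE0] at hx
    have : |x| = (E * |x|) * e ^ 2 := by
      linear_combination (-|x|) * hE
    rw [this]
    gcongr
  replace a1 := strip _ a1
  replace a2 := strip _ a2
  have hD : 0 < s₂ - s₁ := by linarith
  have hβD : |β| * (s₂ - s₁) < 2 * (ρ * e ^ 2) := by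
    have h1 := abs_sub (α + s₂ * β) (α + s₁ * β)
    have h2 : (α + s₂ * β) - (α + s₁ * β) = β * (s₂ - s₁) := by ring
    rw [h2, abs_mul, abs_of_pos hD] at h1
    linarith
  have hβ2 : |β| ≤ 2 / (s₂ - s₁) * (ρ * e ^ 2) := by
    rw [div_mul_eq_mul_div, le_div_iff₀ hD]; exact hβD.le
  have hα2 : |α| ≤ ρ * e ^ 2 + |s₁| * |β| := by
    have h1 := abs_sub (α + s₁ * β) (s₁ * β)
    rw [add_sub_cancel_right, abs_mul] at h1
    linarith
  have hpos : 0 ≤ ρ * e ^ 2 := by positivity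
  have h2D : 0 ≤ 2 / (s₂ - s₁) := by positivity
  have hCe : ρ * (2 / (s₂ - s₁) + 1 + |s₁| * (2 / (s₂ - s₁))) * e ^ 2 ≤ C * e ^ 2 := by
    gcongr
  have hsβ : |s₁| * |β| ≤ |s₁| * (2 / (s₂ - s₁) * (ρ * e ^ 2)) := by gcongr
  have hαC : |α| ≤ C * e ^ 2 := by nlinarith [mul_nonneg h2D hpos]
  have hβC : |β| ≤ C * e ^ 2 := by
    nlinarith [mul_nonneg (abs_nonneg s₁) (mul_nonneg h2D hpos)]
  have hC : 0 ≤ C := le_trans (by positivity) hρC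
  by_cases hv2 : v 2 = 0
  · have e2 : e ^ 2 ≤ 1 := by nlinarith
    have hβv : β = v 1 := by rw [hβ, hv2]; simp
    have v1 : v 1 = 0 := by
      apply int_zero_of_abs_lt
      rw [← hβv]
      by_contra hc
      push Not at hc
      nlinarith
    have hα' : α + s₁ * β = v 0 := by rw [hα, hβ, hv2, v1]; simp
    rw [hα'] at a1
    have v0 := int_zero_of_abs_lt (a1.trans_le (by nlinarith))
    exact hv (vec3_ext v0 v1 hv2)
  · have hv2' : (v 2 : ℝ) ≠ 0 := by exact_mod_cast hv2
    have hq : 0 < (v 2 : ℝ) ^ 2 := by positivity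
    have h5 : C * e ^ 2 ≤ C / (v 2 : ℝ) ^ 2 := by
      rw [le_div_iff₀ hq, mul_assoc]
      have : e ^ 2 * (v 2 : ℝ) ^ 2 ≤ 1 := by
        rw [← mul_pow, ← sq_abs]
        have := abs_nonneg (e * (v 2 : ℝ))
        nlinarith
      nlinarith
    rcases lt_or_gt_of_ne hv2 with hneg | hposq
    · refine hW (-v 0) (-v 1) (-v 2) (by omega) ?_ ?_
      · push_cast
        have : -(v 2 : ℝ) * b + -(v 0) = -α := by rw [hα]; ring
        rw [this, abs_neg, neg_sq]; exact hαC.trans h5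
      · push_cast
        have : -(v 2 : ℝ) * a + -(v 1) = -β := by rw [hβ]; ring
        rw [this, abs_neg, neg_sq]; exact hβC.trans h5
    · refine hW (v 0) (v 1) (v 2) hposq ?_ ?_
      · have : (v 2 : ℝ) * b + (v 0) = α := by rw [hα]; ring
        rw [this]; exact hαC.trans h5
      · have : (v 2 : ℝ) * a + (v 1) = β := by rw [hβ]; ring
        rw [this]; exact hβC.trans h5

lemma cont_curve (a b t : ℝ) : Continuous fun s => ((gSL t * phiSL a b s : G) : X) := by
  have h1 : Continuous fun s => phiSL a b s := by
    rw [gInd.continuous_iff]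
    refine continuous_pi fun i => continuous_pi fun j => ?_
    fin_cases i <;> fin_cases j <;> simp [phiSL] <;> fun_prop
  exact continuous_quotient_mk'.comp (continuous_const.mul h1)

lemma gtLambda_eq (a b s₁ s₂ t : ℝ) : gtLambda a b s₁ s₂ t =
    Measure.map (fun s => ((gSL t * phiSL a b s : G) : X))
      ((volume (Set.Icc s₁ s₂))⁻¹ • volume.restrict (Set.Icc s₁ s₂)) := by
  unfold gtLambda lambdaAB
  have e : (fun s => phiSL a b s • x₀) = fun s => ((phiSL a b s : G) : X) := by
    funext s
    change ((phiSL a b s * 1 : G) : X) = _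
    rw [mul_one]
  have hm : Measurable fun s => phiSL a b s • x₀ := by
    rw [e]
    have := cont_curve a b 0
    have h0 : gSL 0 = 1 := by
      ext i j
      fin_cases i <;> fin_cases j <;> simp [gSL]
    simp only [h0, one_mul] at this
    exact this.measurable
  have hm2 : Measurable fun x : X => gSL t • x := (continuous_const_smul (gSL t)).measurable
  rw [Measure.map_map hm2 hm]
  congr 1
  rw [e]
  rfl

lemma escape (a b s₁ s₂ : ℝ) (hW : W2inf a b) (n : ℕ) :
    ∃ t : ℝ, 0 < t ∧ gtLambda a b s₁ s₂ t (opnX n) = 0 := by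
  set H : ℝ := 2 + (|s₁| + |s₂|) + |a| with hH
  have hH2 : 2 ≤ H := by
    have := abs_nonneg s₁; have := abs_nonneg s₂; have := abs_nonneg a
    linarith
  have hn0 : (0 : ℝ) ≤ n := Nat.cast_nonneg n
  set δ : ℝ := 1 / (3 * H * (n + 1)) with hδ
  have hden : 0 < 3 * H * ((n : ℝ) + 1) := by positivity
  have hδ0 : 0 < δ := by positivity
  have hδe : δ * (3 * H * (n + 1)) = 1 := by rw [hδ]; field_simp
  have hδ1 : δ < 1 := by
    rw [hδ, div_lt_one hden]; nlinarith
  obtain ⟨p₁, p₂, q, hq, h1, h2⟩ := hW (δ ^ 3) (by positivity)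
  have hq1 : (1 : ℝ) ≤ q := by exact_mod_cast hq
  have hq0 : (0 : ℝ) < q := by linarith
  have hqδ : 0 < (q : ℝ) / δ := by positivity
  refine ⟨Real.log (q / δ), Real.log_pos ?_, ?_⟩
  · rw [lt_div_iff₀ hδ0]; linarith
  set t := Real.log (q / δ) with ht
  have e1 : Real.exp (-t) = δ / q := by
    rw [Real.exp_neg, ht, Real.exp_log hqδ, inv_div]
  have e2 : Real.exp (2 * t) = (q / δ) ^ 2 := by
    rw [two_mul, Real.exp_add, ht, Real.exp_log hqδ, pow_two]
  have hempty : ∀ s ∈ Set.Icc s₁ s₂, ((gSL t * phiSL a b s : G) : X) ∉ opnX n := by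
    intro s hs hmem
    have hv : (![p₁, p₂, q] : Fin 3 → ℤ) ≠ 0 := by
      intro h0
      have := congrFun h0 2
      simp at this
      omega
    have hlow := opnX_lower hmem hv
    have hsabs : |s| ≤ |s₁| + |s₂| := by
      rw [abs_le]
      have := neg_abs_le s₁; have := le_abs_self s₂
      have := abs_nonneg s₁; have := abs_nonneg s₂
      constructor <;> linarith [hs.1, hs.2]
    have hup : ‖Lg (gSL t * phiSL a b s) ![p₁, p₂, q]‖ ≤ δ * H := by
      refine (pi_norm_le_iff_of_nonneg (by positivity)).2 fun i => ?_
      rw [Lg_coord, e1, e2, Real.norm_eq_abs]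
      fin_cases i
      · simp only [Fin.zero_eta, Matrix.cons_val]
        have hx : |((p₁ : ℝ) + q * b) + s * (p₂ + q * a)|
            ≤ δ ^ 3 / q ^ 2 * (1 + (|s₁| + |s₂|)) := by
          refine (abs_add_le _ _).trans ?_
          rw [abs_mul, add_comm (p₁ : ℝ), add_comm (p₂ : ℝ)]
          have : |s| * |(q : ℝ) * a + p₂| ≤ (|s₁| + |s₂|) * (δ ^ 3 / q ^ 2) := by gcongr
          linarith
        rw [abs_mul, abs_of_pos (by positivity)]
        calc ((q : ℝ) / δ) ^ 2 * |((p₁ : ℝ) + q * b) + s * (p₂ + q * a)|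
            ≤ ((q : ℝ) / δ) ^ 2 * (δ ^ 3 / q ^ 2 * (1 + (|s₁| + |s₂|))) := by gcongr
          _ = δ * (1 + (|s₁| + |s₂|)) := by field_simp
          _ ≤ δ * H := by
            gcongr
            rw [hH]; linarith [abs_nonneg a]
      · simp only [Fin.mk_one, Matrix.cons_val]
        have hx : |(p₂ : ℝ)| ≤ q * (1 + |a|) := by
          have h3 := abs_sub ((q : ℝ) * a + p₂) (q * a)
          rw [add_sub_cancel_left, abs_mul, abs_of_pos hq0] at h3
          have h4 : δ ^ 3 / (q : ℝ) ^ 2 ≤ 1 := by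
            rw [div_le_one (by positivity)]
            have : δ ^ 3 ≤ 1 := pow_le_one₀ hδ0.le hδ1.le
            nlinarith
          linarith
        rw [abs_mul, abs_of_pos (by positivity)]
        calc δ / q * |(p₂ : ℝ)| ≤ δ / q * (q * (1 + |a|)) := by gcongr
          _ = δ * (1 + |a|) := by field_simp
          _ ≤ δ * H := by
            gcongr
            rw [hH]; linarith [abs_nonneg s₁, abs_nonneg s₂]
      · simp only [Fin.reduceFinMk, Matrix.cons_val]
        rw [div_mul_cancel₀ _ hq0.ne', abs_of_pos hδ0]
        nlinarith
    have : 3 * ‖Lg (gSL t * phiSL a b s) ![p₁, p₂, q]‖ * n ≤ 3 * (δ * H) * n := by gcongr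
    nlinarith [mul_pos hδ0 (by linarith : 0 < H)]
  rw [gtLambda_eq, Measure.map_apply (cont_curve a b t).measurable (isOpen_opnX n).measurableSet,
    Measure.smul_apply, Measure.restrict_apply' measurableSet_Icc]
  have : (fun s => ((gSL t * phiSL a b s : G) : X)) ⁻¹' opnX n ∩ Set.Icc s₁ s₂ = ∅ := by
    rw [Set.eq_empty_iff_forall_notMem]
    rintro s ⟨h1, h2⟩
    exact hempty s h2 h1
  rw [this]; simp

lemma noescape (a b s₁ s₂ : ℝ) (h : s₁ < s₂) (hW : ¬ W2inf a b) (ε : ℝ≥0∞) (hε : 0 < ε) :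
    ∃ K : Set X, IsCompact K ∧ ∀ t : ℝ, 0 < t → 1 - ε < gtLambda a b s₁ s₂ t K := by
  unfold W2inf at hW
  push Not at hW
  obtain ⟨C, hC, hW⟩ := hW
  have hD : 0 < s₂ - s₁ := by linarith
  set S : ℝ := 2 / (s₂ - s₁) + 1 + |s₁| * (2 / (s₂ - s₁)) with hS
  have hS0 : 0 < S := by positivity
  set ρ : ℝ := min (1 / 2) (min ((s₂ - s₁) / 2) (C / S)) with hρ
  have hρ0 : 0 < ρ := by positivity
  have hρ1 : ρ ≤ 1 / 2 := min_le_left _ _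
  have hρ2 : ρ ≤ (s₂ - s₁) / 2 := (min_le_right _ _).trans (min_le_left _ _)
  have hρ3 : ρ * S ≤ C := by
    rw [← le_div_iff₀ hS0]; exact (min_le_right _ _).trans (min_le_right _ _)
  set ε' : ℝ≥0∞ := min ε 1 with hε'
  have hε'0 : 0 < ε' := lt_min hε one_pos
  have hε't : ε' ≠ ⊤ := ne_top_of_le_ne_top one_ne_top (min_le_right _ _)
  have hr : 0 < ε'.toReal := ENNReal.toReal_pos hε'0.ne' hε't
  set κ : ℝ := min (ρ / 4) (ε'.toReal / 80) with hκ
  have hκ0 : 0 < κ := by positivity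
  have hκ1 : κ ≤ ρ / 4 := min_le_left _ _
  have hκ2 : ENNReal.ofReal (40 * κ) < ε' := by
    rw [ENNReal.ofReal_lt_iff_lt_toReal (by positivity) hε't]
    have : κ ≤ ε'.toReal / 80 := min_le_right _ _
    linarith
  refine ⟨KX (2 + 2 / κ ^ 2), isCompact_KX _, fun t ht => ?_⟩
  have hbad := (sys a b t).nondiv (s₁ := s₁) (s₂ := s₂) hκ0 hρ0 hκ1 hρ1
    (sup_L a b t s₁ s₂ ρ C ht h hρ0 hρ1 hρ2 hρ3
      (fun p₁ p₂ q hq h1 => not_le.2 (hW p₁ p₂ q hq h1)))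
    (sup_M a b t s₁ s₂ ρ ht h hρ0 hρ1 hρ2)
  set I := Set.Icc s₁ s₂ with hI
  set K := KX (2 + 2 / κ ^ 2)
  set f : ℝ → X := fun s => ((gSL t * phiSL a b s : G) : X) with hf
  have hvol0 : volume I ≠ 0 := by
    rw [hI, Real.volume_Icc]; simpa using h
  have hvolt : volume I ≠ ⊤ := by
    rw [hI, Real.volume_Icc]; exact ENNReal.ofReal_ne_top
  have h2 : 2 * ENNReal.ofReal (20 * κ) = ENNReal.ofReal (40 * κ) := by
    have : (2 : ℝ≥0∞) = ENNReal.ofReal 2 := by simp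
    rw [this, ← ENNReal.ofReal_mul (by norm_num)]
    congr 1; ring
  rw [h2] at hbad
  have hcov : volume I ≤ volume (f ⁻¹' K ∩ I) + ENNReal.ofReal (40 * κ) * volume I := by
    refine le_trans ?_ (add_le_add le_rfl hbad)
    refine le_trans (measure_mono fun s hs => ?_) (measure_union_le _ _)
    by_cases hsb : s ∈ Bad (fun s => Lg (gSL t * phiSL a b s))
        (fun s => Mg (gSL t * phiSL a b s)) I (κ ^ 2)
    · exact Or.inr hsb
    · left
      refine ⟨?_, hs⟩
      refine mem_KX (by positivity) (fun v hv => ?_) (fun v hv => ?_)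
      · by_contra hc
        exact hsb ⟨hs, v, hv, Or.inl (not_le.1 hc)⟩
      · by_contra hc
        exact hsb ⟨hs, v, hv, Or.inr (not_le.1 hc)⟩
  have hle : (volume I)⁻¹ * volume (f ⁻¹' K ∩ I) ≤ gtLambda a b s₁ s₂ t K := by
    rw [gtLambda_eq]
    refine le_trans (le_of_eq ?_) (Measure.le_map_apply (cont_curve a b t).measurable.aemeasurable K)
    rw [Measure.smul_apply, Measure.restrict_apply' measurableSet_Icc, smul_eq_mul]
  refine lt_of_lt_of_le ?_ hle
  set x := (volume I)⁻¹ * volume (f ⁻¹' K ∩ I) with hx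
  have h1x : 1 ≤ x + ENNReal.ofReal (40 * κ) := by
    have h3 : (volume I)⁻¹ * volume I ≤ (volume I)⁻¹ * (volume (f ⁻¹' K ∩ I)
      + ENNReal.ofReal (40 * κ) * volume I) := by gcongr
    rw [ENNReal.inv_mul_cancel hvol0 hvolt, mul_add, mul_comm (ENNReal.ofReal _), ← mul_assoc,
      ENNReal.inv_mul_cancel hvol0 hvolt, one_mul] at h3
    exact h3
  have hxt : x ≠ ⊤ := by
    refine ENNReal.mul_ne_top (ENNReal.inv_ne_top.2 hvol0) ?_
    exact ne_top_of_le_ne_top hvolt (measure_mono Set.inter_subset_right)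
  have h1x' : 1 < x + ε' := lt_of_le_of_lt h1x (ENNReal.add_lt_add_left hxt hκ2)
  have : 1 - ε ≤ 1 - ε' := tsub_le_tsub_left (min_le_left _ _) _
  refine lt_of_le_of_lt this ?_
  exact (ENNReal.sub_lt_iff_lt_right hε't (min_le_right _ _)).2 h1x'

/-- **Theorem (no escape of mass criterion).**
The translates `{g_t λ_{a,b}}_{t>0}` have no escape of mass (for every `ε > 0` there is a
compact `K ⊆ X` with `(g_t λ_{a,b})(K) > 1 - ε` for all `t > 0`) iff `(a,b) ∉ W₂^∞`. -/
theorem no_escape_of_mass_iff (a b s₁ s₂ : ℝ) (h : s₁ < s₂) :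
    (∀ ε : ℝ≥0∞, 0 < ε → ∃ K : Set X, IsCompact K ∧
      ∀ t : ℝ, 0 < t → 1 - ε < gtLambda a b s₁ s₂ t K) ↔ ¬ W2inf a b := by

  constructor
  · intro hall hW
    obtain ⟨K, hK, hKt⟩ := hall 1 one_pos
    obtain ⟨n, hn⟩ := compact_sub_opnX hK
    obtain ⟨t, ht, h0⟩ := escape a b s₁ s₂ hW n
    have h1 := hKt t ht
    have h2 := (h1.trans_le (measure_mono hn))
    rw [h0] at h2
    exact absurd h2 (by simp)
  · intro hW ε hε
    exact noescape a b s₁ s₂ h hW ε hε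
end
end

section
/- Let (a,b) ∈ ℝ² with (a,b) ∉ ℚ². Then for Lebesgue-almost every s ∈ ℝ, the vector (s, as+b) ∈ ℝ² is not Dirichlet-improvable. -/
open Filter

/-- A vector `x ∈ ℝ²` is `δ`-improvable (`0 < δ < 1`) if for every sufficiently large
`T > 0` there exist `p ∈ ℤ²` and `q ∈ ℤ \ {0}` with `‖qx + p‖ ≤ δ T⁻¹` and `|q| ≤ T²`,
where `‖·‖` is the supremum norm on `ℝ²`. -/
def DeltaImprovable (δ : ℝ) (x : ℝ × ℝ) : Prop :=
  ∀ᶠ T in atTop, 0 < T →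
    ∃ (p : ℤ × ℤ) (q : ℤ), q ≠ 0 ∧
      max |(q : ℝ) * x.1 + (p.1 : ℝ)| |(q : ℝ) * x.2 + (p.2 : ℝ)| ≤ δ / T ∧
      |(q : ℝ)| ≤ T ^ 2

/-- A vector `x ∈ ℝ²` is Dirichlet-improvable if it is `δ`-improvable for some
`0 < δ < 1`. -/
def DirichletImprovable (x : ℝ × ℝ) : Prop :=
  ∃ δ : ℝ, 0 < δ ∧ δ < 1 ∧ DeltaImprovable δ x


lemma coprime_approx (K : ℕ) (hK : 1 ≤ K) (y : ℝ) :
    ∃ (y' : ℤ) (D : ℕ), 1 ≤ D ∧ D ≤ 4 * K ∧ |y - y'| ≤ 1 + |y| / K ∧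
      ∀ x' : ℤ, (D : ℤ) ∣ x' - 1 → IsCoprime x' y' := by
  have hK' : (1:ℝ) ≤ K := by exact_mod_cast hK
  have hex : ∃ n : ℕ, |y| < 2 * K * 2 ^ n := by
    obtain ⟨n, hn⟩ := pow_unbounded_of_one_lt |y| (one_lt_two : (1:ℝ) < 2)
    refine ⟨n, hn.trans_le ?_⟩
    have : (0:ℝ) < 2 ^ n := by positivity
    nlinarith
  classical
  obtain ⟨A, hA1, hA2⟩ : ∃ A : ℕ, |y| < 2 * K * 2 ^ A ∧ (2:ℝ) ^ A ≤ 1 + |y| / K := by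
    refine ⟨Nat.find hex, Nat.find_spec hex, ?_⟩
    rcases hn : Nat.find hex with _ | n
    · simp; positivity
    · have := Nat.find_min hex (m := n) (by omega)
      push Not at this
      have h2 : (2:ℝ) ^ (n+1) ≤ |y| / K := by
        rw [le_div_iff₀ (by positivity), pow_succ]; linarith
      linarith
  set z := y / 2 ^ A with hz
  have hp : (0:ℝ) < 2 ^ A := by positivity
  have hzy : y = z * 2 ^ A := by rw [hz]; field_simp
  have hzK : |z| < 2 * K := by
    rw [hz, abs_div, abs_of_pos hp, div_lt_iff₀ hp]; exact hA1
  obtain ⟨l, hl0, hlK, hlz⟩ : ∃ l : ℤ, l ≠ 0 ∧ |l| ≤ 2 * K ∧ |z - l| ≤ 1 := by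
    have f1 := Int.floor_le z
    have f2 := Int.lt_floor_add_one z
    rw [abs_lt] at hzK
    by_cases h : ⌊z⌋ = 0
    · refine ⟨1, one_ne_zero, ?_, ?_⟩
      · simp; omega
      · rw [h] at f1 f2; push_cast at *; rw [abs_le]; constructor <;> linarith
    · refine ⟨⌊z⌋, h, ?_, ?_⟩
      · rw [abs_le]
        constructor
        · rw [Int.le_floor]; push_cast; linarith
        · have : (⌊z⌋ : ℝ) < ((2 * K : ℤ) : ℝ) := by push_cast; linarith
          exact le_of_lt (by exact_mod_cast this)
      · rw [abs_le]; constructor <;> linarith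
  refine ⟨l * 2 ^ A, (2 * l).natAbs, ?_, ?_, ?_, ?_⟩
  · have : (2 * l).natAbs ≠ 0 := by simpa using hl0
    omega
  · rw [abs_le] at hlK
    omega
  · push_cast
    have : y - l * 2 ^ A = (z - l) * 2 ^ A := by rw [hzy]; ring
    rw [this, abs_mul, abs_of_pos hp]
    nlinarith
  · intro x' hx
    rw [Int.natCast_natAbs, abs_dvd] at hx
    obtain ⟨t, ht⟩ := hx
    refine IsCoprime.mul_right ⟨1, -2 * t, ?_⟩ (IsCoprime.pow_right ⟨1, -l * t, ?_⟩) <;> linear_combination ht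

lemma reduce_basis (A1 B1 A2 B2 Δ lam : ℝ) (hΔ : 0 < Δ) (hdet : A1 * B2 - A2 * B1 = Δ)
    (hl : lam = max |A1| |B1|) (hl0 : 0 < lam) :
    ∃ t : ℤ, |A2 - t * A1| ≤ Δ / lam + lam / 2 ∧ |B2 - t * B1| ≤ Δ / lam + lam / 2 := by
  have key : ∀ A1 B1 A2 B2 : ℝ, |A1 * B2 - A2 * B1| = Δ → |B1| ≤ |A1| → lam = |A1| →
      ∃ t : ℤ, |A2 - t * A1| ≤ Δ / lam + lam / 2 ∧ |B2 - t * B1| ≤ Δ / lam + lam / 2 := by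
    intro A1 B1 A2 B2 hdet hle hl
    have hA : A1 ≠ 0 := by rintro rfl; simp at hl; linarith
    refine ⟨round (A2 / A1), ?_, ?_⟩
    all_goals
      set t := round (A2 / A1) with ht
      have h1 : |A2 - t * A1| ≤ lam / 2 := by
        have := abs_sub_round (A2 / A1)
        have e : A2 - t * A1 = (A2 / A1 - t) * A1 := by field_simp
        rw [e, abs_mul, ← hl]; nlinarith
    · have : 0 < Δ / lam := by positivity
      linarith
    · have h2 : A1 * (B2 - t * B1) = (A1 * B2 - A2 * B1) + (A2 - t * A1) * B1 := by ring
      have h3 : lam * |B2 - t * B1| ≤ Δ + lam / 2 * lam := by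
        rw [hl, ← abs_mul, h2]
        refine (abs_add_le _ _).trans ?_
        rw [hdet, abs_mul, ← hl]
        have := mul_le_mul h1 (hle.trans_eq hl.symm) (abs_nonneg _) (by positivity)
        linarith
      have h4 : Δ / lam + lam / 2 = (Δ + lam / 2 * lam) / lam := by field_simp
      rw [h4, le_div_iff₀ hl0]; linarith
  rcases le_total |B1| |A1| with h | h
  · exact key A1 B1 A2 B2 (by rw [hdet, abs_of_pos hΔ]) h (by rw [hl, max_eq_left h])
  · obtain ⟨t, h1, h2⟩ := key B1 A1 B2 A2 (by
      rw [← abs_neg, show -(B1 * A2 - B2 * A1) = Δ by linarith, abs_of_pos hΔ]) h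
      (by rw [hl, max_eq_right h])
    exact ⟨t, h2, h1⟩

set_option maxHeartbeats 1600000 in
lemma lattice_point (e : ℝ) (he : 0 < e) (he1 : e ≤ 1) :
    ∃ C R0 : ℝ, 4 ≤ C ∧ 1 ≤ R0 ∧ ∀ R μ ν τ : ℝ, R0 ≤ R → 0 < ν → ν ≤ μ → μ * ν ≤ 2 / R →
      (∀ i j : ℤ, (|j * τ + i * μ| ≤ C / R ∧ |j * ν| ≤ C / R) → i = 0 ∧ j = 0) →
      ∃ i j : ℤ, IsCoprime i j ∧ |j * τ + i * μ - 1| ≤ e ∧ |j * ν - 1| ≤ e := by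
  obtain ⟨K, hK⟩ := exists_nat_ge (12 / e)
  have hKpos : (1:ℝ) ≤ K := by
    refine le_trans ?_ hK
    rw [le_div_iff₀ he]; linarith
  have hK1 : 1 ≤ K := by exact_mod_cast hKpos
  set ρ := e / (16 * K) with hρ
  have hρ0 : 0 < ρ := by positivity
  have hρK : 4 * K * ρ = e / 4 := by rw [hρ]; field_simp; norm_num
  have hρe : ρ ≤ e / 16 := by
    rw [hρ]; apply div_le_div_of_nonneg_left he.le (by norm_num); linarith
  have h3K : 3 / K ≤ e / 4 := by
    rw [div_le_iff₀ (by positivity)]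
    rw [div_le_iff₀ he] at hK; linarith
  refine ⟨16 / e, 2 / ρ ^ 2, ?_, ?_, ?_⟩
  · rw [le_div_iff₀ he]; linarith
  · rw [le_div_iff₀ (by positivity)]; nlinarith
  intro R μ ν τ hR hν hνμ hΔR hbad
  have hRpos : 0 < R := lt_of_lt_of_le (by positivity) hR
  have hμ : 0 < μ := hν.trans_le hνμ
  set Δ := μ * ν with hΔ
  have hΔ0 : 0 < Δ := by positivity
  have hsq : √Δ ≤ ρ := by
    rw [Real.sqrt_le_left hρ0.le]
    refine hΔR.trans ?_
    rw [div_le_iff₀ hRpos]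
    rw [div_le_iff₀ (by positivity)] at hR; linarith
  have hsq0 : 0 < √Δ := Real.sqrt_pos.2 hΔ0
  have hsqsq : √Δ * √Δ = Δ := Real.mul_self_sqrt hΔ0.le
  set n := ⌊√Δ / ν⌋₊ with hn
  have hn1 : 0 < n := by
    rw [hn, Nat.floor_pos, le_div_iff₀ hν, one_mul]
    apply Real.le_sqrt_of_sq_le; nlinarith
  have hnlt : √Δ / ν < n + 1 := Nat.lt_floor_add_one _
  have hnle : (n:ℝ) ≤ √Δ / ν := Nat.floor_le (by positivity)
  obtain ⟨r, hr1, hr2⟩ := Real.exists_rat_abs_sub_le_and_den_le (τ / μ) hn1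
  have hden : (0:ℝ) < r.den := by exact_mod_cast r.den_pos
  set j1 : ℤ := ((r.den : ℕ) : ℤ) with hj1
  set i1 : ℤ := - r.num with hi1
  have hcop : IsCoprime i1 j1 := by
    rw [hi1, IsCoprime.neg_left_iff]; exact r.isCoprime_num_den
  have hA1 : |j1 * τ + i1 * μ| ≤ √Δ := by
    have e1 : (j1 * τ + i1 * μ : ℝ) = μ * r.den * (τ / μ - r) := by
      have : (r:ℝ) = r.num / r.den := by exact_mod_cast (Rat.num_div_den r).symm
      rw [this]; simp [hj1, hi1]; field_simp; ring
    rw [e1, abs_mul, abs_of_pos (by positivity)]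
    calc μ * r.den * |τ / μ - r| ≤ μ * r.den * (1 / ((n + 1) * r.den)) := by gcongr
      _ = μ / (n + 1) := by field_simp
      _ ≤ √Δ := by
        rw [div_le_iff₀ (by positivity)]
        rw [div_lt_iff₀ hν] at hnlt
        have : √Δ * √Δ ≤ √Δ * ((n+1) * ν) := by gcongr
        rw [hsqsq, hΔ] at this
        have h2 : μ * ν ≤ (√Δ * (n+1)) * ν := by linarith
        exact le_of_mul_le_mul_right h2 hν
  have hB1 : |j1 * ν| ≤ √Δ := by
    rw [abs_mul, abs_of_pos hν]
    have : |(j1:ℝ)| = r.den := by simp [hj1]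
    rw [this]
    have h2 : (r.den:ℝ) ≤ n := by exact_mod_cast hr2
    calc (r.den:ℝ) * ν ≤ √Δ / ν * ν := by gcongr; linarith
      _ = √Δ := by field_simp
  obtain ⟨j2, i2', hbez⟩ := hcop
  set i2 := -i2' with hi2
  have hbez' : i1 * j2 - i2 * j1 = 1 := by rw [hi2]; linarith
  have hbezR : (i1 * j2 - i2 * j1 : ℝ) = 1 := by exact_mod_cast hbez'
  set A1 := (j1 * τ + i1 * μ : ℝ) with hA1d
  set B1 := (j1 * ν : ℝ) with hB1d
  set lam := max |A1| |B1| with hlam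
  have hlamle : lam ≤ √Δ := max_le hA1 hB1
  have hlamC : 16 / e / R < lam := by
    by_contra hcon
    push Not at hcon
    have := hbad i1 j1 ⟨(le_max_left _ _).trans hcon, (le_max_right _ _).trans hcon⟩
    have h2 := this.2
    simp [hj1] at h2
  have hlam0 : 0 < lam := lt_trans (by positivity) hlamC
  obtain ⟨t, hA2, hB2⟩ := reduce_basis A1 B1 (j2 * τ + i2 * μ) (j2 * ν) Δ lam hΔ0
    (by rw [hA1d, hB1d, hΔ]; linear_combination μ * ν * hbezR) hlam hlam0
  set A2 := ((j2 * τ + i2 * μ) - t * A1 : ℝ) with hA2d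
  set B2 := (j2 * ν - t * B1 : ℝ) with hB2d
  have hdet : A1 * B2 - A2 * B1 = Δ := by
    rw [hA2d, hB2d, hA1d, hB1d, hΔ]; linear_combination μ * ν * hbezR
  set L := Δ / lam + lam / 2 with hL
  have hLpos : 0 < L := by positivity
  have hL1 : L ≤ e / 4 := by
    have : Δ / lam ≤ e / 8 := by
      rw [div_le_iff₀ hlam0]
      have : 2 / R = e / 8 * (16 / e / R) := by field_simp; norm_num
      nlinarith
    have : lam ≤ e / 16 := by linarith
    rw [hL]; linarith
  set x := (B2 - A2) / Δ with hx
  set y := (A1 - B1) / Δ with hy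
  have hy1 : |y| ≤ 2 * lam / Δ := by
    rw [hy, abs_div, abs_of_pos hΔ0]
    gcongr
    have := abs_sub A1 B1
    have := le_max_left |A1| |B1|
    have := le_max_right |A1| |B1|
    linarith
  have hyL : |y| * L ≤ 3 := by
    calc |y| * L ≤ 2 * lam / Δ * L := by gcongr
      _ = 2 + lam * lam / Δ := by rw [hL]; field_simp
      _ ≤ 2 + 1 := by
        gcongr
        rw [div_le_one hΔ0, ← hsqsq]
        gcongr
      _ = 3 := by norm_num
  obtain ⟨y', D, hD1, hD2, hyy, hcop⟩ := coprime_approx K hK1 y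
  have hDR : (1:ℝ) ≤ D := by exact_mod_cast hD1
  have hDR2 : (D:ℝ) ≤ 4 * K := by exact_mod_cast hD2
  set x' : ℤ := 1 + D * round ((x - 1) / D) with hx'
  have hxx : |x - x'| ≤ D := by
    have h := abs_sub_round ((x - 1) / D)
    have e1 : x - x' = ((x - 1) / D - round ((x - 1) / D)) * D := by
      rw [hx']; push_cast; field_simp; ring
    rw [e1, abs_mul, abs_of_pos (by linarith : (0:ℝ) < D)]
    nlinarith
  have hc := hcop x' ⟨round ((x - 1) / D), by rw [hx']; ring⟩
  refine ⟨x' * i1 + y' * (i2 - t * i1), x' * j1 + y' * (j2 - t * j1), ?_, ?_, ?_⟩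
  · obtain ⟨u, w, huw⟩ := hc
    refine ⟨u * (j2 - t * j1) - w * j1, - u * (i2 - t * i1) + w * i1, ?_⟩
    linear_combination huw + (u * x' + w * y') * hbez'
  · have hsol : x * A1 + y * A2 = 1 := by
      rw [hx, hy]; field_simp; rw [← hdet]; ring
    have e1 : (((x' * j1 + y' * (j2 - t * j1) : ℤ) : ℝ) * τ + ((x' * i1 + y' * (i2 - t * i1) : ℤ) : ℝ) * μ - 1)
        = - ((x - x') * A1 + (y - y') * A2) := by
      rw [show (1:ℝ) = x * A1 + y * A2 from hsol.symm, hA2d, hA1d]; push_cast; ring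
    rw [e1, abs_neg]
    refine (abs_add_le _ _).trans ?_
    rw [abs_mul, abs_mul]
    have h1 : |x - x'| * |A1| ≤ 4 * K * ρ :=
      mul_le_mul (hxx.trans hDR2) (hA1.trans hsq) (abs_nonneg _) (by positivity)
    have h2 : |y - y'| * |A2| ≤ (1 + |y| / K) * L :=
      mul_le_mul hyy hA2 (abs_nonneg _) (by positivity)
    have h3 : (1 + |y| / K) * L ≤ L + 3 / K := by
      have : (1 + |y| / K) * L = L + (|y| * L) / K := by field_simp
      rw [this]; gcongr
    linarith
  · have hsol : x * B1 + y * B2 = 1 := by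
      rw [hx, hy]; field_simp; rw [← hdet]; ring
    have e1 : (((x' * j1 + y' * (j2 - t * j1) : ℤ) : ℝ) * ν - 1)
        = - ((x - x') * B1 + (y - y') * B2) := by
      rw [show (1:ℝ) = x * B1 + y * B2 from hsol.symm, hB2d, hB1d]; push_cast; ring
    rw [e1, abs_neg]
    refine (abs_add_le _ _).trans ?_
    rw [abs_mul (x - x'), abs_mul (y - y')]
    have h1 : |x - x'| * |B1| ≤ 4 * K * ρ :=
      mul_le_mul (hxx.trans hDR2) (hB1.trans hsq) (abs_nonneg _) (by positivity)
    have h2 : |y - y'| * |B2| ≤ (1 + |y| / K) * L :=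
      mul_le_mul hyy hB2 (abs_nonneg _) (by positivity)
    have h3 : (1 + |y| / K) * L ≤ L + 3 / K := by
      have : (1 + |y| / K) * L = L + (|y| * L) / K := by field_simp
      rw [this]; gcongr
    linarith


lemma eps_aux1 (ε : ℝ) (h0 : 0 < ε) : (1 - ε) * (1 + ε / 4) ≤ 1 - ε / 4 := by nlinarith

lemma eps_aux2 (ε : ℝ) (h0 : 0 < ε) (h1 : ε ≤ 1 / 20) :
    1 + ε / 4 ≤ (1 + 7 / 4 * ε) * (1 - ε / 4) := by nlinarith

set_option maxHeartbeats 3200000 in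
/-- the deterministic criterion -/
lemma good_interval (a b d ε η T : ℝ) (hd0 : 0 < d) (hε0 : 0 < ε) (hεd : ε ≤ (1 - d) / 20)
    (hη0 : 0 < η) (hη : (2 + |a|) * η ≤ ε) (hT : 1 ≤ T)
    (n1 n2 n3 P1 P2 i j : ℤ) (hcop : IsCoprime n1 n2) (hn2 : 0 < n2) (hn2T : (n2:ℝ) ≤ η * T)
    (hm0 : 0 < n1 + a * n2) (hmT : n1 + a * n2 ≤ η * T) (hP : n1 * P1 + n2 * P2 = - n3)
    (hij : IsCoprime i j)
    (hW : |j * (T * (b + P2 - a * P1)) + i * (T * (n1 + a * n2)) - 1| ≤ ε / 4)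
    (hν : |j * (1 / (n2 * T)) - 1| ≤ ε / 4) :
    ∃ s0 : ℝ, ∀ s ∈ Set.Icc s0 (s0 + 1 / (4 * T ^ 3)),
      (1 / 2 ≤ T ^ 2 * (s * (n1 + a * n2) + b * n2 - n3) ∧
        T ^ 2 * (s * (n1 + a * n2) + b * n2 - n3) ≤ 2) ∧
      ∀ x y z : ℤ, |T * (z * s + x)| ≤ d → |T * (z * (a * s + b) + y)| ≤ d →
        |(z:ℝ)| ≤ d * T ^ 2 → z = 0 := by
  have hT0 : 0 < T := by linarith
  have hn2R : (0:ℝ) < n2 := by exact_mod_cast hn2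
  have ha : 0 ≤ |a| := abs_nonneg a
  have hd1 : d < 1 := by linarith
  have haη0 : 0 ≤ |a| * η := by positivity
  have hηε : η ≤ ε / 2 := by linarith
  have haη : |a| * η ≤ ε := by linarith
  have haη1 : (1 + |a|) * η ≤ ε := by linarith
  have hPR : (n1 * P1 + n2 * P2 : ℝ) = - n3 := by exact_mod_cast hP
  set m : ℝ := n1 + a * n2 with hm
  set φ2 : ℝ := b + P2 - a * P1 with hφ2
  set φ : ℝ := j * φ2 + i * m with hφ
  have hW' : |T * φ - 1| ≤ ε / 4 := by
    rw [hφ]; convert hW using 2; ring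
  have hν' : |j / (n2 * T) - 1| ≤ ε / 4 := by
    convert hν using 2; ring
  rw [abs_le] at hν'
  have hjν1 : (1 - ε / 4) * (n2 * T) ≤ j := by
    rw [← le_div_iff₀ (by positivity)]; linarith
  have hjν2 : (j:ℝ) ≤ (1 + ε / 4) * (n2 * T) := by
    rw [← div_le_iff₀ (by positivity)]; linarith
  have hnT : 0 < n2 * T := by positivity
  have hj0 : (0:ℝ) < j := lt_of_lt_of_le (mul_pos (by linarith) hnT) hjν1
  have hjη : (j:ℝ) ≤ 2 * η * T ^ 2 := by
    have : (1 + ε / 4) * (n2 * T) ≤ 2 * (η * T * T) := by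
      apply mul_le_mul (by linarith) (by gcongr) hnT.le (by norm_num)
    linarith
  set p1 : ℝ := - i * n2 + j * P1 with hp1
  refine ⟨- p1 / j, ?_⟩
  intro s hs
  set s0 := - p1 / j with hs0
  have hs0j : j * s0 + p1 = 0 := by rw [hs0]; field_simp; ring
  obtain ⟨hs1, hs2⟩ := hs
  set h := s - s0 with hh
  have hh0 : 0 ≤ h := by rw [hh]; linarith
  have hh1 : h ≤ 1 / (4 * T ^ 3) := by rw [hh]; linarith
  have hhT : h * T ^ 3 ≤ 1 / 4 := by
    calc h * T ^ 3 ≤ 1 / (4 * T ^ 3) * T ^ 3 := by gcongr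
      _ = 1 / 4 := by field_simp
  have hss : s = s0 + h := by rw [hh]; ring
  have hXv : T * (j * s + p1) = T * j * h := by rw [hss]; linear_combination T * hs0j
  have hXv0 : 0 ≤ T * j * h := by positivity
  have hXv1 : T * j * h ≤ η / 2 := by
    calc T * j * h ≤ T * (2 * η * T ^ 2) * h := by gcongr
      _ = 2 * η * (h * T ^ 3) := by ring
      _ ≤ 2 * η * (1 / 4) := by gcongr
      _ = η / 2 := by ring
  set Γ := T ^ 2 * (s * m + b * n2 - n3) with hΓ
  have hΓs0 : j * (s0 * m + b * n2 - n3) = n2 * φ := by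
    rw [hφ, hφ2]
    have : (n3:ℝ) = - (n1 * P1 + n2 * P2) := by linarith
    rw [this]
    have e1 : j * s0 = - p1 := by linarith
    have : (j:ℝ) * (s0 * m + b * n2 - -(n1 * P1 + n2 * P2)) = (j * s0) * m + j * (b * n2 + (n1 * P1 + n2 * P2)) := by ring
    rw [this, e1, hp1, hm]; ring
  have hΓ2 : Γ * j = (T * φ) * (n2 * T) + T ^ 2 * m * h * j := by
    rw [hΓ, hss]; linear_combination T ^ 2 * hΓs0
  have hε1 : ε ≤ 1 / 20 := by linarith
  rw [abs_le] at hW'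
  have hdrift0 : 0 ≤ T ^ 2 * m * h := by positivity
  have hdrift : T ^ 2 * m * h ≤ ε / 4 := by
    calc T ^ 2 * m * h ≤ T ^ 2 * (η * T) * h := by gcongr
      _ = η * (h * T ^ 3) := by ring
      _ ≤ η * (1 / 4) := by gcongr
      _ ≤ ε / 4 := by linarith
  have hΓlo : 1 - ε ≤ Γ := by
    have h1 : (1 - ε) * j ≤ Γ * j := by
      rw [hΓ2]
      have : (1 - ε) * j ≤ (1 - ε) * ((1 + ε / 4) * (n2 * T)) := by
        apply mul_le_mul_of_nonneg_left hjν2; linarith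
      have h3 : (1 - ε / 4) * (n2 * T) ≤ (T * φ) * (n2 * T) := by gcongr; linarith
      have h4 : (1 - ε) * ((1 + ε / 4) * (n2 * T)) ≤ (1 - ε / 4) * (n2 * T) := by
        rw [← mul_assoc]; exact mul_le_mul_of_nonneg_right (eps_aux1 ε hε0) hnT.le
      have : 0 ≤ T ^ 2 * m * h * j := by positivity
      linarith
    exact le_of_mul_le_mul_right h1 hj0
  have hΓhi : Γ ≤ 1 + 2 * ε := by
    have h1 : Γ * j ≤ (1 + 2 * ε) * j := by
      rw [hΓ2]
      have h3 : (T * φ) * (n2 * T) ≤ (1 + ε / 4) * (n2 * T) := by gcongr; linarith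
      have h4 : T ^ 2 * m * h * j ≤ ε / 4 * j := by gcongr
      have h5 : (1 + ε / 4) * (n2 * T) ≤ (1 + 7 / 4 * ε) * ((1 - ε / 4) * (n2 * T)) := by
        rw [← mul_assoc (1 + 7 / 4 * ε)]; exact mul_le_mul_of_nonneg_right (eps_aux2 ε hε0 hε1) hnT.le
      have h6 : (1 + 7 / 4 * ε) * ((1 - ε / 4) * (n2 * T)) ≤ (1 + 7 / 4 * ε) * j := by gcongr
      linarith
    exact le_of_mul_le_mul_right h1 hj0
  refine ⟨⟨by linarith, by linarith⟩, ?_⟩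
  intro x y z hX hY hZ
  set X := T * (z * s + x) with hXd
  set Y := T * (z * (a * s + b) + y) with hYd
  have hZ' : |(z:ℝ) / T ^ 2| ≤ d := by
    rw [abs_div, abs_of_pos (by positivity : (0:ℝ) < T ^ 2), div_le_iff₀ (by positivity)]; exact hZ
  have hn1 : |(n1:ℝ) / T| ≤ (1 + |a|) * η := by
    rw [abs_div, abs_of_pos hT0, div_le_iff₀ hT0]
    have : (n1:ℝ) = m - a * n2 := by rw [hm]; ring
    rw [this]
    refine (abs_sub _ _).trans ?_
    rw [abs_of_pos hm0, abs_mul, abs_of_pos hn2R]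
    have : |a| * n2 ≤ |a| * (η * T) := by gcongr
    linarith
  have hn2' : |(n2:ℝ) / T| ≤ η := by
    rw [abs_div, abs_of_pos hT0, abs_of_pos hn2R, div_le_iff₀ hT0]; exact hn2T
  have hNu : ((n1 * x + n2 * y + n3 * z : ℤ) : ℝ) = n1 / T * X + n2 / T * Y - z / T ^ 2 * Γ := by
    rw [hXd, hYd, hΓ, hm]; push_cast; field_simp; ring
  have hN0 : n1 * x + n2 * y + n3 * z = 0 := by
    have : |((n1 * x + n2 * y + n3 * z : ℤ) : ℝ)| < 1 := by
      rw [hNu]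
      have t1 : |n1 / T * X| ≤ (1 + |a|) * η * d := by
        rw [abs_mul]; exact mul_le_mul hn1 hX (abs_nonneg _) (by positivity)
      have t2 : |n2 / T * Y| ≤ η * d := by
        rw [abs_mul]; exact mul_le_mul hn2' hY (abs_nonneg _) (by positivity)
      have t3 : |z / T ^ 2 * Γ| ≤ d * (1 + 2 * ε) := by
        rw [abs_mul, abs_of_pos (by linarith : 0 < Γ)]
        exact mul_le_mul hZ' hΓhi (by linarith) hd0.le
      have t4 := abs_sub (n1 / T * X + n2 / T * Y) (z / T ^ 2 * Γ)
      have t5 := abs_add_le (n1 / T * X) (n2 / T * Y)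
      have t6 : d * ε ≤ 1 * ε := by gcongr
      have t7 : (1 + |a|) * η * d ≤ ε * 1 := mul_le_mul haη1 hd1.le hd0.le hε0.le
      have t8 : η * d ≤ ε / 2 * 1 := mul_le_mul hηε hd1.le hd0.le (by positivity)
      have t9 : d * (1 + 2 * ε) = d + 2 * (d * ε) := by ring
      linarith
    have h2 : |n1 * x + n2 * y + n3 * z| < 1 := by exact_mod_cast this
    exact Int.abs_lt_one_iff.1 h2
  obtain ⟨i', hi'⟩ : ∃ i' : ℤ, x - z * P1 = - i' * n2 ∧ y - z * P2 = i' * n1 := by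
    have e1 : n1 * (x - z * P1) + n2 * (y - z * P2) = 0 := by linear_combination hN0 - z * hP
    have : n1 ∣ n2 * (y - z * P2) := ⟨-(x - z * P1), by linarith⟩
    obtain ⟨k, hk⟩ := hcop.dvd_of_dvd_mul_left this
    have hdn : n2 ∣ n1 * (x - z * P1) := ⟨-(y - z * P2), by linarith⟩
    obtain ⟨k', hk'⟩ := hcop.symm.dvd_of_dvd_mul_left hdn
    by_cases hn1 : n1 = 0
    · subst hn1
      have hu : IsUnit n2 := by simpa [isCoprime_zero_left] using hcop
      have : n2 = 1 := by
        rcases Int.isUnit_iff.1 hu with h | h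
        · exact h
        · omega
      subst this
      refine ⟨-(x - z * P1), by ring, ?_⟩
      linarith
    · refine ⟨k, ?_, by rw [hk]; ring⟩
      rw [hk] at e1
      have : n1 * (x - z * P1 + k * n2) = 0 := by linear_combination e1
      rcases mul_eq_zero.1 this with h | h
      · exact absurd h hn1
      · linarith
  obtain ⟨hx', hy'⟩ := hi'
  have hxR : (x:ℝ) = z * P1 - i' * n2 := by
    have : x = z * P1 - i' * n2 := by linarith
    exact_mod_cast this
  have hyR : (y:ℝ) = z * P2 + i' * n1 := by
    have : y = z * P2 + i' * n1 := by linarith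
    exact_mod_cast this
  have hdet : X * (T * φ) - (Y - a * X) * (T * (j * s + p1)) = ((z * i - i' * j : ℤ) : ℝ) * Γ := by
    have hn3 : (n3:ℝ) = - (n1 * P1 + n2 * P2) := by linarith
    rw [hXd, hYd, hΓ, hφ, hφ2, hp1, hm, hxR, hyR, hn3]; push_cast; ring
  have hdet0 : z * i - i' * j = 0 := by
    by_contra hne
    have h1 : (1:ℝ) ≤ |((z * i - i' * j : ℤ) : ℝ)| := by
      exact_mod_cast Int.one_le_abs hne
    have h2 : Γ ≤ |((z * i - i' * j : ℤ) : ℝ) * Γ| := by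
      rw [abs_mul, abs_of_pos (by linarith : 0 < Γ)]
      exact le_mul_of_one_le_left (by linarith) h1
    rw [← hdet, hXv] at h2
    have t1 : |X * (T * φ)| ≤ d * (1 + ε / 4) := by
      rw [abs_mul]
      refine mul_le_mul hX ?_ (abs_nonneg _) hd0.le
      rw [abs_le]; constructor <;> linarith
    have t2 : |(Y - a * X) * (T * j * h)| ≤ ((1 + |a|) * d) * (η / 2) := by
      rw [abs_mul, abs_of_nonneg hXv0]
      refine mul_le_mul ?_ hXv1 hXv0 (by positivity)
      refine (abs_sub _ _).trans ?_
      rw [abs_mul a X]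
      have : |a| * |X| ≤ |a| * d := by gcongr
      linarith
    have t3 := abs_sub (X * (T * φ)) ((Y - a * X) * (T * j * h))
    have t4 : d * ε ≤ 1 * ε := by gcongr
    have t5 : d * ((1 + |a|) * η) ≤ 1 * ε := mul_le_mul hd1.le haη1 (by positivity) zero_le_one
    have t6 : d * (1 + ε / 4) = d + d * ε / 4 := by ring
    have t7 : ((1 + |a|) * d) * (η / 2) = d * ((1 + |a|) * η) / 2 := by ring
    linarith
  -- u is a multiple of v
  have hij2 : z * i = i' * j := by linarith
  have : j ∣ z * i := ⟨i', by linarith⟩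
  obtain ⟨k, hk⟩ := hij.symm.dvd_of_dvd_mul_right this
  have hjZ : j ≠ 0 := by rintro rfl; simp at hj0
  have hi'k : i' = k * i := by
    rw [hk] at hij2
    have : j * (k * i - i') = 0 := by linear_combination hij2
    rcases mul_eq_zero.1 this with h | h
    · exact absurd h hjZ
    · linarith
  have hYk : Y = k * (T * φ + a * (T * (j * s + p1))) := by
    rw [hYd, hyR, hφ, hφ2, hp1, hm, hi'k, hk]; push_cast; ring
  by_contra hz
  have hk0 : k ≠ 0 := by rintro rfl; simp at hk; exact hz hk
  have hk1 : (1:ℝ) ≤ |(k:ℝ)| := by exact_mod_cast Int.one_le_abs hk0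
  rw [hYk, abs_mul, hXv] at hY
  have t1 : 1 - ε ≤ |T * φ + a * (T * j * h)| := by
    refine le_trans ?_ (le_abs_self _)
    have : |a * (T * j * h)| ≤ |a| * (η / 2) := by
      rw [abs_mul, abs_of_nonneg hXv0]; gcongr
    rw [abs_le] at this
    linarith
  have t2 : 1 * |T * φ + a * (T * j * h)| ≤ |(k:ℝ)| * |T * φ + a * (T * j * h)| := by gcongr
  linarith


/-- integers in `(x,y]` -/
noncomputable def zI (x y : ℝ) : Finset ℤ := Finset.Ioc ⌊x⌋ ⌊y⌋

lemma mem_zI {x y : ℝ} {n : ℤ} : n ∈ zI x y ↔ x < n ∧ (n:ℝ) ≤ y := by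
  simp [zI, Int.floor_lt, Int.le_floor]

lemma zI_card_lower (x y : ℝ) : y - x - 1 ≤ (zI x y).card := by
  have f1 := Int.floor_le x
  have f2 := Int.lt_floor_add_one y
  have : ((⌊y⌋ - ⌊x⌋ : ℤ) : ℝ) ≤ (((⌊y⌋ - ⌊x⌋).toNat : ℤ) : ℝ) := by
    exact_mod_cast Int.self_le_toNat _
  simp only [zI, Int.card_Ioc]
  push_cast at this ⊢
  linarith

lemma zI_card_upper (x y : ℝ) (h : x ≤ y) : ((zI x y).card : ℝ) ≤ y - x + 1 := by
  have f1 := Int.lt_floor_add_one x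
  have f2 := Int.floor_le y
  have h3 : (((⌊y⌋ - ⌊x⌋).toNat : ℤ) : ℝ) = ((⌊y⌋ - ⌊x⌋ : ℤ) : ℝ) := by
    rw [Int.toNat_of_nonneg (by have := Int.floor_le_floor h; linarith)]
  simp only [zI, Int.card_Ioc]
  rw [Int.cast_natCast] at h3
  rw [h3]; push_cast; linarith

lemma zI_mult (x y : ℝ) (h : x ≤ y) (i : ℤ) (hi : 0 < i) :
    (((zI x y).filter (i ∣ ·)).card : ℝ) ≤ (y - x) / i + 1 := by
  have hiR : (0:ℝ) < i := by exact_mod_cast hi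
  have : (zI x y).filter (i ∣ ·) ⊆ (zI (x / i) (y / i)).image (i * ·) := by
    intro n hn
    rw [Finset.mem_filter, mem_zI] at hn
    obtain ⟨⟨h1, h2⟩, k, rfl⟩ := hn
    rw [Finset.mem_image]
    refine ⟨k, ?_, rfl⟩
    push_cast at h1 h2
    rw [mem_zI, div_lt_iff₀ hiR, le_div_iff₀ hiR]
    constructor <;> linarith
  have h2 := (Finset.card_le_card this).trans Finset.card_image_le
  have h3 : x / i ≤ y / i := by gcongr
  have h4 := zI_card_upper _ _ h3
  have h5 : (((zI x y).filter (i ∣ ·)).card : ℝ) ≤ (zI (x/i) (y/i)).card := by exact_mod_cast h2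
  rw [sub_div]; linarith

lemma sum_inv_sq (N : ℕ) (hN : 2 ≤ N) :
    ∑ i ∈ Finset.Icc 2 N, (1 / (i:ℝ) ^ 2) ≤ 3 / 4 - 1 / (N:ℝ) := by
  induction N, hN using Nat.le_induction with
  | base => norm_num
  | succ n hn ih =>
    rw [← Finset.insert_Icc_right_eq_Icc_add_one (by omega), Finset.sum_insert (by simp)]
    have hn' : (2:ℝ) ≤ n := by exact_mod_cast hn
    have : 1 / ((n + 1 : ℕ) : ℝ) ^ 2 ≤ 1 / (n:ℝ) - 1 / ((n + 1 : ℕ) : ℝ) := by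
      push_cast
      rw [div_sub_div _ _ (by positivity) (by positivity), div_le_div_iff₀ (by positivity) (by positivity)]
      nlinarith
    linarith

lemma sum_inv_le_log (N : ℕ) (hN : 1 ≤ N) :
    ∑ i ∈ Finset.Icc 2 N, (1 / (i:ℝ)) ≤ Real.log N := by
  induction N, hN using Nat.le_induction with
  | base => simp
  | succ n hn ih =>
    rw [← Finset.insert_Icc_right_eq_Icc_add_one (by omega), Finset.sum_insert (by simp)]
    have hn' : (1:ℝ) ≤ n := by exact_mod_cast hn
    have h := Real.one_sub_inv_le_log_of_pos (x := ((n:ℝ) + 1) / n) (by positivity)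
    rw [Real.log_div (by positivity) (by positivity)] at h
    have e : 1 - (((n:ℝ) + 1) / n)⁻¹ = 1 / ((n + 1 : ℕ) : ℝ) := by
      push_cast; field_simp; ring
    rw [e] at h
    push_cast at *
    linarith

lemma pair_count (a B M : ℝ) (hM : 2 ≤ M) (hMB : M ≤ B) :
    ∃ P : Finset (ℤ × ℤ), (∀ N ∈ P, B / 2 < N.2 ∧ (N.2:ℝ) ≤ B ∧ M / 2 < N.1 + a * N.2 ∧
      N.1 + a * N.2 ≤ M ∧ IsCoprime N.1 N.2) ∧
      B * M / 16 - B * (2 + Real.log B) ≤ P.card := by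
  classical
  set A : ℤ → Finset ℤ := fun n2 => zI (M / 2 - a * n2) (M - a * n2) with hA
  set S := (zI (B / 2) B).sigma A with hS
  set Sc := S.filter (fun x => IsCoprime x.2 x.1) with hSc
  set Sn := S.filter (fun x => ¬ IsCoprime x.2 x.1) with hSn
  have hcard : Sc.card + Sn.card = S.card := Finset.card_filter_add_card_filter_not _
  have hB : 2 ≤ B := hM.trans hMB
  have hSlow : (B / 2 - 1) * (M / 2 - 1) ≤ S.card := by
    rw [hS, Finset.card_sigma]
    push_cast
    have h1 := zI_card_lower (B / 2) B
    calc (B / 2 - 1) * (M / 2 - 1) ≤ (zI (B / 2) B).card * (M / 2 - 1) := by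
          apply mul_le_mul_of_nonneg_right <;> linarith
      _ = ∑ _n ∈ zI (B / 2) B, (M / 2 - 1) := by rw [Finset.sum_const, nsmul_eq_mul]
      _ ≤ _ := by
        apply Finset.sum_le_sum
        intro n _
        have := zI_card_lower (M / 2 - a * n) (M - a * n)
        simp only [hA]; linarith
  set N := ⌊B⌋₊ with hN
  have hN2 : 2 ≤ N := by rw [hN]; apply Nat.le_floor; exact_mod_cast hB
  have hNB : (N:ℝ) ≤ B := Nat.floor_le (by linarith)
  have hSnup : (Sn.card : ℝ) ≤ ∑ i ∈ Finset.Icc 2 N, (B / 2 / i + 1) * (M / 2 / i + 1) := by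
    have hsub : Sn ⊆ (Finset.Icc 2 N).biUnion (fun i : ℕ =>
        ((zI (B / 2) B).filter (fun n => (i:ℤ) ∣ n)).sigma
          (fun n2 => (A n2).filter (fun n => (i:ℤ) ∣ n))) := by
      rintro ⟨n2, n1⟩ hn
      rw [hSn, Finset.mem_filter, hS, Finset.mem_sigma] at hn
      obtain ⟨⟨h1, h2⟩, h3⟩ := hn
      dsimp only at h1 h2 h3
      have h1' := mem_zI.1 h1
      have hn2 : 0 < n2 := by
        have : (0:ℝ) < n2 := by linarith
        exact_mod_cast this
      rw [Int.isCoprime_iff_gcd_eq_one] at h3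
      have hg0 : 0 < Int.gcd n1 n2 := Int.gcd_pos_of_ne_zero_right _ hn2.ne'
      have hdvd : (Int.gcd n1 n2 : ℤ) ∣ n2 := Int.gcd_dvd_right ..
      have hle : (Int.gcd n1 n2 : ℤ) ≤ n2 := Int.le_of_dvd hn2 hdvd
      rw [Finset.mem_biUnion]
      refine ⟨Int.gcd n1 n2, ?_, ?_⟩
      · rw [Finset.mem_Icc]
        refine ⟨by omega, ?_⟩
        rw [hN]; apply Nat.le_floor
        have : ((Int.gcd n1 n2 : ℤ) : ℝ) ≤ n2 := by exact_mod_cast hle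
        push_cast at this
        linarith
      · rw [Finset.mem_sigma, Finset.mem_filter, Finset.mem_filter]
        exact ⟨⟨h1, hdvd⟩, h2, Int.gcd_dvd_left ..⟩
    have h1 : Sn.card ≤ _ := (Finset.card_le_card hsub).trans Finset.card_biUnion_le
    calc (Sn.card : ℝ) ≤ _ := Nat.cast_le.2 h1
      _ ≤ _ := by
        push_cast
        apply Finset.sum_le_sum
        intro i hi
        rw [Finset.mem_Icc] at hi
        have hi0 : (0:ℤ) < i := by omega
        have hiR : (0:ℝ) < i := by exact_mod_cast hi0
        rw [Finset.card_sigma]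
        push_cast
        have hu := zI_mult (B / 2) B (by linarith) i hi0
        calc _ ≤ ∑ n ∈ (zI (B / 2) B).filter (fun n => (i:ℤ) ∣ n), (M / 2 / i + 1) := by
              apply Finset.sum_le_sum
              intro n _
              have := zI_mult (M / 2 - a * n) (M - a * n) (by linarith) i hi0
              simp only [hA]
              push_cast at this
              have e : M - a * n - (M / 2 - a * n) = M / 2 := by ring
              rw [e] at this; exact this
          _ = ((zI (B / 2) B).filter (fun n => (i:ℤ) ∣ n)).card * (M / 2 / i + 1) := by rw [Finset.sum_const, nsmul_eq_mul]
          _ ≤ _ := by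
            gcongr
            push_cast at hu
            have e : B - B / 2 = B / 2 := by ring
            rw [e] at hu; exact hu
  have hsum : ∑ i ∈ Finset.Icc 2 N, (B / 2 / i + 1) * (M / 2 / i + 1)
      = B * M / 4 * ∑ i ∈ Finset.Icc 2 N, (1 / (i:ℝ) ^ 2)
        + (B + M) / 2 * ∑ i ∈ Finset.Icc 2 N, (1 / (i:ℝ)) + ((N:ℝ) - 1) := by
    have : ((N:ℝ) - 1) = ∑ i ∈ Finset.Icc 2 N, (1:ℝ) := by
      simp; rw [Nat.cast_sub (by omega)]; push_cast; ring
    rw [this, Finset.mul_sum, Finset.mul_sum, ← Finset.sum_add_distrib, ← Finset.sum_add_distrib]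
    apply Finset.sum_congr rfl
    intro i hi
    rw [Finset.mem_Icc] at hi
    have hiR : (0:ℝ) < i := by exact_mod_cast (by omega : 0 < i)
    field_simp; ring
  have hs1 := sum_inv_sq N hN2
  have hs2 := sum_inv_le_log N (by omega)
  have hlog : Real.log N ≤ Real.log B := Real.log_le_log (by positivity) hNB
  have hlog0 : 0 ≤ Real.log B := Real.log_nonneg (by linarith)
  have b1 : B * M / 4 * ∑ i ∈ Finset.Icc 2 N, (1 / (i:ℝ) ^ 2) ≤ B * M / 4 * (3 / 4) := by
    gcongr
    have : 0 ≤ 1 / (N:ℝ) := by positivity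
    linarith
  have b2 : (B + M) / 2 * ∑ i ∈ Finset.Icc 2 N, (1 / (i:ℝ)) ≤ B * Real.log B := by
    apply mul_le_mul (by linarith) (by linarith) (Finset.sum_nonneg (fun i _ => by positivity)) (by linarith)
  refine ⟨Sc.image (fun x => (x.2, x.1)), ?_, ?_⟩
  · intro x hx
    rw [Finset.mem_image] at hx
    obtain ⟨⟨n2, n1⟩, hx, rfl⟩ := hx
    rw [hSc, Finset.mem_filter, hS, Finset.mem_sigma] at hx
    obtain ⟨⟨h1, h2⟩, h3⟩ := hx
    have h1 := mem_zI.1 h1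
    have h2 := mem_zI.1 h2
    dsimp only at *
    exact ⟨h1.1, h1.2, by linarith, by linarith, h3⟩
  · rw [Finset.card_image_of_injective]
    · have hcR : (Sc.card + Sn.card : ℝ) = S.card := by exact_mod_cast hcard
      nlinarith
    · rintro ⟨x, y⟩ ⟨z, w⟩ h
      simp at h
      simp [h]

lemma family_count (a b σ ℓ B M : ℝ) (hM : 2 ≤ M) (hMB : M ≤ B) (hℓM : 1 ≤ ℓ * M / 2) :
    ∃ F : Finset (ℤ × ℤ × ℤ), (∀ N ∈ F, B / 2 < N.2.1 ∧ (N.2.1:ℝ) ≤ B ∧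
      M / 2 < N.1 + a * N.2.1 ∧ N.1 + a * N.2.1 ≤ M ∧ IsCoprime N.1 N.2.1 ∧
      b * N.2.1 + σ * (N.1 + a * N.2.1) < N.2.2 ∧
      N.2.2 ≤ b * N.2.1 + (σ + ℓ) * (N.1 + a * N.2.1)) ∧
      (B * M / 16 - B * (2 + Real.log B)) * (ℓ * M / 2 - 1) ≤ F.card := by
  classical
  obtain ⟨P, hP, hPc⟩ := pair_count a B M hM hMB
  have hℓ : 0 < ℓ := by
    by_contra h
    push Not at h
    nlinarith
  set S := P.sigma (fun N => zI (b * N.2 + σ * (N.1 + a * N.2)) (b * N.2 + (σ + ℓ) * (N.1 + a * N.2))) with hS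
  refine ⟨S.image (fun x => (x.1.1, x.1.2, x.2)), ?_, ?_⟩
  · intro x hx
    rw [Finset.mem_image] at hx
    obtain ⟨⟨⟨n1, n2⟩, n3⟩, hx, rfl⟩ := hx
    rw [hS, Finset.mem_sigma] at hx
    obtain ⟨h1, h2⟩ := hx
    obtain ⟨g1, g2, g3, g4, g5⟩ := hP _ h1
    obtain ⟨k1, k2⟩ := mem_zI.1 h2
    exact ⟨g1, g2, g3, g4, g5, k1, k2⟩
  · rw [Finset.card_image_of_injective]
    · rw [hS, Finset.card_sigma]
      push_cast
      calc (B * M / 16 - B * (2 + Real.log B)) * (ℓ * M / 2 - 1) ≤ P.card * (ℓ * M / 2 - 1) := by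
            apply mul_le_mul_of_nonneg_right hPc; linarith
        _ = ∑ N ∈ P, (ℓ * M / 2 - 1) := by rw [Finset.sum_const, nsmul_eq_mul]
        _ ≤ _ := by
          apply Finset.sum_le_sum
          intro N hN
          obtain ⟨g1, g2, g3, g4, g5⟩ := hP _ hN
          have := zI_card_lower (b * N.2 + σ * (N.1 + a * N.2)) (b * N.2 + (σ + ℓ) * (N.1 + a * N.2))
          have : ℓ * (M / 2) ≤ ℓ * (N.1 + a * N.2) := by gcongr
          linarith
    · rintro ⟨⟨x1, x2⟩, y⟩ ⟨⟨z1, z2⟩, w⟩ h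
      simp at h
      simp [h]


lemma sep_card {α : Type*} (S : Finset α) (f : α → ℝ) (L g : ℝ) (hg : 0 < g)
    (hL : 0 ≤ L) (hf : ∀ x ∈ S, 0 ≤ f x ∧ f x ≤ L)
    (hsep : ∀ x ∈ S, ∀ y ∈ S, x ≠ y → g ≤ |f x - f y|) : (S.card : ℝ) ≤ 1 + L / g := by
  have h1 : S.card ≤ (Finset.range (⌊L / g⌋₊ + 1)).card := by
    apply Finset.card_le_card_of_injOn (fun x => ⌊f x / g⌋₊)
    · intro x hx
      have := hf x hx
      simp only [Finset.coe_range, Set.mem_Iio]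
      have : ⌊f x / g⌋₊ ≤ ⌊L / g⌋₊ := Nat.floor_le_floor (by gcongr; exact this.2)
      omega
    · intro x hx y hy hxy
      by_contra hne
      have h3 := hsep x hx y hy hne
      dsimp only at hxy
      have a1 := Nat.floor_le (div_nonneg (hf x hx).1 hg.le)
      have a2 := Nat.lt_floor_add_one (f x / g)
      have b1 := Nat.floor_le (div_nonneg (hf y hy).1 hg.le)
      have b2 := Nat.lt_floor_add_one (f y / g)
      rw [hxy] at a1 a2
      have : |f x / g - f y / g| < 1 := by rw [abs_lt]; constructor <;> linarith
      rw [← sub_div, abs_div, abs_of_pos hg, div_lt_one hg] at this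
      linarith
  rw [Finset.card_range] at h1
  have h2 : (S.card : ℝ) ≤ (⌊L / g⌋₊ : ℝ) + 1 := by exact_mod_cast h1
  have := Nat.floor_le (div_nonneg hL hg.le)
  linarith

lemma bad_fiber (a B M : ℝ) (hB : 0 < B) (hM : 0 < M) (p1 p2 q u1 u2 u3 : ℤ) (hq : 1 ≤ q)
    (hu : u1 * p1 + u2 * p2 + u3 * q = 1) (S : Finset (ℤ × ℤ × ℤ))
    (hS : ∀ N ∈ S, B / 2 < N.2.1 ∧ (N.2.1:ℝ) ≤ B ∧
      M / 2 < N.1 + a * N.2.1 ∧ N.1 + a * N.2.1 ≤ M ∧ IsCoprime N.1 N.2.1 ∧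
      N.1 * p1 + N.2.1 * p2 + N.2.2 * q = 0) :
    (S.card : ℝ) ≤ 1 + 2 * M * B / q := by
  have hqR : (1:ℝ) ≤ q := by exact_mod_cast hq
  have key := sep_card S (fun N => (N.1 + a * N.2.1) / N.2.1) (2 * M / B) (q / B ^ 2)
    (by positivity) (by positivity) ?_ ?_
  · refine key.trans_eq ?_
    field_simp
  · intro N hN
    obtain ⟨h1, h2, h3, h4, h5, h6⟩ := hS N hN
    have hn : (0:ℝ) < N.2.1 := by linarith
    refine ⟨div_nonneg (by linarith) hn.le, ?_⟩
    rw [div_le_div_iff₀ hn hB]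
    nlinarith
  · rintro ⟨n1, n2, n3⟩ hN ⟨k1, k2, k3⟩ hK hne
    obtain ⟨h1, h2, h3, h4, h5, h6⟩ := hS _ hN
    obtain ⟨g1, g2, g3, g4, g5, g6⟩ := hS _ hK
    dsimp only at *
    have hn : (0:ℝ) < n2 := by linarith
    have hk : (0:ℝ) < k2 := by linarith
    have hn' : 0 < n2 := by exact_mod_cast hn
    have hk' : 0 < k2 := by exact_mod_cast hk
    have hdvd : n1 * k2 - n2 * k1 = q * (u1 * (n2 * k3 - n3 * k2) + u2 * (n3 * k1 - n1 * k3)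
        + u3 * (n1 * k2 - n2 * k1)) := by
      linear_combination (-(n1 * k2 - n2 * k1)) * hu - u1 * (n2 * g6 - k2 * h6) + u2 * (n1 * g6 - k1 * h6)
    have hc0 : n1 * k2 - n2 * k1 ≠ 0 := by
      intro hc
      apply hne
      have d1 : n2 ∣ k2 := by
        apply h5.symm.dvd_of_dvd_mul_left
        exact ⟨k1, by linarith⟩
      have d2 : k2 ∣ n2 := by
        apply g5.symm.dvd_of_dvd_mul_left
        exact ⟨n1, by linarith⟩
      have e2 : n2 = k2 := Int.dvd_antisymm hn'.le hk'.le d1 d2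
      subst e2
      have e1 : n1 = k1 := by
        have : n2 * (n1 - k1) = 0 := by linarith
        rcases mul_eq_zero.1 this with h | h <;> omega
      subst e1
      have e3 : n3 = k3 := by
        have : q * (n3 - k3) = 0 := by linarith
        rcases mul_eq_zero.1 this with h | h <;> omega
      rw [e3]
    have hqc : q ≤ |n1 * k2 - n2 * k1| := by
      apply Int.le_of_dvd (abs_pos.2 hc0)
      rw [dvd_abs]; exact ⟨_, hdvd⟩
    have hqcR : (q:ℝ) ≤ |(n1 * k2 - n2 * k1 : ℝ)| := by exact_mod_cast hqc
    have e : ((n1:ℝ) + a * n2) / n2 - (k1 + a * k2) / k2 = (n1 * k2 - n2 * k1) / (n2 * k2) := by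
      field_simp; ring
    rw [e, abs_div, abs_of_pos (by positivity : (0:ℝ) < n2 * k2)]
    apply div_le_div₀ (abs_nonneg _) hqcR (by positivity)
    rw [sq]; gcongr

/-- degenerate normals -/
def BadN (a b h w : ℝ) (n1 n2 n3 : ℤ) : Prop :=
  ∃ p1 p2 q : ℤ, ¬ (p1 = 0 ∧ p2 = 0 ∧ q = 0) ∧ n1 * p1 + n2 * p2 + n3 * q = 0 ∧
    |q * b + p2 - a * p1| ≤ h ∧ |(q:ℝ)| ≤ w * n2

lemma bad_primitive (a b h w B M σ ℓ : ℝ) (hB : 0 < B) (hM : 0 < M) (hh : h < 1 / 2)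
    (hBM : 2 * B * h < M) (n1 n2 n3 : ℤ)
    (h1 : B / 2 < n2) (h2 : (n2:ℝ) ≤ B) (h3 : M / 2 < n1 + a * n2)
    (h6 : b * n2 + σ * (n1 + a * n2) < n3) (h7 : n3 ≤ b * n2 + (σ + ℓ) * (n1 + a * n2))
    (hbad : BadN a b h w n1 n2 n3) :
    ∃ p1 p2 q u1 u2 u3 : ℤ, 1 ≤ q ∧ u1 * p1 + u2 * p2 + u3 * q = 1 ∧
      n1 * p1 + n2 * p2 + n3 * q = 0 ∧ |q * b + p2 - a * p1| ≤ h ∧ (q:ℝ) ≤ w * n2 ∧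
      - q * σ - q * ℓ - 1 ≤ p1 ∧ (p1:ℝ) ≤ - q * σ + 1 := by
  have hn2 : (0:ℝ) < n2 := by linarith
  have hm : (0:ℝ) < n1 + a * n2 := by linarith
  have hclose : ∀ p1 p2 q : ℤ, n1 * p1 + n2 * p2 + n3 * q = 0 → |q * b + p2 - a * p1| ≤ h →
      |p1 * (n1 + a * n2) + q * (n3 - b * n2)| < n1 + a * n2 := by
    intro p1 p2 q e1 e2
    have e1R : (n1 * p1 + n2 * p2 + n3 * q : ℝ) = 0 := by exact_mod_cast e1
    have e3 : (p1 * (n1 + a * n2) + q * (n3 - b * n2) : ℝ) = - (n2 * (q * b + p2 - a * p1)) := by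
      linear_combination e1R
    rw [e3, abs_neg, abs_mul, abs_of_pos hn2]
    have hh0 : 0 ≤ h := (abs_nonneg _).trans e2
    have : n2 * |q * b + p2 - a * p1| ≤ B * h := by gcongr
    linarith
  -- sign normalised
  have hstep : ∃ p1 p2 q : ℤ, 1 ≤ q ∧ n1 * p1 + n2 * p2 + n3 * q = 0 ∧
      |q * b + p2 - a * p1| ≤ h ∧ (q:ℝ) ≤ w * n2 := by
    obtain ⟨p1, p2, q, e0, e1, e2, e3⟩ := hbad
    have hq0 : q ≠ 0 := by
      rintro rfl
      have := hclose _ _ _ e1 e2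
      simp only [Int.cast_zero, zero_mul, add_zero] at this
      rw [abs_mul, abs_of_pos hm] at this
      have hp1 : p1 = 0 := by
        by_contra hne
        have : (1:ℝ) ≤ |(p1:ℝ)| := by exact_mod_cast Int.one_le_abs hne
        nlinarith
      subst hp1
      simp at e2
      have hp2 : p2 = 0 := by
        by_contra hne
        have : (1:ℝ) ≤ |(p2:ℝ)| := by exact_mod_cast Int.one_le_abs hne
        linarith
      exact e0 ⟨rfl, hp2, rfl⟩
    rcases lt_or_gt_of_ne hq0 with hq | hq
    · refine ⟨-p1, -p2, -q, by omega, by linarith, ?_, ?_⟩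
      · rw [← abs_neg]; convert e2 using 2; push_cast; ring
      · push_cast; exact (neg_le_abs _).trans e3
    · exact ⟨p1, p2, q, by omega, e1, e2, (le_abs_self _).trans e3⟩
  obtain ⟨p1, p2, q, hq, e1, e2, e3⟩ := hstep
  -- divide by gcd
  set g1 : ℤ := ((Int.gcd p1 p2 : ℕ) : ℤ) with hg1
  set g : ℤ := ((Int.gcd g1 q : ℕ) : ℤ) with hg
  have hgpos : 0 < g := by
    rw [hg]; exact_mod_cast Int.gcd_pos_of_ne_zero_right _ (by omega)
  have hgq : g ∣ q := Int.gcd_dvd_right ..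
  have hgg1 : g ∣ g1 := Int.gcd_dvd_left ..
  have hgp1 : g ∣ p1 := hgg1.trans (Int.gcd_dvd_left ..)
  have hgp2 : g ∣ p2 := hgg1.trans (Int.gcd_dvd_right ..)
  have bz1 : g1 = p1 * Int.gcdA p1 p2 + p2 * Int.gcdB p1 p2 := Int.gcd_eq_gcd_ab p1 p2
  have bz2 : g = g1 * Int.gcdA g1 q + q * Int.gcdB g1 q := Int.gcd_eq_gcd_ab g1 q
  obtain ⟨P1, hP1⟩ := hgp1
  obtain ⟨P2, hP2⟩ := hgp2
  obtain ⟨Q, hQ⟩ := hgq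
  generalize Int.gcdA p1 p2 = x1 at bz1
  generalize Int.gcdB p1 p2 = x2 at bz1
  generalize Int.gcdA g1 q = x3 at bz2
  generalize Int.gcdB g1 q = x4 at bz2
  clear_value g g1
  subst hP1 hP2 hQ
  have hQ1 : 1 ≤ Q := by
    by_contra hc
    nlinarith
  have hgR : (1:ℝ) ≤ g := by exact_mod_cast hgpos
  have hE1 : n1 * P1 + n2 * P2 + n3 * Q = 0 := by
    have : g * (n1 * P1 + n2 * P2 + n3 * Q) = 0 := by linear_combination e1
    rcases mul_eq_zero.1 this with h | h
    · omega
    · exact h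
  have hE2 : |Q * b + P2 - a * P1| ≤ h := by
    refine le_trans ?_ e2
    have : (((g * Q : ℤ):ℝ) * b + ((g * P2 : ℤ):ℝ) - a * ((g * P1 : ℤ):ℝ)) = g * (Q * b + P2 - a * P1) := by
      push_cast; ring
    rw [this, abs_mul, abs_of_pos (by linarith : (0:ℝ) < g)]
    exact le_mul_of_one_le_left (abs_nonneg _) hgR
  have hQR : (1:ℝ) ≤ Q := by exact_mod_cast hQ1
  have hcl := hclose _ _ _ hE1 hE2
  rw [abs_lt] at hcl
  refine ⟨P1, P2, Q, x1 * x3, x2 * x3, x4, hQ1, ?_, hE1, hE2, ?_, ?_, ?_⟩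
  · have : g * (x1 * x3 * P1 + x2 * x3 * P2 + x4 * Q - 1) = 0 := by
      linear_combination -bz2 - x3 * bz1
    rcases mul_eq_zero.1 this with h | h
    · omega
    · linarith
  · refine le_trans ?_ e3
    push_cast
    exact le_mul_of_one_le_left (by linarith) hgR
  · have : (- Q * σ - Q * ℓ - 1) * (n1 + a * n2) ≤ P1 * (n1 + a * n2) := by
      have : Q * (n3 - b * n2) ≤ Q * ((σ + ℓ) * (n1 + a * n2)) := by gcongr; linarith
      linarith
    exact le_of_mul_le_mul_right this hm
  · have : P1 * (n1 + a * n2) ≤ (- Q * σ + 1) * (n1 + a * n2) := by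
      have : Q * (σ * (n1 + a * n2)) ≤ Q * (n3 - b * n2) := by gcongr; linarith
      linarith
    exact le_of_mul_le_mul_right this hm

lemma bad_count (a b h w B M σ ℓ : ℝ) (hB : 0 < B) (hM : 0 < M) (hh : h < 1 / 2) (hw : 0 ≤ w)
    (hBM : 2 * B * h < M) (F : Finset (ℤ × ℤ × ℤ))
    (hF : ∀ N ∈ F, B / 2 < N.2.1 ∧ (N.2.1:ℝ) ≤ B ∧
      M / 2 < N.1 + a * N.2.1 ∧ N.1 + a * N.2.1 ≤ M ∧ IsCoprime N.1 N.2.1 ∧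
      b * N.2.1 + σ * (N.1 + a * N.2.1) < N.2.2 ∧
      N.2.2 ≤ b * N.2.1 + (σ + ℓ) * (N.1 + a * N.2.1))
    (hbad : ∀ N ∈ F, BadN a b h w N.1 N.2.1 N.2.2) :
    ∃ V : Finset (ℤ × ℤ), (∀ x ∈ V, 1 ≤ x.1 ∧ (x.1:ℝ) ≤ w * B ∧
      - x.1 * σ - x.1 * ℓ - 1 ≤ x.2 ∧ (x.2:ℝ) ≤ - x.1 * σ + 1 ∧
      ∃ p2 : ℤ, |x.1 * b + p2 - a * x.2| ≤ h) ∧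
      (F.card : ℝ) ≤ ∑ x ∈ V, (1 + 2 * M * B / x.1) := by
  classical
  have hall : ∀ N : ℤ × ℤ × ℤ, ∃ p1 p2 q u1 u2 u3 : ℤ, N ∈ F → (1 ≤ q ∧ u1 * p1 + u2 * p2 + u3 * q = 1 ∧
      N.1 * p1 + N.2.1 * p2 + N.2.2 * q = 0 ∧ |q * b + p2 - a * p1| ≤ h ∧ (q:ℝ) ≤ w * N.2.1 ∧
      - q * σ - q * ℓ - 1 ≤ p1 ∧ (p1:ℝ) ≤ - q * σ + 1) := by
    intro N
    by_cases hN : N ∈ F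
    · obtain ⟨h1, h2, h3, h4, h5, h6, h7⟩ := hF N hN
      obtain ⟨p1, p2, q, u1, u2, u3, hyp⟩ := bad_primitive a b h w B M σ ℓ hB hM hh hBM _ _ _
        h1 h2 h3 h6 h7 (hbad N hN)
      exact ⟨p1, p2, q, u1, u2, u3, fun _ => hyp⟩
    · exact ⟨0, 0, 0, 0, 0, 0, fun h => absurd h hN⟩
  choose p1 p2 q u1 u2 u3 hv using hall
  refine ⟨F.image (fun N => (q N, p1 N)), ?_, ?_⟩
  · intro x hx
    rw [Finset.mem_image] at hx
    obtain ⟨N, hN, rfl⟩ := hx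
    obtain ⟨e1, e2, e3, e4, e5, e6, e7⟩ := hv N hN
    refine ⟨e1, e5.trans ?_, e6, e7, p2 N, e4⟩
    have := (hF N hN).2.1
    gcongr
  · rw [Finset.card_eq_sum_card_image (fun N => (q N, p1 N)) F]
    push_cast
    apply Finset.sum_le_sum
    intro x hx
    rw [Finset.mem_image] at hx
    obtain ⟨N, hN, rfl⟩ := hx
    obtain ⟨e1, e2, e3, e4, e5, e6, e7⟩ := hv N hN
    apply bad_fiber a B M hB hM (p1 N) (p2 N) (q N) (u1 N) (u2 N) (u3 N) e1 e2
    intro K hK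
    rw [Finset.mem_filter] at hK
    obtain ⟨hK, heq⟩ := hK
    simp only [Prod.mk.injEq] at heq
    obtain ⟨h1, h2, h3, h4, h5, h6, h7⟩ := hF K hK
    refine ⟨h1, h2, h3, h4, h5, ?_⟩
    obtain ⟨g1, g2, g3, g4, g5, g6, g7⟩ := hv K hK
    rw [heq.1, heq.2] at g4 g3
    have : p2 K = p2 N := by
      rw [abs_le] at g4 e4
      have : |((p2 K - p2 N : ℤ) : ℝ)| < 1 := by
        rw [abs_lt]; push_cast; constructor <;> linarith
      have h2 : |p2 K - p2 N| < 1 := by exact_mod_cast this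
      have := Int.abs_lt_one_iff.1 h2
      omega
    rw [this] at g3
    exact g3


lemma big_den (β : ℝ) (hβ : Irrational β) (X : ℝ) :
    ∃ (k : ℕ) (l : ℤ), 2 ≤ k ∧ X ≤ k ∧ IsCoprime l (k:ℤ) ∧ |β - l / k| ≤ 1 / (k:ℝ) ^ 2 := by
  have hinf := Real.infinite_rat_abs_sub_lt_one_div_den_sq_of_irrational hβ
  by_contra hcon
  push Not at hcon
  obtain ⟨Y, hY⟩ := exists_nat_ge (max X 2)
  have hYX : X ≤ Y := (le_max_left _ _).trans hY
  have hY2' : (2:ℝ) ≤ Y := (le_max_right _ _).trans hY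
  have hY2 : 2 ≤ Y := by exact_mod_cast hY2'
  obtain ⟨Z, hZ⟩ := exists_nat_ge ((|β| + 1) * Y)
  apply hinf
  refine Set.Finite.subset (((Finset.Icc (-(Z:ℤ)) Z) ×ˢ (Finset.range (Y + 1))).image
    (fun x => (x.1 : ℚ) / (x.2 : ℚ))).finite_toSet ?_
  intro r hr
  have hr' : |β - r| < 1 / (r.den:ℝ) ^ 2 := hr
  have hden : (1:ℝ) ≤ r.den := by exact_mod_cast r.den_pos
  have hrr : (r:ℝ) = r.num / r.den := by exact_mod_cast (Rat.num_div_den r).symm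
  have hdY : r.den ≤ Y := by
    by_contra hlt
    push Not at hlt
    have hltR : (Y:ℝ) < r.den := by exact_mod_cast hlt
    have := hcon r.den r.num (by omega) (by linarith) r.isCoprime_num_den
    rw [← hrr] at this
    linarith
  have hdYR : (r.den:ℝ) ≤ Y := by exact_mod_cast hdY
  rw [Finset.mem_coe, Finset.mem_image]
  refine ⟨(r.num, r.den), ?_, Rat.num_div_den r⟩
  rw [Finset.mem_product, Finset.mem_Icc, Finset.mem_range]
  have h1 : |(r:ℝ)| ≤ |β| + 1 := by
    have : 1 / (r.den:ℝ) ^ 2 ≤ 1 := by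
      rw [div_le_one (by positivity)]; nlinarith
    have h3 := abs_sub_abs_le_abs_sub (r:ℝ) β
    rw [abs_sub_comm] at h3
    linarith
  have h2 : |(r.num:ℝ)| ≤ Z := by
    have e : (r.num:ℝ) = r * r.den := by rw [hrr]; field_simp
    rw [e, abs_mul, abs_of_pos (by linarith : (0:ℝ) < r.den)]
    refine le_trans ?_ hZ
    gcongr
  have h3 : |r.num| ≤ (Z:ℤ) := by exact_mod_cast h2
  rw [abs_le] at h3
  exact ⟨h3, by dsimp only; omega⟩

lemma block_one (β c h : ℝ) (k : ℕ) (hk : 1 ≤ k) (l : ℤ) (hlk : IsCoprime l (k:ℤ)) (hh : 0 ≤ h)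
    (happ : |β - l / k| ≤ 1 / (k:ℝ) ^ 2) (S : Finset ℤ) (r0 : ℤ)
    (hS : ∀ r ∈ S, r0 ≤ r ∧ r < r0 + k ∧ ∃ z : ℤ, |r * β + c + z| ≤ h / k) :
    (S.card : ℝ) ≤ 2 * h + 3 := by
  classical
  have hkR : (1:ℝ) ≤ k := by exact_mod_cast hk
  have hall : ∀ r : ℤ, ∃ z : ℤ, r ∈ S → |r * β + c + z| ≤ h / k := by
    intro r
    by_cases hr : r ∈ S
    · obtain ⟨z, hz⟩ := (hS r hr).2.2
      exact ⟨z, fun _ => hz⟩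
    · exact ⟨0, fun h => absurd h hr⟩
  choose z hz using hall
  set y := - k * (c + r0 * β) with hy
  have h1 : S.card ≤ (Finset.Icc ⌈y - (h + 1)⌉ ⌊y + (h + 1)⌋).card := by
    apply Finset.card_le_card_of_injOn (fun r => (r - r0) * l + z r * k)
    · intro r hr
      obtain ⟨g1, g2, -⟩ := hS r hr
      have g3 := hz r hr
      have hrk : |((r:ℝ) - r0)| ≤ k := by
        have : ((r0:ℤ):ℝ) ≤ r := by exact_mod_cast g1
        have g2' : (r:ℝ) < r0 + k := by exact_mod_cast g2
        rw [abs_le]; constructor <;> linarith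
      have hmain : |(((r - r0) * l + z r * k : ℤ) : ℝ) - y| ≤ h + 1 := by
        have e : (((r - r0) * l + z r * k : ℤ) : ℝ) - y
            = k * (r * β + c + z r) - k * ((r - r0) * (β - l / k)) := by
          rw [hy]; push_cast; field_simp; ring
        rw [e]
        refine (abs_sub _ _).trans ?_
        rw [abs_mul, abs_mul, abs_mul, abs_of_pos (by linarith : (0:ℝ) < k)]
        have t1 : k * |r * β + c + z r| ≤ k * (h / k) := by gcongr
        have t2 : k * (|(r:ℝ) - r0| * |β - l / k|) ≤ k * (k * (1 / (k:ℝ) ^ 2)) := by gcongr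
        have t3 : k * (h / k) = h := by field_simp
        have t4 : (k:ℝ) * (k * (1 / (k:ℝ) ^ 2)) = 1 := by field_simp
        linarith
      rw [abs_le] at hmain
      simp only [Finset.coe_Icc, Set.mem_Icc, Int.ceil_le, Int.le_floor]
      constructor <;> linarith
    · intro r hr r' hr' heq
      obtain ⟨g1, g2, -⟩ := hS r hr
      obtain ⟨g1', g2', -⟩ := hS r' hr'
      dsimp only at heq
      have hd : (k:ℤ) ∣ l * (r - r') := ⟨z r' - z r, by linear_combination heq⟩
      have hd2 := hlk.symm.dvd_of_dvd_mul_left hd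
      have : r - r' = 0 := Int.eq_zero_of_abs_lt_dvd hd2 (by rw [abs_lt]; constructor <;> linarith)
      omega
  rw [Int.card_Icc] at h1
  have f1 := Int.le_ceil (y - (h + 1))
  have f2 := Int.floor_le (y + (h + 1))
  have h3 : (((⌊y + (h + 1)⌋ + 1 - ⌈y - (h + 1)⌉).toNat : ℤ) : ℝ) ≤ 2 * h + 3 := by
    rcases le_total 0 (⌊y + (h + 1)⌋ + 1 - ⌈y - (h + 1)⌉) with h0 | h0
    · rw [Int.toNat_of_nonneg h0]; push_cast; linarith
    · rw [Int.toNat_of_nonpos h0]; simp; linarith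
  have h4 : (S.card : ℝ) ≤ (((⌊y + (h + 1)⌋ + 1 - ⌈y - (h + 1)⌉).toNat : ℤ) : ℝ) := by
    exact_mod_cast h1
  linarith

lemma block_count (β c h x L : ℝ) (k : ℕ) (hk : 1 ≤ k) (l : ℤ) (hlk : IsCoprime l (k:ℤ)) (hh : 0 ≤ h)
    (hL : 0 ≤ L)
    (happ : |β - l / k| ≤ 1 / (k:ℝ) ^ 2) (S : Finset ℤ)
    (hS : ∀ r ∈ S, x ≤ r ∧ r ≤ x + L ∧ ∃ z : ℤ, |r * β + c + z| ≤ h / k) :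
    (S.card : ℝ) ≤ (L / k + 1) * (2 * h + 3) := by
  classical
  have hkR : (0:ℝ) < k := by exact_mod_cast hk
  set f : ℤ → ℕ := fun r => ⌊(r - x) / k⌋₊ with hf
  have himg : ((S.image f).card : ℝ) ≤ L / k + 1 := by
    have : S.image f ⊆ Finset.range (⌊L / k⌋₊ + 1) := by
      intro j hj
      rw [Finset.mem_image] at hj
      obtain ⟨r, hr, rfl⟩ := hj
      rw [Finset.mem_range]
      have : ⌊(r - x) / k⌋₊ ≤ ⌊L / k⌋₊ := by
        apply Nat.floor_le_floor
        have := (hS r hr).2.1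
        gcongr; linarith
      simp only [hf]; omega
    have h2 := Finset.card_le_card this
    rw [Finset.card_range] at h2
    have h3 : ((S.image f).card : ℝ) ≤ (⌊L / k⌋₊ : ℝ) + 1 := by exact_mod_cast h2
    have := Nat.floor_le (by positivity : 0 ≤ L / k)
    linarith
  rw [Finset.card_eq_sum_card_image f S]
  push_cast
  calc _ ≤ ∑ j ∈ S.image f, (2 * h + 3) := by
        apply Finset.sum_le_sum
        intro j _
        apply block_one β c h k hk l hlk hh happ _ ⌈x + k * j⌉
        intro r hr
        rw [Finset.mem_filter] at hr
        obtain ⟨hr, rfl⟩ := hr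
        obtain ⟨h1, h2, h3⟩ := hS r hr
        have a1 := Nat.floor_le (a := (r - x) / k) (div_nonneg (by linarith) hkR.le)
        have a2 := Nat.lt_floor_add_one (((r:ℝ) - x) / k)
        rw [le_div_iff₀ hkR] at a1
        rw [div_lt_iff₀ hkR] at a2
        refine ⟨?_, ?_, h3⟩
        · rw [Int.ceil_le]; simp only [hf]; linarith
        · have := Int.le_ceil (x + k * (f r : ℝ))
          have h5 : (r:ℝ) < ((⌈x + k * (f r : ℝ)⌉ + k : ℤ) : ℝ) := by
            push_cast; simp only [hf] at this ⊢; linarith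
          exact_mod_cast h5
    _ = (S.image f).card * (2 * h + 3) := by rw [Finset.sum_const, nsmul_eq_mul]
    _ ≤ _ := by gcongr

lemma sum_inv_int (S : Finset ℤ) (Q : ℝ) (hQ : 1 ≤ Q) (hS : ∀ q ∈ S, 1 ≤ q ∧ (q:ℝ) ≤ Q) :
    ∑ q ∈ S, (1 / (q:ℝ)) ≤ 1 + Real.log Q ∧ (S.card : ℝ) ≤ Q := by
  classical
  set N := ⌊Q⌋₊ with hN
  have hN1 : 1 ≤ N := by rw [hN]; apply Nat.le_floor; exact_mod_cast hQ
  have hNQ : (N:ℝ) ≤ Q := Nat.floor_le (by linarith)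
  have hsub : S ⊆ (Finset.Icc 1 N).image (fun i : ℕ => (i:ℤ)) := by
    intro q hq
    obtain ⟨h1, h2⟩ := hS q hq
    rw [Finset.mem_image]
    refine ⟨q.toNat, ?_, by omega⟩
    rw [Finset.mem_Icc]
    refine ⟨by omega, ?_⟩
    rw [hN]; apply Nat.le_floor
    have : ((q.toNat : ℤ) : ℝ) = q := by rw [Int.toNat_of_nonneg (by omega)]
    push_cast at this
    rw [this]; exact h2
  constructor
  · calc _ ≤ ∑ q ∈ (Finset.Icc 1 N).image (fun i : ℕ => (i:ℤ)), (1 / (q:ℝ)) := by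
          apply Finset.sum_le_sum_of_subset_of_nonneg hsub
          intro q hq _
          rw [Finset.mem_image] at hq
          obtain ⟨i, _, rfl⟩ := hq
          positivity
      _ = ∑ i ∈ Finset.Icc 1 N, (1 / (i:ℝ)) := by
          rw [Finset.sum_image (by intro x _ y _ h; simpa using h)]
          simp
      _ ≤ 1 + Real.log N := by
          rw [← Finset.insert_Icc_add_one_left_eq_Icc hN1, Finset.sum_insert (by simp)]
          have := sum_inv_le_log N hN1
          simp at this ⊢; exact this
      _ ≤ _ := by gcongr
  · have := (Finset.card_le_card hsub).trans Finset.card_image_le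
    simp at this
    have h2 : (S.card:ℝ) ≤ N := by exact_mod_cast this
    linarith

lemma fiber_sum (V : Finset (ℤ × ℤ)) (Q G A E : ℝ) (hG : 0 ≤ G)
    (hV : ∀ x ∈ V, 1 ≤ x.1 ∧ (x.1:ℝ) ≤ Q) (hQ : 1 ≤ Q) (hA : 0 ≤ A) (hE : 0 ≤ E) (W : ℝ)
    (hW : ((V.image Prod.fst).card : ℝ) ≤ W)
    (hfib : ∀ q : ℤ, 1 ≤ q → (((V.filter (fun x => x.1 = q)).image Prod.snd).card : ℝ) ≤ A * q + E) :
    ∑ x ∈ V, (1 + G / (x.1:ℝ)) ≤ A * Q * W + E * Q + A * G * W + E * G * (1 + Real.log Q) := by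
  classical
  set S := V.image Prod.fst with hS
  have hSQ : ∀ q ∈ S, 1 ≤ q ∧ (q:ℝ) ≤ Q := by
    intro q hq
    rw [hS, Finset.mem_image] at hq
    obtain ⟨x, hx, rfl⟩ := hq
    exact hV x hx
  obtain ⟨s1, s2⟩ := sum_inv_int S Q hQ hSQ
  rw [← Finset.sum_fiberwise_of_maps_to (g := Prod.fst) (t := S)
    (fun x hx => Finset.mem_image_of_mem _ hx)]
  calc _ ≤ ∑ q ∈ S, (A * Q + E + A * G + E * G * (1 / (q:ℝ))) := by
        apply Finset.sum_le_sum
        intro q hq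
        obtain ⟨hq1, hq2⟩ := hSQ q hq
        have hqR : (1:ℝ) ≤ q := by exact_mod_cast hq1
        have : ∑ x ∈ V with x.1 = q, (1 + G / (x.1:ℝ)) = (V.filter (fun x => x.1 = q)).card * (1 + G / q) := by
          rw [← nsmul_eq_mul, ← Finset.sum_const]
          apply Finset.sum_congr rfl
          intro x hx
          rw [Finset.mem_filter] at hx
          rw [hx.2]
        rw [this]
        have hf := hfib q hq1
        rw [Finset.card_image_of_injOn] at hf
        · calc _ ≤ (A * q + E) * (1 + G / q) := by gcongr
            _ = A * q + E + A * G + E * G * (1 / (q:ℝ)) := by field_simp; ring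
            _ ≤ _ := by gcongr
        · intro x hx y hy hxy
          simp at hx hy
          exact Prod.ext (hx.2.trans hy.2.symm) hxy
    _ = S.card * (A * Q + E + A * G) + E * G * ∑ q ∈ S, (1 / (q:ℝ)) := by
        rw [Finset.sum_add_distrib, Finset.sum_const, nsmul_eq_mul, Finset.mul_sum]
    _ ≤ _ := by
        have t1 : E * G * ∑ q ∈ S, (1 / (q:ℝ)) ≤ E * G * (1 + Real.log Q) := by gcongr
        have t2 : S.card * (A * Q) ≤ W * (A * Q) := by gcongr
        have t3 : S.card * E ≤ Q * E := by gcongr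
        have t4 : S.card * (A * G) ≤ W * (A * G) := by gcongr
        linarith


lemma dioph (a b : ℝ) (hab : ¬ ∃ p q : ℚ, a = (p : ℝ) ∧ b = (q : ℝ)) :
    ∃ D : ℝ, 1 ≤ D ∧ ∀ X : ℝ, ∃ k : ℕ, 2 ≤ k ∧ X ≤ k ∧ ∀ σ ℓ Q G : ℝ, 0 ≤ ℓ → ℓ ≤ 1 → 1 ≤ Q → 0 ≤ G →
      ∀ V : Finset (ℤ × ℤ), (∀ x ∈ V, 1 ≤ x.1 ∧ (x.1:ℝ) ≤ Q ∧
      - x.1 * σ - x.1 * ℓ - 1 ≤ x.2 ∧ (x.2:ℝ) ≤ - x.1 * σ + 1 ∧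
      ∃ p2 : ℤ, |x.1 * b + p2 - a * x.2| ≤ 1 / k) →
      ∑ x ∈ V, (1 + G / x.1) ≤ D * (ℓ * (Q ^ 2 + G * Q) / k + (Q + G) * (1 + Real.log Q)) := by
  by_cases ha : Irrational a
  · refine ⟨10, by norm_num, ?_⟩
    intro X
    obtain ⟨k, l, hk2, hkX, hlk, happ⟩ := big_den a ha X
    refine ⟨k, hk2, hkX, ?_⟩
    intro σ ℓ Q G hℓ0 hℓ1 hQ hG V hV
    have hkR : (2:ℝ) ≤ k := by exact_mod_cast hk2
    have hlog : 0 ≤ Real.log Q := Real.log_nonneg hQ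
    have key := fiber_sum V Q G (5 * ℓ / k) 10 hG (fun x hx => ⟨(hV x hx).1, (hV x hx).2.1⟩) hQ
      (by positivity) (by norm_num) Q ?_ ?_
    · refine key.trans ?_
      have e : 5 * ℓ / k * Q * Q + 10 * Q + 5 * ℓ / k * G * Q + 10 * G * (1 + Real.log Q)
        = 5 * (ℓ * (Q ^ 2 + G * Q) / k) + 10 * Q + 10 * G * (1 + Real.log Q) := by ring
      rw [e]
      have : 0 ≤ ℓ * (Q ^ 2 + G * Q) / k := by positivity
      have : 0 ≤ Q * Real.log Q := by positivity
      linarith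
    · refine (sum_inv_int _ Q hQ ?_).2
      intro q hq
      rw [Finset.mem_image] at hq
      obtain ⟨x, hx, rfl⟩ := hq
      exact ⟨(hV x hx).1, (hV x hx).2.1⟩
    · intro q hq
      have hqR : (1:ℝ) ≤ q := by exact_mod_cast hq
      have := block_count a (- q * b) 1 (- q * σ - q * ℓ - 1) (q * ℓ + 2) k (by omega) l hlk
        zero_le_one (by positivity) happ ((V.filter (fun x => x.1 = q)).image Prod.snd) ?_
      · refine this.trans ?_
        have h2 : 2 / (k:ℝ) ≤ 1 := by rw [div_le_one (by positivity)]; exact hkR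
        have e : ((q * ℓ + 2) / k + 1) * (2 * 1 + 3) = 5 * ℓ / k * q + 5 * (2 / k) + 5 := by ring
        rw [e]; linarith
      · intro r hr
        rw [Finset.mem_image] at hr
        obtain ⟨x, hx, rfl⟩ := hr
        rw [Finset.mem_filter] at hx
        obtain ⟨hx, rfl⟩ := hx
        obtain ⟨h1, h2, h3, h4, p2, h5⟩ := hV x hx
        refine ⟨h3, by linarith, -p2, ?_⟩
        rw [← abs_neg]
        convert h5 using 2
        push_cast; ring
  · have ha' : ∃ r : ℚ, (r:ℝ) = a := by
      unfold Irrational at ha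
      push Not at ha
      exact ha
    obtain ⟨r, hr⟩ := ha'
    have hb : Irrational b := by
      rintro ⟨s, hs⟩
      exact hab ⟨r, s, hr.symm, hs.symm⟩
    have hdpos : (1:ℝ) ≤ r.den := by exact_mod_cast r.den_pos
    have hrr : (r:ℝ) = r.num / r.den := by exact_mod_cast (Rat.num_div_den r).symm
    have hβ : Irrational ((r.den : ℕ) * b) := by
      exact Irrational.natCast_mul hb r.den_ne_zero
    refine ⟨2 * r.den + 6, by linarith, ?_⟩
    intro X
    obtain ⟨k, l, hk2, hkX, hlk, happ⟩ := big_den _ hβ X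
    refine ⟨k, hk2, hkX, ?_⟩
    intro σ ℓ Q G hℓ0 hℓ1 hQ hG V hV
    have hkR : (2:ℝ) ≤ k := by exact_mod_cast hk2
    have hlog : 0 ≤ Real.log Q := Real.log_nonneg hQ
    have key := fiber_sum V Q G ℓ 3 hG (fun x hx => ⟨(hV x hx).1, (hV x hx).2.1⟩) hQ
      (by positivity) (by norm_num) ((Q / k + 1) * (2 * r.den + 3)) ?_ ?_
    · refine key.trans ?_
      have e : ℓ * Q * ((Q / k + 1) * (2 * r.den + 3)) + 3 * Q + ℓ * G * ((Q / k + 1) * (2 * r.den + 3))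
          + 3 * G * (1 + Real.log Q)
        = (2 * r.den + 3) * (ℓ * (Q ^ 2 + G * Q) / k) + (2 * r.den + 3) * (ℓ * (Q + G)) + 3 * Q + 3 * G * (1 + Real.log Q) := by ring
      rw [e]
      have t1 : 0 ≤ ℓ * (Q ^ 2 + G * Q) / k := by positivity
      have t2 : 0 ≤ Q * Real.log Q := by positivity
      have t3 : 0 ≤ G * Real.log Q := by positivity
      have t4 : (2 * r.den + 3) * (ℓ * (Q + G)) ≤ (2 * r.den + 3) * (1 * (Q + G)) := by gcongr
      have t5 : (2 * (r.den:ℝ) + 3) * (Q + G) ≤ (2 * r.den + 3) * ((Q + G) * (1 + Real.log Q)) := by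
        gcongr; linarith
      have t6 : (2 * (r.den:ℝ) + 6) * (ℓ * (Q ^ 2 + G * Q) / k + (Q + G) * (1 + Real.log Q))
        = (2 * r.den + 3) * (ℓ * (Q ^ 2 + G * Q) / k) + (2 * r.den + 3) * ((Q + G) * (1 + Real.log Q))
         + 3 * (ℓ * (Q ^ 2 + G * Q) / k) + 3 * (Q + G + Q * Real.log Q + G * Real.log Q) := by ring
      rw [t6]
      linarith
    · refine block_count (r.den * b) 0 r.den 0 Q k (by omega) l hlk (by positivity) (by linarith) happ _ ?_
      intro q hq
      rw [Finset.mem_image] at hq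
      obtain ⟨x, hx, rfl⟩ := hq
      obtain ⟨h1, h2, h3, h4, p2, h5⟩ := hV x hx
      have h1R : (1:ℝ) ≤ x.1 := by exact_mod_cast h1
      refine ⟨by linarith, by linarith, r.den * p2 - r.num * x.2, ?_⟩
      have e : (x.1 * (r.den * b) + 0 + ((r.den * p2 - r.num * x.2 : ℤ) : ℝ)) = r.den * (x.1 * b + p2 - a * x.2) := by
        rw [← hr, hrr]; push_cast; field_simp; ring
      rw [e, abs_mul, abs_of_pos (by linarith : (0:ℝ) < r.den)]
      calc _ ≤ r.den * (1 / (k:ℝ)) := by gcongr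
        _ = _ := by ring
    · intro q hq
      have hqR : (1:ℝ) ≤ q := by exact_mod_cast hq
      have := sep_card ((V.filter (fun x => x.1 = q)).image Prod.snd) (fun y => (y:ℝ) - (- q * σ - q * ℓ - 1))
        (q * ℓ + 2) 1 one_pos (by positivity) ?_ ?_
      · refine this.trans ?_
        rw [div_one]; linarith
      · intro y hy
        rw [Finset.mem_image] at hy
        obtain ⟨x, hx, rfl⟩ := hy
        rw [Finset.mem_filter] at hx
        obtain ⟨hx, rfl⟩ := hx
        obtain ⟨h1, h2, h3, h4, p2, h5⟩ := hV x hx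
        constructor <;> linarith
      · intro y _ y' _ hne
        have : (1:ℝ) ≤ |((y - y' : ℤ) : ℝ)| := by exact_mod_cast Int.one_le_abs (sub_ne_zero.2 hne)
        push_cast at this
        convert this using 2
        ring


/-- the family of normals -/
def InF (a b σ ℓ B M : ℝ) (n1 n2 n3 : ℤ) : Prop :=
  B / 2 < n2 ∧ (n2:ℝ) ≤ B ∧ M / 2 < n1 + a * n2 ∧ n1 + a * n2 ≤ M ∧ IsCoprime n1 n2 ∧
      b * n2 + σ * (n1 + a * n2) < n3 ∧ n3 ≤ b * n2 + (σ + ℓ) * (n1 + a * n2)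

lemma good_of_notbad (a b d ε η T C R σ ℓ : ℝ) (hd0 : 0 < d) (hε0 : 0 < ε)
    (hεd : ε ≤ (1 - d) / 20)
    (hη0 : 0 < η) (hη : (2 + |a|) * η ≤ ε) (hT : 1 ≤ T) (hR : 1 ≤ R)
    (hM : 2 ≤ η * T / R)
    (hLP : ∀ μ ν τ : ℝ, 0 < ν → ν ≤ μ → μ * ν ≤ 2 / R →
      (∀ i j : ℤ, (|j * τ + i * μ| ≤ C / R ∧ |j * ν| ≤ C / R) → i = 0 ∧ j = 0) →
      ∃ i j : ℤ, IsCoprime i j ∧ |j * τ + i * μ - 1| ≤ ε / 4 ∧ |j * ν - 1| ≤ ε / 4)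
    (n1 n2 n3 : ℤ) (hF : InF a b σ ℓ (η * T) (η * T / R) n1 n2 n3)
    (hnb : ¬ BadN a b (C / R / T) (C / R * T) n1 n2 n3) :
    ∃ s0 : ℝ, ∀ s ∈ Set.Icc s0 (s0 + 1 / (4 * T ^ 3)),
      (1 / 2 ≤ T ^ 2 * (s * (n1 + a * n2) + b * n2 - n3) ∧
        T ^ 2 * (s * (n1 + a * n2) + b * n2 - n3) ≤ 2) ∧
      ∀ x y z : ℤ, |T * (z * s + x)| ≤ d → |T * (z * (a * s + b) + y)| ≤ d →
        |(z:ℝ)| ≤ d * T ^ 2 → z = 0 := by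
  obtain ⟨h1, h2, h3, h4, h5, h6, h7⟩ := hF
  have hT0 : 0 < T := by linarith
  have hMB : η * T / R ≤ η * T := div_le_self (by positivity) hR
  have hn2 : (1:ℝ) < n2 := by linarith
  have hm : (1:ℝ) < n1 + a * n2 := by linarith
  have hn2' : 0 < n2 := by
    have : (0:ℝ) < n2 := by linarith
    exact_mod_cast this
  have hn20 : (0:ℝ) < n2 := by linarith
  have hm0 : (0:ℝ) < n1 + a * n2 := by linarith
  obtain ⟨u, w, huw⟩ := id h5
  have hP : n1 * (-n3 * u) + n2 * (-n3 * w) = - n3 := by linear_combination (-n3) * huw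
  have hres := hLP (T * (n1 + a * n2)) (1 / (n2 * T))
    (T * (b + ((-n3 * w : ℤ) : ℝ) - a * ((-n3 * u : ℤ) : ℝ))) (by positivity) ?_ ?_ ?_
  · obtain ⟨i, j, hij, hW, hν⟩ := hres
    exact good_interval a b d ε η T hd0 hε0 hεd hη0 hη hT n1 n2 n3 _ _ i j h5 hn2' h2
      hm0 (by linarith) hP hij hW hν
  · rw [div_le_iff₀ (by positivity)]
    have t1 : 1 * 1 ≤ T * T := by gcongr
    have t2 : 1 * 1 ≤ n2 * (n1 + a * n2) := by gcongr
    have t3 : (1 * 1) * (1 * 1) ≤ (T * T) * (n2 * (n1 + a * n2)) := by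
      apply mul_le_mul <;> nlinarith
    linarith
  · have e : T * (n1 + a * n2) * (1 / (n2 * T)) = (n1 + a * n2) / n2 := by field_simp
    rw [e, div_le_div_iff₀ hn20 (by linarith)]
    have : (n1 + a * n2) * R ≤ η * T / R * R := by gcongr
    have e2 : η * T / R * R = η * T := by field_simp
    linarith
  · intro i j hij
    obtain ⟨g1, g2⟩ := hij
    by_contra hne
    apply hnb
    refine ⟨- i * n2 + j * (-n3 * u), i * n1 + j * (-n3 * w), j, ?_, ?_, ?_, ?_⟩
    · rintro ⟨k1, k2, k3⟩
      subst k3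
      apply hne
      refine ⟨?_, rfl⟩
      simp at k1
      rcases k1 with h | h
      · exact h
      · omega
    · linear_combination j * hP
    · rw [le_div_iff₀ hT0]
      refine le_trans (le_of_eq ?_) g1
      nth_rewrite 1 [← abs_of_pos hT0]
      rw [← abs_mul]
      congr 1
      push_cast; ring
    · rw [abs_mul, abs_of_pos (by positivity : (0:ℝ) < 1 / (n2 * T)), mul_one_div,
        div_le_iff₀ (by positivity)] at g2
      linarith

lemma disjoint_aux (a b κ T B M σ ℓ s : ℝ) (hT : 0 < T) (hB : 0 < B) (hM : 0 < M) (hκ : 2 * M ≤ κ * T)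
    (n1 n2 n3 k1 k2 k3 : ℤ) (hF : InF a b σ ℓ B M n1 n2 n3) (hK : InF a b σ ℓ B M k1 k2 k3)
    (hnb : ¬ BadN a b (κ / T) (κ * T) n1 n2 n3)
    (hg1 : 1 / 2 ≤ T ^ 2 * (s * (n1 + a * n2) + b * n2 - n3))
    (hg2 : T ^ 2 * (s * (n1 + a * n2) + b * n2 - n3) ≤ 2)
    (hg3 : 1 / 2 ≤ T ^ 2 * (s * (k1 + a * k2) + b * k2 - k3))
    (hg4 : T ^ 2 * (s * (k1 + a * k2) + b * k2 - k3) ≤ 2) :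
    n1 = k1 ∧ n2 = k2 ∧ n3 = k3 := by
  by_contra hne
  apply hnb
  obtain ⟨h1, h2, h3, h4, h5, -, -⟩ := hF
  obtain ⟨g1, g2, g3, g4, g5, -, -⟩ := hK
  have hn : (0:ℝ) < n2 := by linarith
  have hk : (0:ℝ) < k2 := by linarith
  have hn' : 0 < n2 := by exact_mod_cast hn
  have hk' : 0 < k2 := by exact_mod_cast hk
  refine ⟨n2 * k3 - n3 * k2, n3 * k1 - n1 * k3, n1 * k2 - n2 * k1, ?_, by ring, ?_, ?_⟩
  · rintro ⟨c1, c2, hc⟩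
    apply hne
    have d1 : n2 ∣ k2 := by
      apply h5.symm.dvd_of_dvd_mul_left
      exact ⟨k1, by linarith⟩
    have d2 : k2 ∣ n2 := by
      apply g5.symm.dvd_of_dvd_mul_left
      exact ⟨n1, by linarith⟩
    have e2 : n2 = k2 := Int.dvd_antisymm hn'.le hk'.le d1 d2
    subst e2
    have e1 : n1 = k1 := by
      have : n2 * (n1 - k1) = 0 := by linarith
      rcases mul_eq_zero.1 this with h | h <;> omega
    have e3 : n3 = k3 := by
      have : n2 * (n3 - k3) = 0 := by linarith
      rcases mul_eq_zero.1 this with h | h <;> omega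
    exact ⟨e1, rfl, e3⟩
  · set Γ := T ^ 2 * (s * (n1 + a * n2) + b * n2 - n3) with hΓ
    set Γ' := T ^ 2 * (s * (k1 + a * k2) + b * k2 - k3) with hΓ'
    have e : (((n1 * k2 - n2 * k1 : ℤ) : ℝ) * b + ((n3 * k1 - n1 * k3 : ℤ) : ℝ)
        - a * ((n2 * k3 - n3 * k2 : ℤ) : ℝ)) = (Γ' * (n1 + a * n2) - Γ * (k1 + a * k2)) / T ^ 2 := by
      rw [hΓ, hΓ']; push_cast; field_simp; ring
    rw [e, abs_div, abs_of_pos (by positivity : (0:ℝ) < T ^ 2), div_le_div_iff₀ (by positivity) hT]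
    have t1 : Γ' * (n1 + a * n2) ≤ 2 * M := mul_le_mul hg4 h4 (by linarith) (by norm_num)
    have t2 : Γ * (k1 + a * k2) ≤ 2 * M := mul_le_mul hg2 g4 (by linarith) (by norm_num)
    have t3 : 0 ≤ Γ' * (n1 + a * n2) := mul_nonneg (by linarith) (by linarith)
    have t4 : 0 ≤ Γ * (k1 + a * k2) := mul_nonneg (by linarith) (by linarith)
    have t5 : |Γ' * (n1 + a * n2) - Γ * (k1 + a * k2)| ≤ κ * T := by
      rw [abs_le]; constructor <;> linarith
    calc _ ≤ κ * T * T := by gcongr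
      _ = _ := by ring
  · have e : (((n1 * k2 - n2 * k1 : ℤ) : ℝ)) = (n1 + a * n2) * k2 - n2 * (k1 + a * k2) := by
      push_cast; ring
    rw [e]
    have t1 : (n1 + a * n2) * k2 ≤ M * B := mul_le_mul h4 g2 hk.le hM.le
    have t2 : n2 * (k1 + a * k2) ≤ B * M := mul_le_mul h2 g4 (by linarith) hB.le
    have t3 : 0 ≤ (n1 + a * n2) * k2 := mul_nonneg (by linarith) hk.le
    have t4 : 0 ≤ n2 * (k1 + a * k2) := mul_nonneg hn.le (by linarith)
    have t5 : 2 * M * (B / 2) ≤ κ * T * n2 := mul_le_mul hκ h1.le (by positivity) (by linarith)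
    rw [abs_le]; constructor <;> linarith

lemma good_measure (a b d ε η T C R σ ℓ : ℝ) (hd0 : 0 < d) (hε0 : 0 < ε)
    (hεd : ε ≤ (1 - d) / 20)
    (hη0 : 0 < η) (hη : (2 + |a|) * η ≤ ε) (hT : 2 ≤ T) (hR : 1 ≤ R) (hC : 4 ≤ C)
    (hM : 2 ≤ η * T / R) (hℓM : 1 ≤ ℓ * (η * T / R) / 2)
    (hLP : ∀ μ ν τ : ℝ, 0 < ν → ν ≤ μ → μ * ν ≤ 2 / R →
      (∀ i j : ℤ, (|j * τ + i * μ| ≤ C / R ∧ |j * ν| ≤ C / R) → i = 0 ∧ j = 0) →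
      ∃ i j : ℤ, IsCoprime i j ∧ |j * τ + i * μ - 1| ≤ ε / 4 ∧ |j * ν - 1| ≤ ε / 4)
    (F : Finset (ℤ × ℤ × ℤ)) (hF : ∀ N ∈ F, InF a b σ ℓ (η * T) (η * T / R) N.1 N.2.1 N.2.2)
    (hnb : ∀ N ∈ F, ¬ BadN a b (C / R / T) (C / R * T) N.1 N.2.1 N.2.2) :
    ∃ G : Set ℝ, MeasurableSet G ∧ G ⊆ Set.Icc σ (σ + 2 * ℓ) ∧
      ENNReal.ofReal (F.card * (1 / (4 * T ^ 3))) ≤ MeasureTheory.volume G ∧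
      ∀ s ∈ G, ∀ x y z : ℤ, |T * (z * s + x)| ≤ d → |T * (z * (a * s + b) + y)| ≤ d →
        |(z:ℝ)| ≤ d * T ^ 2 → z = 0 := by
  have hT0 : 0 < T := by linarith
  have hall : ∀ N : ℤ × ℤ × ℤ, ∃ s0 : ℝ, N ∈ F → ∀ s ∈ Set.Icc s0 (s0 + 1 / (4 * T ^ 3)),
      (1 / 2 ≤ T ^ 2 * (s * (N.1 + a * N.2.1) + b * N.2.1 - N.2.2) ∧
        T ^ 2 * (s * (N.1 + a * N.2.1) + b * N.2.1 - N.2.2) ≤ 2) ∧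
      ∀ x y z : ℤ, |T * (z * s + x)| ≤ d → |T * (z * (a * s + b) + y)| ≤ d →
        |(z:ℝ)| ≤ d * T ^ 2 → z = 0 := by
    intro N
    by_cases hN : N ∈ F
    · obtain ⟨s0, hs0⟩ := good_of_notbad a b d ε η T C R σ ℓ hd0 hε0 hεd hη0 hη (by linarith) hR hM hLP
        _ _ _ (hF N hN) (hnb N hN)
      exact ⟨s0, fun _ => hs0⟩
    · exact ⟨0, fun h => absurd h hN⟩
  choose s0 hs0 using hall
  refine ⟨⋃ N ∈ F, Set.Icc (s0 N) (s0 N + 1 / (4 * T ^ 3)), ?_, ?_, ?_, ?_⟩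
  · exact Finset.measurableSet_biUnion _ (fun _ _ => measurableSet_Icc)
  · intro s hs
    simp only [Set.mem_iUnion] at hs
    obtain ⟨N, hN, hs⟩ := hs
    obtain ⟨⟨g1, g2⟩, -⟩ := hs0 N hN s hs
    obtain ⟨h1, h2, h3, h4, h5, h6, h7⟩ := hF N hN
    have hm : (0:ℝ) < N.1 + a * N.2.1 := by linarith
    have hT2 : (0:ℝ) < T ^ 2 := by positivity
    have hpos : 0 < s * (N.1 + a * N.2.1) + b * N.2.1 - N.2.2 := by
      by_contra hc
      push Not at hc
      nlinarith
    have hle : s * (N.1 + a * N.2.1) + b * N.2.1 - N.2.2 ≤ 1 := by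
      by_contra hc
      push Not at hc
      nlinarith
    have hℓ : 0 < ℓ := by
      by_contra h
      push Not at h
      nlinarith
    have hℓm : 1 ≤ ℓ * (N.1 + a * N.2.1) := by
      have : ℓ * (η * T / R / 2) ≤ ℓ * (N.1 + a * N.2.1) := by gcongr
      linarith
    constructor
    · have : σ * (N.1 + a * N.2.1) ≤ s * (N.1 + a * N.2.1) := by linarith
      exact le_of_mul_le_mul_right this hm
    · have : s * (N.1 + a * N.2.1) ≤ (σ + 2 * ℓ) * (N.1 + a * N.2.1) := by linarith
      exact le_of_mul_le_mul_right this hm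
  · rw [MeasureTheory.measure_biUnion_finset]
    · simp only [Real.volume_Icc, add_sub_cancel_left]
      rw [Finset.sum_const, nsmul_eq_mul, ENNReal.ofReal_mul (by positivity), ENNReal.ofReal_natCast]
    · intro N hN K hK hne
      rw [Function.onFun, Set.disjoint_left]
      intro s hsN hsK
      obtain ⟨⟨g1, g2⟩, -⟩ := hs0 N hN s hsN
      obtain ⟨⟨g3, g4⟩, -⟩ := hs0 K hK s hsK
      have hη1 : η ≤ 1 := by
        have := abs_nonneg a
        have h2 : 0 ≤ |a| * η := by positivity
        linarith
      have hκ : 2 * (η * T / R) ≤ C / R * T := by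
        have : 2 * (η * T / R) = (2 * η) / R * T := by ring
        rw [this]; gcongr; linarith
      obtain ⟨e1, e2, e3⟩ := disjoint_aux a b (C / R) T (η * T) (η * T / R) σ ℓ s hT0 (by positivity)
        (by positivity) hκ _ _ _ _ _ _ (hF N hN) (hF K hK) (hnb N hN) g1 g2 g3 g4
      exact hne (Prod.ext e1 (Prod.ext e2 e3))
    · intro _ _; exact measurableSet_Icc
  · intro s hs
    simp only [Set.mem_iUnion] at hs
    obtain ⟨N, hN, hs⟩ := hs
    exact (hs0 N hN s hs).2


lemma ev_log (A Bc c : ℝ) (hc : 0 < c) : ∀ᶠ T : ℝ in atTop, A + Bc * Real.log T ≤ c * T := by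
  have h : (fun T : ℝ => A + Bc * Real.log T) =o[atTop] (id : ℝ → ℝ) :=
    (Asymptotics.isLittleO_const_id_atTop A).add (Real.isLittleO_log_id_atTop.const_mul_left Bc)
  filter_upwards [h.def hc, eventually_gt_atTop 0] with T h1 h2
  simp only [id, Real.norm_eq_abs, abs_of_pos h2] at h1
  exact (le_abs_self _).trans h1

set_option maxHeartbeats 1600000 in
lemma core_T (a b d ε η C R D : ℝ) (hd0 : 0 < d) (hε0 : 0 < ε)
    (hεd : ε ≤ (1 - d) / 20) (hη0 : 0 < η) (hη : (2 + |a|) * η ≤ ε) (hR : 1 ≤ R) (hC : 4 ≤ C)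
    (hD : 1 ≤ D) (hRD : 512 * (D * (C ^ 3 / η + 2 * C ^ 2)) ≤ R)
    (hLP : ∀ μ ν τ : ℝ, 0 < ν → ν ≤ μ → μ * ν ≤ 2 / R →
      (∀ i j : ℤ, (|j * τ + i * μ| ≤ C / R ∧ |j * ν| ≤ C / R) → i = 0 ∧ j = 0) →
      ∃ i j : ℤ, IsCoprime i j ∧ |j * τ + i * μ - 1| ≤ ε / 4 ∧ |j * ν - 1| ≤ ε / 4)
    (T : ℝ) (k : ℕ) (hk2 : 2 ≤ k) (hTk : T = C / R * k) (σ ℓ : ℝ) (hℓ0 : 0 < ℓ) (hℓ1 : ℓ ≤ 1)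
    (hDio : ∀ σ ℓ Q G : ℝ, 0 ≤ ℓ → ℓ ≤ 1 → 1 ≤ Q → 0 ≤ G →
      ∀ V : Finset (ℤ × ℤ), (∀ x ∈ V, 1 ≤ x.1 ∧ (x.1:ℝ) ≤ Q ∧
      - x.1 * σ - x.1 * ℓ - 1 ≤ x.2 ∧ (x.2:ℝ) ≤ - x.1 * σ + 1 ∧
      ∃ p2 : ℤ, |x.1 * b + p2 - a * x.2| ≤ 1 / k) →
      ∑ x ∈ V, (1 + G / x.1) ≤ D * (ℓ * (Q ^ 2 + G * Q) / k + (Q + G) * (1 + Real.log Q)))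
    (hT2 : 2 ≤ T) (hM : 2 ≤ η * T / R) (hℓM : 4 ≤ ℓ * (η * T / R))
    (hE1 : 2 + Real.log (η * T) ≤ η * T / R / 32)
    (hE2 : 2 * (η * T) * (C / R / T) < η * T / R) (hE3 : C / R / T < 1 / 2)
    (hE4 : 1 ≤ C / R * T * (η * T))
    (hE5 : D * ((C / R * T * (η * T) + 2 * (η * T / R) * (η * T)) * (1 + Real.log (C / R * T * (η * T))))
      ≤ ℓ * (η * T) * (η * T / R) ^ 2 / 512) :
    ∃ G : Set ℝ, MeasurableSet G ∧ G ⊆ Set.Icc σ (σ + 2 * ℓ) ∧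
      ENNReal.ofReal (η ^ 3 / (1024 * R ^ 2) * ℓ) ≤ MeasureTheory.volume G ∧
      ∀ s ∈ G, ∀ x y z : ℤ, |T * (z * s + x)| ≤ d → |T * (z * (a * s + b) + y)| ≤ d →
        |(z:ℝ)| ≤ d * T ^ 2 → z = 0 := by
  classical
  have hT0 : 0 < T := by linarith
  have hkR : (2:ℝ) ≤ k := by exact_mod_cast hk2
  have hhk : C / R / T = 1 / k := by rw [hTk]; field_simp
  set B := η * T with hB
  set M := B / R with hMd
  have hB0 : 0 < B := by positivity
  have hM0 : 0 < M := by positivity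
  have hMB : M ≤ B := div_le_self hB0.le hR
  obtain ⟨F, hF, hFc⟩ := family_count a b σ ℓ B M hM hMB (by linarith)
  set X := ℓ * B * M ^ 2 with hX
  have hX0 : 0 < X := by positivity
  have hFcard : X / 128 ≤ F.card := by
    refine le_trans ?_ hFc
    have t1 : B * M / 32 ≤ B * M / 16 - B * (2 + Real.log B) := by
      have : B * (2 + Real.log B) ≤ B * (M / 32) := by gcongr
      linarith
    have t2 : ℓ * M / 4 ≤ ℓ * M / 2 - 1 := by linarith
    have := mul_le_mul t1 t2 (by positivity) (le_trans (by positivity) t1)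
    refine le_trans (le_of_eq ?_) this
    rw [hX]; ring
  set P : ℤ × ℤ × ℤ → Prop := fun N => BadN a b (C / R / T) (C / R * T) N.1 N.2.1 N.2.2 with hP
  have hsplit : (F.filter P).card + (F.filter (fun N => ¬ P N)).card = F.card :=
    Finset.card_filter_add_card_filter_not _
  obtain ⟨V, hV, hVc⟩ := bad_count a b (C / R / T) (C / R * T) B M σ ℓ hB0 hM0 hE3 (by positivity) hE2
    (F.filter P) (fun N hN => hF N (Finset.mem_filter.1 hN).1) (fun N hN => (Finset.mem_filter.1 hN).2)
  rw [hhk] at hV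
  have hVs := hDio σ ℓ (C / R * T * B) (2 * M * B) hℓ0.le hℓ1 hE4 (by positivity) V hV
  have hmain : D * (ℓ * ((C / R * T * B) ^ 2 + 2 * M * B * (C / R * T * B)) / k) ≤ X / 512 := by
    have e1 : D * (ℓ * ((C / R * T * B) ^ 2 + 2 * M * B * (C / R * T * B)) / k)
        = (512 * (D * (C ^ 3 / η + 2 * C ^ 2))) / R * (X / 512) := by
      rw [div_eq_mul_one_div _ (k:ℝ), ← hhk, hX, hMd, hB]
      field_simp
    rw [e1]
    have : (512 * (D * (C ^ 3 / η + 2 * C ^ 2))) / R ≤ 1 := by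
      rw [div_le_one (by linarith)]; exact hRD
    calc _ ≤ 1 * (X / 512) := by gcongr
      _ = _ := one_mul _
  have hbadc : ((F.filter P).card : ℝ) ≤ X / 256 := by
    refine (hVc.trans hVs).trans ?_
    rw [mul_add]
    linarith
  have hgood : X / 256 ≤ ((F.filter (fun N => ¬ P N)).card : ℝ) := by
    have : (((F.filter P).card : ℝ) + (F.filter (fun N => ¬ P N)).card) = F.card := by exact_mod_cast hsplit
    linarith
  obtain ⟨G, hG1, hG2, hG3, hG4⟩ := good_measure a b d ε η T C R σ ℓ hd0 hε0 hεd hη0 hη hT2 hR hC hM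
    (by rw [← hB, ← hMd]; linarith) hLP
    (F.filter (fun N => ¬ P N)) (fun N hN => hF N (Finset.mem_filter.1 hN).1)
    (fun N hN => (Finset.mem_filter.1 hN).2)
  refine ⟨G, hG1, hG2, le_trans ?_ hG3, hG4⟩
  apply ENNReal.ofReal_le_ofReal
  calc η ^ 3 / (1024 * R ^ 2) * ℓ = X / 256 * (1 / (4 * T ^ 3)) := by
        rw [hX, hMd, hB]; field_simp; norm_num
    _ ≤ _ := by gcongr

set_option maxHeartbeats 1600000 in
lemma core (a b : ℝ) (hab : ¬ ∃ p q : ℚ, a = (p : ℝ) ∧ b = (q : ℝ)) (δ : ℝ) (hδ0 : 0 < δ) (hδ1 : δ < 1) :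
    ∃ c : ℝ, 0 < c ∧ ∀ σ ℓ : ℝ, 0 < ℓ → ℓ ≤ 1 → ∀ T0 : ℝ, ∃ T : ℝ, T0 ≤ T ∧ 0 < T ∧
      ∃ G : Set ℝ, MeasurableSet G ∧ G ⊆ Set.Icc σ (σ + 2 * ℓ) ∧
      ENNReal.ofReal (c * ℓ) ≤ MeasureTheory.volume G ∧
      ∀ s ∈ G, ¬ ∃ (p : ℤ × ℤ) (q : ℤ), q ≠ 0 ∧
        max |(q:ℝ) * s + (p.1:ℝ)| |(q:ℝ) * (a * s + b) + (p.2:ℝ)| ≤ δ / T ∧ |(q:ℝ)| ≤ T ^ 2 := by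
  set d := (1 + δ) / 2 with hd
  have hd0 : 0 < d := by rw [hd]; linarith
  have hd1 : d < 1 := by rw [hd]; linarith
  have hδd : δ ≤ d * d := by rw [hd]; nlinarith [sq_nonneg (1 - δ)]
  set ε := (1 - d) / 20 with hε
  have hε0 : 0 < ε := by rw [hε]; linarith
  have ha := abs_nonneg a
  set η := ε / (2 + |a|) with hη
  have hη0 : 0 < η := by positivity
  have hηε : (2 + |a|) * η = ε := by rw [hη]; field_simp
  obtain ⟨C, R0, hC, hR0, hLP⟩ := lattice_point (ε / 4) (by positivity) (by rw [hε]; linarith)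
  obtain ⟨D, hD, hDio⟩ := dioph a b hab
  set R := max R0 (512 * (D * (C ^ 3 / η + 2 * C ^ 2))) with hR
  have hRR0 : R0 ≤ R := le_max_left _ _
  have hRD : 512 * (D * (C ^ 3 / η + 2 * C ^ 2)) ≤ R := le_max_right _ _
  have hR1 : 1 ≤ R := hR0.trans hRR0
  clear_value R η
  have hC0 : 0 < C := by linarith
  have hκ : 0 < C / R := by positivity
  refine ⟨η ^ 3 / (1024 * R ^ 2), by positivity, ?_⟩
  intro σ ℓ hℓ0 hℓ1 T0
  set g := C / R * η + 2 * η ^ 2 / R with hg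
  have ev : ∀ᶠ T : ℝ in atTop, 2 ≤ T ∧ 2 * R / η ≤ T ∧ 4 * R / (ℓ * η) ≤ T ∧
      (2 + Real.log η) + 1 * Real.log T ≤ η / R / 32 * T ∧ 2 * C + 1 ≤ T ∧ 2 * (C / R) + 1 ≤ T ∧
      1 / (C / R * η) ≤ T ∧
      D * g * (1 + Real.log (C / R * η)) + D * g * 2 * Real.log T ≤ ℓ * η ^ 3 / R ^ 2 / 512 * T ∧
      T0 / d ≤ T := by
    filter_upwards [eventually_ge_atTop (2:ℝ), eventually_ge_atTop (2 * R / η),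
      eventually_ge_atTop (4 * R / (ℓ * η)), ev_log (2 + Real.log η) 1 (η / R / 32) (by positivity),
      eventually_ge_atTop (2 * C + 1), eventually_ge_atTop (2 * (C / R) + 1),
      eventually_ge_atTop (1 / (C / R * η)),
      ev_log (D * g * (1 + Real.log (C / R * η))) (D * g * 2) (ℓ * η ^ 3 / R ^ 2 / 512) (by positivity),
      eventually_ge_atTop (T0 / d)] with T h1 h2 h3 h4 h5 h6 h7 h8 h9
    exact ⟨h1, h2, h3, h4, h5, h6, h7, h8, h9⟩
  obtain ⟨T1, hT1⟩ := eventually_atTop.1 ev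
  obtain ⟨k, hk2, hkX, hk⟩ := hDio (T1 / (C / R))
  set T := C / R * k with hT
  have hTT1 : T1 ≤ T := by
    rw [div_le_iff₀ hκ] at hkX; rw [hT]; linarith
  obtain ⟨h1, h2, h3, h4, h5, h6, h7, h8, h9⟩ := hT1 T hTT1
  clear_value T
  have hT0 : 0 < T := by linarith
  have hlogQ : Real.log (C / R * T * (η * T)) = Real.log (C / R * η) + 2 * Real.log T := by
    have : C / R * T * (η * T) = (C / R * η) * (T * T) := by ring
    rw [this, Real.log_mul (by positivity) (by positivity), Real.log_mul hT0.ne' hT0.ne']; ring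
  obtain ⟨G, hG1, hG2, hG3, hG4⟩ := core_T a b d ε η C R D hd0 hε0 le_rfl hη0 hηε.le hR1 hC hD hRD
    (fun μ ν τ => hLP R μ ν τ hRR0) T k hk2 hT σ ℓ hℓ0 hℓ1 hk h1
    (by rw [le_div_iff₀ (by positivity)]; rw [div_le_iff₀ hη0] at h2; linarith)
    (by
      rw [div_le_iff₀ (by positivity)] at h3
      rw [← mul_div_assoc, le_div_iff₀ (by positivity)]; linarith)
    (by
      rw [Real.log_mul hη0.ne' hT0.ne']
      have : η * T / R / 32 = η / R / 32 * T := by ring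
      rw [this]; linarith)
    (by
      have e : 2 * (η * T) * (C / R / T) = (η / R) * (2 * C) := by field_simp
      have e2 : η * T / R = (η / R) * T := by ring
      rw [e, e2]
      apply mul_lt_mul_of_pos_left (by linarith) (by positivity))
    (by rw [div_lt_iff₀ hT0]; linarith)
    (by
      rw [div_le_iff₀ (by positivity)] at h7
      have : C / R * T * (η * T) = T * (T * (C / R * η)) := by ring
      rw [this]; nlinarith)
    (by
      rw [hlogQ]
      have e : D * ((C / R * T * (η * T) + 2 * (η * T / R) * (η * T)) * (1 + (Real.log (C / R * η) + 2 * Real.log T)))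
        = (D * g * (1 + Real.log (C / R * η)) + D * g * 2 * Real.log T) * T ^ 2 := by
        rw [hg]; ring
      have e2 : ℓ * (η * T) * (η * T / R) ^ 2 / 512 = (ℓ * η ^ 3 / R ^ 2 / 512 * T) * T ^ 2 := by
        field_simp
      rw [e, e2]
      gcongr)
  refine ⟨d * T, ?_, by positivity, G, hG1, hG2, hG3, ?_⟩
  · rw [div_le_iff₀ hd0] at h9; linarith
  · rintro s hs ⟨p, q, hq0, hmax, hqT⟩
    apply hq0
    have hδT : T * (δ / (d * T)) ≤ d := by
      have : T * (δ / (d * T)) = δ / d := by field_simp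
      rw [this, div_le_iff₀ hd0]; exact hδd
    have m1 := (le_max_left _ _).trans hmax
    have m2 := (le_max_right _ _).trans hmax
    refine hG4 s hs p.1 p.2 q ?_ ?_ ?_
    · rw [abs_mul, abs_of_pos hT0]
      exact le_trans (by gcongr) hδT
    · rw [abs_mul, abs_of_pos hT0]
      exact le_trans (by gcongr) hδT
    · refine hqT.trans ?_
      have : (d * T) ^ 2 = d * (d * T ^ 2) := by ring
      rw [this]
      have : 0 ≤ d * T ^ 2 := by positivity
      exact mul_le_of_le_one_left this hd1.le

lemma null_of_hole (E : Set ℝ) (c : ℝ) (hc : 0 < c)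
    (h : ∀ σ ℓ : ℝ, 0 < ℓ → ℓ ≤ 1 → ∃ G : Set ℝ, MeasurableSet G ∧ G ⊆ Set.Icc σ (σ + 2 * ℓ) ∧
      ENNReal.ofReal (c * ℓ) ≤ MeasureTheory.volume G ∧ ∀ s ∈ G, s ∉ E) :
    MeasureTheory.volume E = 0 := by
  have H := Besicovitch.ae_tendsto_measure_inter_div (MeasureTheory.volume : MeasureTheory.Measure ℝ) E
  have key : ∀ x : ℝ, ¬ Tendsto (fun r => MeasureTheory.volume (E ∩ Metric.closedBall x r) /
      MeasureTheory.volume (Metric.closedBall x r)) (nhdsWithin 0 (Set.Ioi 0)) (nhds 1) := by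
    intro x ht
    have hle : (1 : ENNReal) ≤ ENNReal.ofReal (1 - c / 2) := by
      refine le_of_tendsto ht ?_
      filter_upwards [Ioc_mem_nhdsGT (show (0:ℝ) < 1 by norm_num)] with r hr
      obtain ⟨G, hG, hGs, hGv, hGE⟩ := h (x - r) r hr.1 hr.2
      have hI : Metric.closedBall x r = Set.Icc (x - r) (x - r + 2 * r) := by
        rw [Real.closedBall_eq_Icc]; congr 1; ring
      rw [hI]
      have hv : MeasureTheory.volume (Set.Icc (x - r) (x - r + 2 * r)) = ENNReal.ofReal (2 * r) := by
        rw [Real.volume_Icc]; congr 1; ring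
      rw [hv]
      have hr0 := hr.1
      apply ENNReal.div_le_of_le_mul
      calc MeasureTheory.volume (E ∩ Set.Icc (x - r) (x - r + 2 * r))
          ≤ MeasureTheory.volume (Set.Icc (x - r) (x - r + 2 * r) \ G) := by
            apply MeasureTheory.measure_mono
            rintro y ⟨hy1, hy2⟩
            exact ⟨hy2, fun hy => hGE y hy hy1⟩
        _ = ENNReal.ofReal (2 * r) - MeasureTheory.volume G := by
            rw [MeasureTheory.measure_sdiff hGs hG.nullMeasurableSet, hv]
            refine ((MeasureTheory.measure_mono hGs).trans_lt ?_).ne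
            rw [hv]; exact ENNReal.ofReal_lt_top
        _ ≤ ENNReal.ofReal (2 * r) - ENNReal.ofReal (c * r) := tsub_le_tsub_left hGv _
        _ = ENNReal.ofReal ((1 - c / 2) * (2 * r)) := by
            rw [← ENNReal.ofReal_sub _ (by positivity)]; congr 1; ring
        _ = ENNReal.ofReal (1 - c / 2) * ENNReal.ofReal (2 * r) :=
            ENNReal.ofReal_mul' (by positivity)
    rw [ENNReal.one_le_ofReal] at hle
    linarith
  have H2 : ∀ᵐ x ∂(MeasureTheory.volume.restrict E : MeasureTheory.Measure ℝ), False := by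
    filter_upwards [H] with x hx using key x hx
  rw [Filter.eventually_false_iff_eq_bot, MeasureTheory.ae_eq_bot,
    MeasureTheory.Measure.restrict_eq_zero] at H2
  exact H2

/-- **Theorem.** If `(a,b) ∉ ℚ²`, then for Lebesgue-almost every `s ∈ ℝ` the vector
`(s, as+b)` is not Dirichlet-improvable. -/
theorem ae_not_dirichlet_improvable (a b : ℝ)
    (hab : ¬ ∃ p q : ℚ, a = (p : ℝ) ∧ b = (q : ℝ)) :
    ∀ᵐ s ∂(MeasureTheory.volume : MeasureTheory.Measure ℝ),
      ¬ DirichletImprovable (s, a * s + b) := by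
  have hE : ∀ n m : ℕ, MeasureTheory.volume {s : ℝ | ∀ T : ℝ, (m:ℝ) ≤ T → 0 < T →
      ∃ (p : ℤ × ℤ) (q : ℤ), q ≠ 0 ∧
        max |(q:ℝ) * s + (p.1:ℝ)| |(q:ℝ) * (a * s + b) + (p.2:ℝ)| ≤ (1 - 1 / ((n:ℝ) + 2)) / T ∧
          |(q:ℝ)| ≤ T ^ 2} = 0 := by
    intro n m
    have hn : (0:ℝ) ≤ n := Nat.cast_nonneg n
    have h1 : 1 / ((n:ℝ) + 2) < 1 := by rw [div_lt_one (by positivity)]; linarith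
    have h2 : 0 < 1 / ((n:ℝ) + 2) := by positivity
    obtain ⟨c, hc, hcore⟩ := core a b hab (1 - 1 / ((n:ℝ) + 2)) (by linarith) (by linarith)
    refine null_of_hole _ c hc ?_
    intro σ ℓ hℓ0 hℓ1
    obtain ⟨T, hT, hT0, G, hG1, hG2, hG3, hG4⟩ := hcore σ ℓ hℓ0 hℓ1 m
    exact ⟨G, hG1, hG2, hG3, fun s hs hsE => hG4 s hs (hsE T hT hT0)⟩
  have hall : ∀ᵐ s ∂(MeasureTheory.volume : MeasureTheory.Measure ℝ), ∀ n m : ℕ,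
      ¬ ∀ T : ℝ, (m:ℝ) ≤ T → 0 < T →
      ∃ (p : ℤ × ℤ) (q : ℤ), q ≠ 0 ∧
        max |(q:ℝ) * s + (p.1:ℝ)| |(q:ℝ) * (a * s + b) + (p.2:ℝ)| ≤ (1 - 1 / ((n:ℝ) + 2)) / T ∧
          |(q:ℝ)| ≤ T ^ 2 := by
    rw [MeasureTheory.ae_all_iff]; intro n
    rw [MeasureTheory.ae_all_iff]; intro m
    rw [MeasureTheory.ae_iff]
    simpa only [not_not] using hE n m
  filter_upwards [hall] with s hs
  rintro ⟨δ, hδ0, hδ1, hδ⟩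
  obtain ⟨T0, hT0⟩ := eventually_atTop.1 hδ
  obtain ⟨m, hm⟩ := exists_nat_ge T0
  obtain ⟨n, hn⟩ := exists_nat_ge (1 / (1 - δ))
  apply hs n m
  intro T hT hTp
  obtain ⟨p, q, hq, hmax, hqT⟩ := hT0 T (hm.trans hT) hTp
  refine ⟨p, q, hq, hmax.trans ?_, hqT⟩
  have hd : 0 < 1 - δ := by linarith
  have : 1 / ((n:ℝ) + 2) ≤ 1 - δ := by
    rw [div_le_iff₀ hd] at hn
    rw [div_le_iff₀ (by positivity)]; nlinarith
  gcongr
  linarith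
end

section
/- There exists a constant C_I > 0, depending only on I = [s₁,s₂] (in fact C_I = min{(s₂−s₁)/2, (s₂−s₁)/(|s₁|+|s₂|), 1} works), such that for every (p, r, q) ∈ ℤ³ \ {(0,0,0)} and every t ≥ 0, sup_{s∈I} max( e^t·|p − (as+b)q|, e^t·|r + sq|, e^{-2t}·|q| ) ≥ C_I·e^t. (This is the statement that sup_{s∈I}‖g_tφ_{a,b}(s)v‖ ≥ C_I e^t for every nonzero v ∈ ⋀²ℤ³, since under the identification of ⋀²ℝ³ with ℝ³ via the basis (e₁∧e₂, e₁∧e₃, e₂∧e₃) the vector v = p e₁∧e₂ + r e₁∧e₃ + q e₂∧e₃ is mapped by g_tφ_{a,b}(s) to (e^t(p − (as+b)q), e^t(r + sq), e^{-2t}q).) -/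
open MeasureTheory Matrix Filter Topology ENNReal

noncomputable section

/-- `g_t = diag(e^{2t}, e^{-t}, e^{-t})`. -/
def gmat (t : ℝ) : Matrix (Fin 3) (Fin 3) ℝ :=
  Matrix.diagonal ![Real.exp (2*t), Real.exp (-t), Real.exp (-t)]

/-- `φ_{a,b}(s)`, the unipotent matrix with first row `(1, s, as+b)`. -/
def phimat (a b s : ℝ) : Matrix (Fin 3) (Fin 3) ℝ :=
  !![1, s, a*s+b; 0, 1, 0; 0, 0, 1]

/-- `sup_{s ∈ [s₁,s₂]} ‖g_t φ_{a,b}(s) v‖` for an integer vector `v`, where `ℝ³`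
carries the supremum norm. -/
def supNormOrbit (a b s₁ s₂ t : ℝ) (v : Fin 3 → ℤ) : ℝ :=
  ⨆ s : Set.Icc s₁ s₂, ‖(gmat t * phimat a b (s : ℝ)).mulVec (fun i => (v i : ℝ))‖

/-- **Lemma (exterior square bound).** There is `C_I > 0` depending only on
`I = [s₁,s₂]` — in fact `C_I = min{(s₂−s₁)/2, (s₂−s₁)/(|s₁|+|s₂|), 1}` works — such
that for every `(p,r,q) ∈ ℤ³ \ {0}` and `t ≥ 0`,
`sup_{s∈I} max(e^t|p−(as+b)q|, e^t|r+sq|, e^{-2t}|q|) ≥ C_I e^t`;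
that is, `sup_{s∈I} ‖g_t φ_{a,b}(s) v‖ ≥ C_I e^t` for every nonzero `v ∈ ⋀²ℤ³`. -/
theorem exterior_square_lower_bound (a b s₁ s₂ : ℝ) (h : s₁ < s₂) :
    ∃ CI : ℝ, 0 < CI ∧
      CI = min (min ((s₂ - s₁) / 2) ((s₂ - s₁) / (|s₁| + |s₂|))) 1 ∧
      ∀ p r q : ℤ, (p, r, q) ≠ (0, 0, 0) → ∀ t : ℝ, 0 ≤ t →
        CI * Real.exp t ≤
          ⨆ s : Set.Icc s₁ s₂,
            max (max (Real.exp t * |(p : ℝ) - (a * (s : ℝ) + b) * (q : ℝ)|)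
                     (Real.exp t * |(r : ℝ) + (s : ℝ) * (q : ℝ)|))
                (Real.exp (-2 * t) * |(q : ℝ)|) := by
  have hd : 0 < |s₁| + |s₂| := by
    rcases eq_or_ne s₁ 0 with h1 | h1
    · have : 0 < |s₂| := abs_pos.mpr (by intro h2; linarith)
      have := abs_nonneg s₁
      linarith
    · have := abs_pos.mpr h1
      have := abs_nonneg s₂
      linarith
  have hs : 0 < s₂ - s₁ := sub_pos.mpr h
  refine ⟨_, ?_, rfl, ?_⟩
  · exact lt_min (lt_min (by positivity) (by positivity)) one_pos
  intro p r q hne t _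
  set C := min (min ((s₂ - s₁) / 2) ((s₂ - s₁) / (|s₁| + |s₂|))) 1 with hC
  have hC1 : C ≤ 1 := min_le_right _ _
  have hC2 : C ≤ (s₂ - s₁) / 2 := (min_le_left _ _).trans (min_le_left _ _)
  have he : 0 < Real.exp t := Real.exp_pos t
  have hbdd : BddAbove (Set.range fun s : Set.Icc s₁ s₂ =>
      max (max (Real.exp t * |(p : ℝ) - (a * (s : ℝ) + b) * (q : ℝ)|)
                     (Real.exp t * |(r : ℝ) + (s : ℝ) * (q : ℝ)|))
                (Real.exp (-2 * t) * |(q : ℝ)|)) :=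
    (isCompact_range (by fun_prop)).bddAbove
  have key : ∀ s : Set.Icc s₁ s₂,
      (C ≤ |(p : ℝ) - (a * (s : ℝ) + b) * (q : ℝ)| ∨ C ≤ |(r : ℝ) + (s : ℝ) * (q : ℝ)|) →
      C * Real.exp t ≤ ⨆ s : Set.Icc s₁ s₂,
            max (max (Real.exp t * |(p : ℝ) - (a * (s : ℝ) + b) * (q : ℝ)|)
                     (Real.exp t * |(r : ℝ) + (s : ℝ) * (q : ℝ)|))
                (Real.exp (-2 * t) * |(q : ℝ)|) := by
    intro s hs'
    refine le_trans ?_ (le_ciSup hbdd s)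
    refine le_trans ?_ (le_max_left _ _)
    rw [mul_comm C]
    rcases hs' with h' | h'
    · exact le_trans (mul_le_mul_of_nonneg_left h' he.le) (le_max_left _ _)
    · exact le_trans (mul_le_mul_of_nonneg_left h' he.le) (le_max_right _ _)
  have hint : ∀ n : ℤ, n ≠ 0 → (1 : ℝ) ≤ |(n : ℝ)| := by
    intro n hn
    exact_mod_cast Int.one_le_abs hn
  by_cases hq : q = 0
  · apply key ⟨s₁, le_refl _, h.le⟩
    subst hq
    by_cases hp : p = 0
    · right
      have hr : r ≠ 0 := by
        rintro rfl
        exact hne (by rw [hp])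
      simpa using hC1.trans (hint r hr)
    · left
      simpa using hC1.trans (hint p hp)
  · have hq1 := hint q hq
    by_cases h1 : C ≤ |(r : ℝ) + s₁ * (q : ℝ)|
    · exact key ⟨s₁, le_refl _, h.le⟩ (Or.inr h1)
    · refine key ⟨s₂, h.le, le_refl _⟩ (Or.inr ?_)
      have e : (s₂ - s₁) * |(q : ℝ)| ≤ |(r : ℝ) + s₂ * (q : ℝ)| + |(r : ℝ) + s₁ * (q : ℝ)| := by
        rw [← abs_of_pos hs, ← abs_mul]
        refine le_trans (le_of_eq ?_) (abs_sub _ _)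
        congr 1
        ring
      have : (s₂ - s₁) ≤ (s₂ - s₁) * |(q : ℝ)| := le_mul_of_one_le_right hs.le hq1
      push Not at h1
      change C ≤ |(r : ℝ) + s₂ * (q : ℝ)|
      linarith
end
end
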